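/- Let γ be a simple closed curve in ℝ². Then there exists a homeomorphism f of ℝ² onto itself mapping γ onto the unit circle {x ∈ ℝ² : |x| = 1}. -/

import Mathlib

open Metric Set

/-- The plane `ℝ²`. -/
abbrev Plane := EuclideanSpace ℝ (Fin 2)

/-- The unit circle in the plane. -/
abbrev Circle2 := Metric.sphere (0 : Plane) 1

namespace Schoenflies

open Complex Filter Topology

/-! ### Continuous logarithms -/

/-- The function `f` has a continuous logarithm on `K`. -/
def HasLog (f : ℂ → ℂ) (K : Set ℂ) : Prop :=
  ∃ φ : ℂ → ℂ, ContinuousOn φ K ∧ ∀ z ∈ K, exp (φ z) = f z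

namespace HasLog

variable {f g : ℂ → ℂ} {K L : Set ℂ}

theorem mono (h : HasLog f L) (hKL : K ⊆ L) : HasLog f K :=
  let ⟨φ, hc, he⟩ := h
  ⟨φ, hc.mono hKL, fun z hz => he z (hKL hz)⟩

theorem congr (h : HasLog f K) (hfg : ∀ z ∈ K, f z = g z) : HasLog g K :=
  let ⟨φ, hc, he⟩ := h
  ⟨φ, hc, fun z hz => (he z hz).trans (hfg z hz)⟩

theorem mul (hf : HasLog f K) (hg : HasLog g K) : HasLog (fun z => f z * g z) K :=
  let ⟨φ, hc, he⟩ := hf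
  let ⟨ψ, hc', he'⟩ := hg
  ⟨fun z => φ z + ψ z, hc.add hc', fun z hz => by rw [exp_add, he z hz, he' z hz]⟩

theorem zpow (hf : HasLog f K) (n : ℤ) : HasLog (fun z => f z ^ n) K :=
  let ⟨φ, hc, he⟩ := hf
  ⟨fun z => n * φ z, continuousOn_const.mul hc, fun z hz => by rw [exp_int_mul, he z hz]⟩

theorem inv (hf : HasLog f K) : HasLog (fun z => (f z)⁻¹) K :=
  (hf.zpow (-1)).congr fun z _ => by simp

theorem div (hf : HasLog f K) (hg : HasLog g K) : HasLog (fun z => f z / g z) K :=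
  (hf.mul hg.inv).congr fun _ _ => (div_eq_mul_inv _ _).symm

theorem const {c : ℂ} (hc : c ≠ 0) : HasLog (fun _ => c) K :=
  ⟨fun _ => log c, continuousOn_const, fun _ _ => exp_log hc⟩

theorem of_slitPlane (hf : ContinuousOn f K) (hs : ∀ z ∈ K, f z ∈ slitPlane) : HasLog f K :=
  ⟨fun z => log (f z), hf.clog hs, fun z hz => exp_log (slitPlane_ne_zero (hs z hz))⟩

theorem of_mul_mem_slitPlane {c : ℂ} (hf : ContinuousOn f K)
    (hs : ∀ z ∈ K, c * f z ∈ slitPlane) (hc : c ≠ 0) : HasLog f K :=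
  ((of_slitPlane (f := fun z => c * f z) (continuousOn_const.mul hf) hs).mul
    (const (inv_ne_zero hc))).congr fun z _ => by field_simp

theorem comp (hf : HasLog f K) {u : ℂ → ℂ} (hu : ContinuousOn u L) (hm : MapsTo u L K) :
    HasLog (fun z => f (u z)) L :=
  let ⟨φ, hc, he⟩ := hf
  ⟨fun z => φ (u z), hc.comp hu hm, fun _ hz => he _ (hm hz)⟩

end HasLog

/-- Two lifts through `exp` of the same function on a preconnected space differ by a constant. -/
theorem sub_eq_of_exp_eq {X : Type*} [TopologicalSpace X] {S : Set X} (hS : IsPreconnected S)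
    {φ ψ : X → ℂ} (hφ : ContinuousOn φ S) (hψ : ContinuousOn ψ S)
    (h : ∀ x ∈ S, exp (φ x) = exp (ψ x)) {x y : X} (hx : x ∈ S) (hy : y ∈ S) :
    φ x - ψ x = φ y - ψ y := by
  refine hS.induction₂ (fun x y => φ x - ψ x = φ y - ψ y) (fun x hx => ?_)
    (fun x y z _ _ _ h h' => h.trans h') (fun x y _ _ h => h.symm) hx hy
  have hc : ContinuousWithinAt (fun y => φ y - ψ y) S x := (hφ x hx).sub (hψ x hx)
  have h1 : ∀ᶠ y in 𝓝[S] x, dist (φ y - ψ y) (φ x - ψ x) < 2 * Real.pi :=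
    hc (ball_mem_nhds _ (by positivity))
  filter_upwards [h1, self_mem_nhdsWithin] with y hy hyS
  obtain ⟨n, hn⟩ := exp_eq_exp_iff_exists_int.1 (h y hyS)
  obtain ⟨m, hm⟩ := exp_eq_exp_iff_exists_int.1 (h x hx)
  have e1 : φ y - ψ y = n * (2 * Real.pi * I) := by rw [hn]; ring
  have e2 : φ x - ψ x = m * (2 * Real.pi * I) := by rw [hm]; ring
  rw [e1, e2] at hy ⊢
  rw [dist_eq_norm, ← sub_mul, norm_mul] at hy
  have e3 : ‖(2 * Real.pi * I : ℂ)‖ = 2 * Real.pi := by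
    simp [abs_of_pos Real.pi_pos]
  rw [e3] at hy
  have e4 : ‖((n : ℂ) - m)‖ < 1 := by
    by_contra! hcon
    nlinarith [Real.pi_pos]
  have e5 : n - m = 0 := by
    rw [← Int.cast_sub, norm_intCast] at e4
    have : |n - m| < 1 := by exact_mod_cast e4
    exact Int.abs_lt_one_iff.1 this
  rw [show n = m by lia]

/-- A nonzero power of `z - a` has no continuous logarithm on a circle about `a`. -/
theorem not_hasLog_sphere {a : ℂ} {R : ℝ} (hR : 0 < R) {n : ℤ} (hn : n ≠ 0) :
    ¬ HasLog (fun z => (z - a) ^ n) (sphere a R) := by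
  rintro ⟨φ, hc, he⟩
  have hm : ∀ θ : ℝ, circleMap a R θ ∈ sphere a R := fun θ => circleMap_mem_sphere _ hR.le _
  have hR' : (R : ℂ) ≠ 0 := by exact_mod_cast hR.ne'
  have key := sub_eq_of_exp_eq (S := (univ : Set ℝ)) isPreconnected_univ
    (φ := fun θ => φ (circleMap a R θ)) (ψ := fun θ => log ((R : ℂ) ^ n) + n * (θ * I))
    (hc.comp (continuous_circleMap a R).continuousOn fun θ _ => hm θ) (by fun_prop)
    (fun θ _ => by
      rw [he _ (hm θ), exp_add, exp_log (zpow_ne_zero _ hR'), exp_int_mul, ← mul_zpow]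
      simp [circleMap]) (mem_univ 0) (mem_univ (2 * Real.pi))
  have e : circleMap a R (2 * Real.pi) = circleMap a R 0 := by simp [circleMap]
  simp only [e, ofReal_zero] at key
  have : (n : ℂ) * (((2 * Real.pi : ℝ) : ℂ) * I) = 0 := by linear_combination key
  simp [Real.pi_ne_zero, hn] at this

/-- Every nonvanishing continuous function on the plane has a continuous logarithm. -/
theorem hasLog_univ {F : ℂ → ℂ} (hF : Continuous F) (h0 : ∀ z, F z ≠ 0) : HasLog F univ := by
  obtain ⟨φ, hφ, -⟩ := isCoveringMapOn_exp.existsUnique_continuousMap_lifts ⟨F, hF⟩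
    (a₀ := 0) (e₀ := log (F 0)) (exp_log (h0 0)) h0
  exact ⟨φ, φ.continuous.continuousOn, fun z _ => congrFun hφ.2 z⟩

/-- Eilenberg's criterion: the winding of `z - a` along the frontier of a bounded open set
containing `a` is not that of a nonvanishing function on the closure. -/
theorem not_hasLog_frontier {U : Set ℂ} (hU : IsOpen U) (hb : Bornology.IsBounded U) {a : ℂ}
    (ha : a ∈ U) {h : ℂ → ℂ} (hc : ContinuousOn h (closure U)) (h0 : ∀ z ∈ closure U, h z ≠ 0)
    {n : ℤ} (hn : n ≠ 0) : ¬ HasLog (fun z => (z - a) ^ n / h z) (frontier U) := by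
  classical
  rintro ⟨φ, hφ, he⟩
  obtain ⟨ψ, hψ⟩ := ContinuousMap.exists_restrict_eq (Y := ℂ) (isClosed_frontier (s := U))
    ⟨(frontier U).domRestrict φ, continuousOn_iff_continuous_domRestrict.1 hφ⟩
  have hψ' : ∀ z ∈ frontier U, ψ z = φ z := fun z hz =>
    congrArg (fun f : C(frontier U, ℂ) => f ⟨z, hz⟩) hψ
  set F : ℂ → ℂ := (closure U).piecewise (fun z => h z * exp (ψ z)) (fun z => (z - a) ^ n) with hF
  have hFc : Continuous F := by
    rw [← continuousOn_univ]
    have : (univ : Set ℂ) = closure U ∪ Uᶜ := by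
      refine (eq_univ_of_forall fun z => ?_).symm
      by_cases hz : z ∈ U
      exacts [Or.inl (subset_closure hz), Or.inr hz]
    rw [this]
    refine ContinuousOn.union_of_isClosed ?_ ?_ isClosed_closure hU.isClosed_compl
    · refine ContinuousOn.congr (hc.mul (Complex.continuous_exp.comp ψ.continuous).continuousOn)
        fun z hz => ?_
      rw [hF, piecewise_eq_of_mem _ _ _ hz]; rfl
    · have : ContinuousOn (fun z : ℂ => (z - a) ^ n) Uᶜ :=
        (continuousOn_id.sub continuousOn_const).zpow₀ n fun z hz =>
          Or.inl (sub_ne_zero.2 fun hza : z = a => hz (hza ▸ ha))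
      refine this.congr fun z hz => ?_
      by_cases hz' : z ∈ closure U
      · have hfr : z ∈ frontier U := by rw [hU.frontier_eq]; exact ⟨hz', hz⟩
        rw [hF, piecewise_eq_of_mem _ _ _ hz', hψ' z hfr, he z hfr]
        field_simp [h0 z hz']
      · rw [hF, piecewise_eq_of_notMem _ _ _ hz']
  have hF0 : ∀ z, F z ≠ 0 := by
    intro z
    by_cases hz' : z ∈ closure U
    · rw [hF, piecewise_eq_of_mem _ _ _ hz']
      exact mul_ne_zero (h0 z hz') (exp_ne_zero _)
    · rw [hF, piecewise_eq_of_notMem _ _ _ hz']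
      exact zpow_ne_zero _ (sub_ne_zero.2 fun hza => hz' (subset_closure (hza ▸ ha)))
  obtain ⟨R, hR0, hR⟩ := hb.closure.subset_ball_lt 0 a
  refine not_hasLog_sphere (a := a) hR0 hn (((hasLog_univ hFc hF0).mono (subset_univ _)).congr ?_)
  intro z hz
  rw [hF, piecewise_eq_of_notMem]
  intro hz'
  have := hR hz'
  rw [mem_sphere] at hz
  rw [mem_ball] at this
  linarith

/-! ### Separation of points -/

/-- The points `a` and `b` are not separated by `K`. -/
def Joined (K : Set ℂ) (a b : ℂ) : Prop :=
  ∃ C : Set ℂ, IsPreconnected C ∧ Disjoint C K ∧ a ∈ C ∧ b ∈ C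

theorem frontier_connectedComponentIn_subset {O : Set ℂ} (hO : IsOpen O) (x : ℂ) :
    frontier (connectedComponentIn O x) ⊆ Oᶜ := by
  intro z hz hzO
  have hop : IsOpen (connectedComponentIn O x) := hO.connectedComponentIn
  rw [hop.frontier_eq] at hz
  have h1 : IsOpen (connectedComponentIn O z) := hO.connectedComponentIn
  obtain ⟨w, hw1, hw2⟩ := mem_closure_iff.1 hz.1 _ h1 (mem_connectedComponentIn hzO)
  apply hz.2
  rw [connectedComponentIn_eq hw2, ← connectedComponentIn_eq hw1]
  exact mem_connectedComponentIn hzO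

theorem _root_.IsPreconnected.mem_of_disjoint_frontier {C U : Set ℂ} (hC : IsPreconnected C)
    (hU : IsOpen U) (hd : Disjoint C (frontier U)) {a b : ℂ} (ha : a ∈ C) (haU : a ∈ U)
    (hb : b ∈ C) : b ∈ U := by
  refine hC.subset_left_of_subset_union hU isClosed_closure.isOpen_compl
    (disjoint_compl_right.mono_left subset_closure) (fun z hz => ?_) ⟨a, ha, haU⟩ hb
  by_cases hzU : z ∈ U
  · exact Or.inl hzU
  · exact Or.inr fun hz' => disjoint_left.1 hd hz (hU.frontier_eq ▸ ⟨hz', hzU⟩)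

theorem _root_.Bornology.IsBounded.not_isBounded_compl {s : Set ℂ} (hs : Bornology.IsBounded s) :
    ¬ Bornology.IsBounded sᶜ := fun h => by
  have := hs.union h
  rw [union_compl_self] at this
  exact NormedSpace.unbounded_univ ℂ ℂ this

theorem isPreconnected_compl_ball (R : ℝ) : IsPreconnected (ball (0 : ℂ) R)ᶜ := by
  rcases le_or_gt R 0 with hR | hR
  · rw [ball_eq_empty.2 hR, compl_empty]; exact isPreconnected_univ
  have : (ball (0 : ℂ) R)ᶜ = (fun p : ℝ × ℝ => circleMap 0 p.1 p.2) '' (Ici R ×ˢ univ) := by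
    ext z
    simp only [mem_compl_iff, mem_ball, dist_zero_right, not_lt, mem_image, mem_prod, mem_Ici,
      mem_univ, and_true, Prod.exists]
    constructor
    · intro hz
      exact ⟨‖z‖, z.arg, hz, by simp [circleMap]⟩
    · rintro ⟨r, θ, hr, rfl⟩
      simpa [circleMap] using hr.trans (le_abs_self r)
  rw [this]
  refine (isPreconnected_Ici.prod isPreconnected_univ).image _ (Continuous.continuousOn ?_)
  simp only [circleMap]; fun_prop

theorem hasLog_div_of_joined {K : Set ℂ} (hK : IsCompact K) {a b : ℂ} (h : Joined K a b) :
    HasLog (fun z => (z - a) / (z - b)) K := by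
  obtain ⟨C, hC, hd, ha, hb⟩ := h
  have hne : ∀ z ∈ K, ∀ x ∈ C, z - x ≠ 0 := fun z hz x hx h0 =>
    disjoint_left.1 hd hx (sub_eq_zero.1 h0 ▸ hz)
  refine hC.induction₂ (fun x y => HasLog (fun z => (z - x) / (z - y)) K) (fun x hx => ?_)
    (fun x y w hx hy hw h h' => ?_) (fun x y hx hy h => ?_) ha hb
  · obtain ⟨r, hr, hr'⟩ := Metric.isOpen_iff.1 hK.isClosed.isOpen_compl x (disjoint_left.1 hd hx)
    filter_upwards [mem_nhdsWithin_of_mem_nhds (ball_mem_nhds x (half_pos hr)),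
      self_mem_nhdsWithin] with y hy hyC
    refine HasLog.of_slitPlane (ContinuousOn.div (by fun_prop) (by fun_prop)
      fun z hz => hne z hz y hyC) fun z hz => ?_
    have h1 : (z - x) / (z - y) = 1 + (y - x) / (z - y) := by
      field_simp [hne z hz y hyC]; ring
    rw [h1]
    refine mem_slitPlane_of_norm_lt_one ?_
    rw [norm_div, div_lt_one (norm_pos_iff.2 (hne z hz y hyC))]
    rw [mem_ball, dist_eq_norm] at hy
    have h2 : r ≤ ‖z - x‖ := by
      by_contra! hlt
      exact hr' (by rwa [mem_ball, dist_eq_norm]) hz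
    have h3 : ‖z - x‖ ≤ ‖z - y‖ + ‖y - x‖ := by
      simpa using norm_add_le (z - y) (y - x)
    linarith
  · refine (h.mul h').congr fun z hz => ?_
    field_simp [hne z hz y hy]
  · exact h.inv.congr fun z _ => by rw [inv_div]

theorem hasLog_sub_of_unbounded {K : Set ℂ} (hK : IsCompact K) {C : Set ℂ}
    (hC : IsPreconnected C) (hd : Disjoint C K) (hb : ¬ Bornology.IsBounded C) {a : ℂ}
    (ha : a ∈ C) : HasLog (fun z => z - a) K := by
  obtain ⟨R, hR⟩ := hK.isBounded.subset_ball 0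
  obtain ⟨b, hbC, hbR⟩ : ∃ b ∈ C, b ∉ ball (0 : ℂ) R := by
    by_contra! hcon
    exact hb (isBounded_ball.subset hcon)
  rw [mem_ball, dist_zero_right, not_lt] at hbR
  by_cases hKe : K = ∅
  · subst hKe
    exact ⟨fun _ => 0, continuousOn_empty _, by simp⟩
  obtain ⟨z₀, hz₀⟩ := nonempty_iff_ne_empty.2 hKe
  have hR0 : 0 < R := (norm_nonneg _).trans_lt (by simpa using hR hz₀)
  have hb0 : b ≠ 0 := norm_pos_iff.1 (hR0.trans_le hbR)
  have h1 : HasLog (fun z => z - b) K := by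
    refine HasLog.of_mul_mem_slitPlane (c := -b⁻¹) (by fun_prop) (fun z hz => ?_)
      (neg_ne_zero.2 (inv_ne_zero hb0))
    have : -b⁻¹ * (z - b) = 1 + (-(z / b)) := by field_simp; ring
    rw [this]
    refine mem_slitPlane_of_norm_lt_one ?_
    rw [norm_neg, norm_div, div_lt_one (norm_pos_iff.2 hb0)]
    exact (by simpa using hR hz : ‖z‖ < R).trans_le hbR
  refine ((hasLog_div_of_joined hK ⟨C, hC, hd, ha, hbC⟩).mul h1).congr fun z hz => ?_
  have : z - b ≠ 0 := fun h0 => disjoint_left.1 hd hbC (sub_eq_zero.1 h0 ▸ hz)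
  field_simp

theorem isBounded_of_not_joined {K : Set ℂ} (hK : IsCompact K) {a b : ℂ} (ha : a ∉ K) (hb : b ∉ K)
    (h : ¬ Joined K a b) : Bornology.IsBounded (connectedComponentIn Kᶜ a) ∨
      Bornology.IsBounded (connectedComponentIn Kᶜ b) := by
  by_contra! hcon
  obtain ⟨R, hR⟩ := hK.isBounded.subset_ball 0
  have hE : Disjoint (ball (0 : ℂ) R)ᶜ K := disjoint_left.2 fun z hz hz' => hz (hR hz')
  have far : ∀ C : Set ℂ, ¬ Bornology.IsBounded C → ((ball (0 : ℂ) R)ᶜ ∩ C).Nonempty := by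
    intro C hC
    by_contra! hcon'
    refine hC (isBounded_ball.subset (s := C) (t := ball (0 : ℂ) R) fun z hz => ?_)
    by_contra hz'
    exact (eq_empty_iff_forall_notMem.1 hcon' z) ⟨hz', hz⟩
  refine h ⟨connectedComponentIn Kᶜ a ∪ (ball (0 : ℂ) R)ᶜ ∪ connectedComponentIn Kᶜ b, ?_, ?_,
    Or.inl (Or.inl (mem_connectedComponentIn ha)), Or.inr (mem_connectedComponentIn hb)⟩
  · obtain ⟨x, hx1, hx2⟩ := far _ hcon.1
    obtain ⟨y, hy1, hy2⟩ := far _ hcon.2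
    exact (isPreconnected_connectedComponentIn.union x hx2 hx1 (isPreconnected_compl_ball R)).union
      y (Or.inr hy1) hy2 isPreconnected_connectedComponentIn
  · have : ∀ x, Disjoint (connectedComponentIn Kᶜ x) K := fun x =>
      disjoint_compl_left.mono_left (connectedComponentIn_subset _ _)
    exact ((this a).union_left hE).union_left (this b)

theorem joined_of_hasLog_div {K : Set ℂ} (hK : IsCompact K) {a b : ℂ} (ha : a ∉ K) (hb : b ∉ K)
    (h : HasLog (fun z => (z - a) / (z - b)) K) : Joined K a b := by
  by_contra hcon
  have main : ∀ a b : ℂ, a ∉ K → b ∉ K → HasLog (fun z => (z - a) / (z - b)) K → ¬ Joined K a b →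
      ¬ Bornology.IsBounded (connectedComponentIn Kᶜ a) := by
    intro a b ha hb h hcon hbd
    have hfr : frontier (connectedComponentIn Kᶜ a) ⊆ K := by
      simpa using frontier_connectedComponentIn_subset hK.isClosed.isOpen_compl a
    have hbU : b ∉ closure (connectedComponentIn Kᶜ a) := by
      rw [closure_eq_self_union_frontier]
      rintro (h1 | h1)
      · exact hcon ⟨_, isPreconnected_connectedComponentIn,
          disjoint_compl_left.mono_left (connectedComponentIn_subset _ _),
          mem_connectedComponentIn ha, h1⟩
      · exact hb (hfr h1)
    refine not_hasLog_frontier (hK.isClosed.isOpen_compl.connectedComponentIn) hbd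
      (mem_connectedComponentIn ha) (h := fun z => z - b) (by fun_prop)
      (fun z hz h0 => hbU (sub_eq_zero.1 h0 ▸ hz)) one_ne_zero ?_
    exact (h.mono hfr).congr fun z _ => by rw [zpow_one]
  rcases isBounded_of_not_joined hK ha hb hcon with h1 | h1
  · exact main a b ha hb h hcon h1
  · exact main b a hb ha (h.inv.congr fun z _ => inv_div _ _)
      (fun ⟨C, h1, h2, h3, h4⟩ => hcon ⟨C, h1, h2, h4, h3⟩) h1

/-- Gluing logarithms over two closed sets with preconnected intersection. -/
theorem HasLog.union {f : ℂ → ℂ} {K L : Set ℂ} (hK : IsClosed K) (hL : IsClosed L)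
    (hKL : IsPreconnected (K ∩ L)) (h : HasLog f K) (h' : HasLog f L) : HasLog f (K ∪ L) := by
  classical
  obtain ⟨φ, hφ, he⟩ := h
  obtain ⟨ψ, hψ, he'⟩ := h'
  obtain ⟨c, hc, hcL⟩ : ∃ c : ℂ, (∀ z ∈ K ∩ L, φ z = ψ z + c) ∧ exp c = 1 := by
    rcases (K ∩ L).eq_empty_or_nonempty with h0 | ⟨x, hx⟩
    · exact ⟨0, by simp [h0], exp_zero⟩
    · refine ⟨φ x - ψ x, fun z hz => ?_, ?_⟩
      · rw [sub_eq_of_exp_eq hKL (hφ.mono inter_subset_left) (hψ.mono inter_subset_right)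
          (fun y hy => (he y hy.1).trans (he' y hy.2).symm) hx hz]
        ring
      · rw [exp_sub, he x hx.1, ← he' x hx.2, div_self (exp_ne_zero _)]
  set χ : ℂ → ℂ := K.piecewise φ fun z => ψ z + c
  have h1 : EqOn χ φ K := fun z hz => piecewise_eq_of_mem _ _ _ hz
  have h2 : EqOn χ (fun z => ψ z + c) L := fun z hz => by
    by_cases hzK : z ∈ K
    · rw [h1 hzK, hc z ⟨hzK, hz⟩]
    · exact piecewise_eq_of_notMem _ _ _ hzK
  refine ⟨χ, (hφ.congr h1).union_of_isClosed ((hψ.add continuousOn_const).congr h2) hK hL, ?_⟩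
  rintro z (hz | hz)
  · rw [h1 hz, he z hz]
  · rw [h2 hz, exp_add, hcL, mul_one, he' z hz]

/-- Janiszewski's theorem. -/
theorem Joined.union {K L : Set ℂ} (hK : IsCompact K) (hL : IsCompact L)
    (hKL : IsPreconnected (K ∩ L)) {a b : ℂ} (h : Joined K a b) (h' : Joined L a b) :
    Joined (K ∪ L) a b := by
  refine joined_of_hasLog_div (hK.union hL) ?_ ?_ (HasLog.union hK.isClosed hL.isClosed hKL
    (hasLog_div_of_joined hK h) (hasLog_div_of_joined hL h'))
  · obtain ⟨C, -, hd, ha, -⟩ := h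
    obtain ⟨C', -, hd', ha', -⟩ := h'
    exact fun hx => hx.elim (disjoint_left.1 hd ha) (disjoint_left.1 hd' ha')
  · obtain ⟨C, -, hd, -, hb⟩ := h
    obtain ⟨C', -, hd', -, hb'⟩ := h'
    exact fun hx => hx.elim (disjoint_left.1 hd hb) (disjoint_left.1 hd' hb')

/-! ### Winding along star-shaped curves -/

/-- A nonvanishing function on a star-shaped curve around `q` is, up to a power of `z - q`,
the exponential of a continuous function. -/
theorem exists_hasLog_mul_zpow {M : ℂ → ℝ} (hM : Continuous M) (hpos : ∀ z, z ≠ 0 → 0 < M z)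
    (hhom : ∀ (t : ℝ) (z : ℂ), 0 ≤ t → M (t * z) = t * M z) {q : ℂ} {f : ℂ → ℂ}
    (hf : ContinuousOn f {z | M (z - q) = 1}) (h0 : ∀ z, M (z - q) = 1 → f z ≠ 0) :
    ∃ d : ℤ, HasLog (fun z => f z * (z - q) ^ d) {z | M (z - q) = 1} := by
  have hM0 : M 0 = 0 := by simpa using hhom 0 0 le_rfl
  have hpe : ∀ θ : ℝ, 0 < M (exp (θ * I)) := fun θ => hpos _ (exp_ne_zero _)
  set p : ℝ → ℂ := fun θ => q + ((M (exp (θ * I)))⁻¹ : ℝ) * exp (θ * I) with hp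
  have hpc : Continuous p := by
    have h1 : Continuous fun θ : ℝ => M (exp (θ * I)) := hM.comp (by fun_prop)
    have h2 : Continuous fun θ : ℝ => (M (exp (θ * I)))⁻¹ := h1.inv₀ fun θ => (hpe θ).ne'
    exact continuous_const.add ((continuous_ofReal.comp h2).mul (by fun_prop))
  have hpS : ∀ θ, M (p θ - q) = 1 := fun θ => by
    simp only [hp, add_sub_cancel_left]
    rw [hhom _ _ (inv_nonneg.2 (hpe θ).le), inv_mul_cancel₀ (hpe θ).ne']
  have hpz : ∀ z, M (z - q) = 1 → p (arg (z - q)) = z := fun z hz => by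
    have h1 := norm_mul_exp_arg_mul_I (z - q)
    have h2 := hhom ‖z - q‖ (exp (arg (z - q) * I)) (norm_nonneg _)
    rw [h1, hz] at h2
    have h3 : (M (exp (arg (z - q) * I)))⁻¹ = ‖z - q‖ := by
      rw [eq_comm]; exact eq_inv_of_mul_eq_one_left h2.symm
    simp only [hp]
    rw [h3, h1]; ring
  have hper : ∀ θ, p (θ + 2 * Real.pi) = p θ := fun θ => by
    have : exp (((θ + 2 * Real.pi : ℝ) : ℂ) * I) = exp (θ * I) := by
      push_cast
      rw [add_mul, exp_periodic (θ * I)]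
    simp only [hp, this]
  obtain ⟨φ, hφ, -⟩ := isCoveringMapOn_exp.existsUnique_continuousMap_lifts
    ⟨fun θ => f (p θ), hf.comp_continuous hpc hpS⟩
    (a₀ := 0) (e₀ := log (f (p 0))) (exp_log (h0 _ (hpS _))) (fun θ => h0 _ (hpS θ))
  have hφe : ∀ θ, exp (φ θ) = f (p θ) := fun θ => congrFun hφ.2 θ
  obtain ⟨n, hn⟩ : ∃ n : ℤ, ∀ θ, φ (θ + 2 * Real.pi) = φ θ + n * (2 * Real.pi * I) := by
    obtain ⟨n, hn⟩ := exp_eq_exp_iff_exists_int.1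
      (show exp (φ (0 + 2 * Real.pi)) = exp (φ 0) by rw [hφe, hφe, hper])
    refine ⟨n, fun θ => ?_⟩
    have := sub_eq_of_exp_eq (S := (univ : Set ℝ)) isPreconnected_univ
      (φ := fun θ => φ (θ + 2 * Real.pi)) (ψ := φ) (by fun_prop) (by fun_prop)
      (fun θ _ => by rw [hφe, hφe, hper]) (mem_univ θ) (mem_univ 0)
    rw [hn] at this
    linear_combination this
  have hψper : Function.Periodic (fun θ : ℝ => φ θ - n * (θ * I)) (2 * Real.pi) := fun θ => by
    simp only [hn]; push_cast; ring
  have hψc : Continuous (hψper.lift : Real.Angle → ℂ) :=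
    continuous_coinduced_dom.2 (by
      change Continuous fun θ : ℝ => φ θ - n * (θ * I)
      fun_prop)
  have hz0 : ∀ z, M (z - q) = 1 → z - q ≠ 0 := fun z hz h => by
    rw [h, hM0] at hz; exact zero_ne_one hz
  refine ⟨-n, fun z => hψper.lift (arg (z - q) : Real.Angle) - n * (Real.log ‖z - q‖ : ℝ), ?_, ?_⟩
  · refine ContinuousOn.sub (fun z hz => ?_) ?_
    · refine ContinuousAt.continuousWithinAt ?_
      have := (continuousAt_arg_coe_angle (hz0 z hz))
      exact hψc.continuousAt.comp
        (ContinuousAt.comp (f := fun z => z - q) (x := z) this (by fun_prop))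
    · refine continuousOn_const.mul (continuous_ofReal.comp_continuousOn ?_)
      exact ContinuousOn.log (by fun_prop) fun z hz => norm_ne_zero_iff.2 (hz0 z hz)
  · intro z hz
    have h1 : hψper.lift (arg (z - q) : Real.Angle) = φ (arg (z - q)) - n * (arg (z - q) * I) := rfl
    have h2 : (z - q) = exp ((Real.log ‖z - q‖ : ℝ) + arg (z - q) * I) := by
      rw [exp_add, ← ofReal_exp, Real.exp_log (norm_pos_iff.2 (hz0 z hz)), norm_mul_exp_arg_mul_I]
    have h3 : (z - q) ^ (-n) = exp ((-n : ℤ) * ((Real.log ‖z - q‖ : ℝ) + arg (z - q) * I)) := by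
      rw [exp_int_mul, ← h2]
    simp only
    rw [h1, h3, ← hpz z hz, ← hφe, hpz z hz, ← exp_add]
    congr 1
    push_cast
    ring

/-! ### Logarithms along segments -/

/-- Nonvanishing functions on compact subsets of a line have logarithms. -/
theorem hasLog_of_isometric {u : ℂ → ℝ} (hu : Continuous u) {C : Set ℂ} (hC : IsCompact C)
    (hd : ∀ z ∈ C, ∀ w ∈ C, dist z w = |u z - u w|) {f : ℂ → ℂ} (hf : ContinuousOn f C)
    (h0 : ∀ z ∈ C, f z ≠ 0) : HasLog f C := by
  rcases C.eq_empty_or_nonempty with rfl | hne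
  · exact ⟨fun _ => 0, continuousOn_empty _, by simp⟩
  obtain ⟨x, hx, hmin⟩ := hC.exists_isMinOn hne hf.norm
  have hm : 0 < ‖f x‖ := norm_pos_iff.2 (h0 x hx)
  obtain ⟨δ, hδ, hδ'⟩ := Metric.uniformContinuousOn_iff.1
    (hC.uniformContinuousOn_of_continuous hf) ‖f x‖ hm
  have key : ∀ (n : ℕ) (a b : ℝ), b - a ≤ n * (δ / 2) → HasLog f (C ∩ u ⁻¹' Icc a b) := by
    intro n
    induction n with
    | zero =>
      intro a b hab
      have hsub : (C ∩ u ⁻¹' Icc a b).Subsingleton := by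
        rintro z ⟨hz, hz1, hz2⟩ w ⟨hw, hw1, hw2⟩
        have : u z = u w := by
          simp only [CharP.cast_eq_zero, zero_mul] at hab
          linarith
        rw [← dist_eq_zero, hd z hz w hw, this, sub_self, abs_zero]
      rcases hsub.eq_empty_or_singleton with h | ⟨z, h⟩
      · rw [h]; exact ⟨fun _ => 0, continuousOn_empty _, by simp⟩
      · have hz : z ∈ C := (h.symm ▸ mem_singleton z : z ∈ C ∩ u ⁻¹' Icc a b).1
        rw [h]
        exact ⟨fun _ => log (f z), continuousOn_const, fun w hw => by
          rw [mem_singleton_iff.1 hw, exp_log (h0 z hz)]⟩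
    | succ n ih =>
      intro a b hab
      have h1 := ih a (b - δ / 2) (by push_cast at hab; linarith)
      have h2 : HasLog f (C ∩ u ⁻¹' Icc (b - δ / 2) b) := by
        rcases (C ∩ u ⁻¹' Icc (b - δ / 2) b).eq_empty_or_nonempty with h | ⟨w, hw, hw1, hw2⟩
        · rw [h]; exact ⟨fun _ => 0, continuousOn_empty _, by simp⟩
        refine HasLog.of_mul_mem_slitPlane (c := (f w)⁻¹) (hf.mono inter_subset_left) ?_
          (inv_ne_zero (h0 w hw))
        rintro z ⟨hz, hz1, hz2⟩
        have e : (f w)⁻¹ * f z = 1 + (f z - f w) / f w := by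
          field_simp [h0 w hw]; ring
        rw [e]
        refine mem_slitPlane_of_norm_lt_one ?_
        rw [norm_div, div_lt_one (norm_pos_iff.2 (h0 w hw)), ← dist_eq_norm]
        refine (hδ' z hz w hw ?_).trans_le (hmin hw)
        rw [hd z hz w hw, abs_lt]
        constructor <;> linarith
      refine (HasLog.union (hC.isClosed.inter (isClosed_Icc.preimage hu))
        (hC.isClosed.inter (isClosed_Icc.preimage hu)) ?_ h1 h2).mono ?_
      · refine Set.Subsingleton.isPreconnected ?_
        rintro z ⟨⟨hz, hz1, hz2⟩, -, hz3, hz4⟩ w ⟨⟨hw, hw1, hw2⟩, -, hw3, hw4⟩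
        have : u z = u w := by linarith
        rw [← dist_eq_zero, hd z hz w hw, this, sub_self, abs_zero]
      · rintro z ⟨hz, hz1, hz2⟩
        rcases le_total (u z) (b - δ / 2) with h | h
        · exact Or.inl ⟨hz, hz1, h⟩
        · exact Or.inr ⟨hz, h, hz2⟩
  obtain ⟨a, ha⟩ := (hC.image hu).bddBelow
  obtain ⟨b, hb⟩ := (hC.image hu).bddAbove
  obtain ⟨n, hn⟩ := exists_nat_ge ((b - a) / (δ / 2))
  refine (key n a b ((div_le_iff₀ (by positivity)).1 hn)).mono fun z hz => ⟨hz, ?_, ?_⟩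
  · exact ha (mem_image_of_mem _ hz)
  · exact hb (mem_image_of_mem _ hz)

/-- A continuous extension of a function from a closed set to the plane. -/
theorem exists_continuous_extension {K : Set ℂ} (hK : IsClosed K) {φ : ℂ → ℂ}
    (hφ : ContinuousOn φ K) : ∃ ψ : ℂ → ℂ, Continuous ψ ∧ EqOn ψ φ K := by
  obtain ⟨ψ, hψ⟩ := ContinuousMap.exists_restrict_eq (Y := ℂ) hK
    ⟨K.domRestrict φ, continuousOn_iff_continuous_domRestrict.1 hφ⟩
  exact ⟨ψ, ψ.continuous, fun z hz => congrArg (fun f : C(K, ℂ) => f ⟨z, hz⟩) hψ⟩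

/-- Nonvanishing functions extend without zeros over a set where they have logarithms. -/
theorem exists_extend_of_hasLog {Y L : Set ℂ} (hY : IsClosed Y) (hL : IsClosed L) {f : ℂ → ℂ}
    (hf : ContinuousOn f Y) (h0 : ∀ z ∈ Y, f z ≠ 0) (h : HasLog f (Y ∩ L)) :
    ∃ f' : ℂ → ℂ, ContinuousOn f' (Y ∪ L) ∧ (∀ z ∈ Y ∪ L, f' z ≠ 0) ∧ EqOn f' f Y := by
  classical
  obtain ⟨φ, hφ, he⟩ := h
  obtain ⟨ψ, hψ, hψφ⟩ := exists_continuous_extension (hY.inter hL) hφ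
  have h1 : EqOn (Y.piecewise f fun z => exp (ψ z)) f Y := fun z hz => piecewise_eq_of_mem _ _ _ hz
  have h2 : EqOn (Y.piecewise f fun z => exp (ψ z)) (fun z => exp (ψ z)) L := fun z hz => by
    by_cases hzY : z ∈ Y
    · simp only [h1 hzY, hψφ ⟨hzY, hz⟩, he z ⟨hzY, hz⟩]
    · exact piecewise_eq_of_notMem _ _ _ hzY
  refine ⟨_, (hf.congr h1).union_of_isClosed ((hψ.cexp).continuousOn.congr h2) hY hL, ?_, h1⟩
  rintro z (hz | hz)
  · rw [h1 hz]; exact h0 z hz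
  · rw [h2 hz]; exact exp_ne_zero _

/-! ### Rectangles -/

/-- The closed rectangle `[a, b] × [c, d]`. -/
def rect (a b c d : ℝ) : Set ℂ := {z | (a ≤ z.re ∧ z.re ≤ b) ∧ c ≤ z.im ∧ z.im ≤ d}

/-- The boundary of the rectangle `[a, b] × [c, d]`. -/
def rectBd (a b c d : ℝ) : Set ℂ :=
  {z | z ∈ rect a b c d ∧ (z.re = a ∨ z.re = b ∨ z.im = c ∨ z.im = d)}

theorem isClosed_rect (a b c d : ℝ) : IsClosed (rect a b c d) :=
  ((isClosed_le continuous_const continuous_re).inter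
    (isClosed_le continuous_re continuous_const)).inter
    ((isClosed_le continuous_const continuous_im).inter
      (isClosed_le continuous_im continuous_const))

theorem isClosed_rectBd (a b c d : ℝ) : IsClosed (rectBd a b c d) :=
  (isClosed_rect a b c d).inter ((isClosed_eq continuous_re continuous_const).union
    ((isClosed_eq continuous_re continuous_const).union
    ((isClosed_eq continuous_im continuous_const).union
    (isClosed_eq continuous_im continuous_const))))

theorem isPreconnected_rect (a b c d : ℝ) : IsPreconnected (rect a b c d) := by
  refine Convex.isPreconnected ?_
  have : rect a b c d = (re ⁻¹' Icc a b) ∩ (im ⁻¹' Icc c d) := rfl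
  rw [this]
  exact ((convex_Icc a b).linear_preimage reLm).inter ((convex_Icc c d).linear_preimage imLm)

theorem rect_subset_ball {a b c d δ : ℝ} (hab : b - a < δ) (hcd : d - c < δ) {z w : ℂ}
    (hz : z ∈ rect a b c d) (hw : w ∈ rect a b c d) : dist z w < 2 * δ := by
  obtain ⟨⟨h1, h2⟩, h3, h4⟩ := hz
  obtain ⟨⟨h1', h2'⟩, h3', h4'⟩ := hw
  rw [dist_eq_norm]
  refine (norm_le_abs_re_add_abs_im _).trans_lt ?_
  have : |(z - w).re| < δ := by rw [sub_re, abs_lt]; constructor <;> linarith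
  have : |(z - w).im| < δ := by rw [sub_im, abs_lt]; constructor <;> linarith
  linarith

theorem isCompact_rect (a b c d : ℝ) : IsCompact (rect a b c d) := by
  refine isCompact_of_isClosed_isBounded (isClosed_rect a b c d) ?_
  refine Metric.isBounded_iff.2 ⟨2 * (|b - a| + |d - c| + 1), fun z hz w hw => ?_⟩
  exact (rect_subset_ball (by linarith [le_abs_self (b - a), abs_nonneg (d - c)])
    (by linarith [le_abs_self (d - c), abs_nonneg (b - a)]) hz hw).le

/-- `LogModulo f X D`: up to a product of powers of `z - q` with `q ∈ D`, the function `f` has a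
logarithm on `X`. -/
def LogModulo (f : ℂ → ℂ) (X D : Set ℂ) : Prop :=
  ∃ p : ℂ → ℂ, (∀ Z : Set ℂ, (∀ q ∈ D, HasLog (fun z => z - q) Z) → HasLog p Z) ∧
    HasLog (fun z => f z * p z) X

theorem LogModulo.glue {f : ℂ → ℂ} {X X₁ X₂ D D₁ D₂ : Set ℂ} (h₁ : LogModulo f X₁ D₁)
    (h₂ : LogModulo f X₂ D₂) (hD₁ : D₁ ⊆ D) (hD₂ : D₂ ⊆ D) (hX : X ⊆ X₁ ∪ X₂)
    (hX₁ : IsClosed X₁) (hX₂ : IsClosed X₂) (hc : IsPreconnected (X₁ ∩ X₂))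
    (h₁₂ : ∀ q ∈ D₁, HasLog (fun z => z - q) X₂) (h₂₁ : ∀ q ∈ D₂, HasLog (fun z => z - q) X₁) :
    LogModulo f X D := by
  obtain ⟨p₁, hp₁, hl₁⟩ := h₁
  obtain ⟨p₂, hp₂, hl₂⟩ := h₂
  refine ⟨fun z => p₁ z * p₂ z, fun Z hZ => (hp₁ Z fun q hq => hZ q (hD₁ hq)).mul
    (hp₂ Z fun q hq => hZ q (hD₂ hq)), ?_⟩
  refine (HasLog.union hX₁ hX₂ hc ?_ ?_).mono hX
  · exact (hl₁.mul (hp₂ _ h₂₁)).congr fun z _ => mul_assoc _ _ _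
  · exact (hl₂.mul (hp₁ _ h₁₂)).congr fun z _ => by ring

/-- The interior of a rectangle with a set removed. -/
def holes (K₀ : Set ℂ) (a b c d : ℝ) : Set ℂ :=
  {z | z ∉ K₀ ∧ (a < z.re ∧ z.re < b) ∧ c < z.im ∧ z.im < d}

/-- Every nonvanishing function on the part of `K` in the rectangle and the boundary of the
rectangle has a logarithm modulo factors `z - q`. -/
def RectGood (K K₀ : Set ℂ) (a b c d : ℝ) : Prop :=
  ∀ f : ℂ → ℂ, ContinuousOn f (K ∩ rect a b c d ∪ rectBd a b c d) →
    (∀ z ∈ K ∩ rect a b c d ∪ rectBd a b c d, f z ≠ 0) →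
    LogModulo f (K₀ ∩ rect a b c d ∪ rectBd a b c d) (holes K₀ a b c d)

section

variable {K K₀ : Set ℂ} {a b c d m : ℝ}

theorem RectGood.of_subset (hK : rect a b c d ⊆ K) : RectGood K K₀ a b c d := by
  intro f hf h0
  have hX : K ∩ rect a b c d ∪ rectBd a b c d = rect a b c d := by
    rw [inter_eq_right.2 hK, union_eq_left]; exact fun z hz => hz.1
  rw [hX] at hf h0
  refine ⟨fun _ => 1, fun Z _ => HasLog.const one_ne_zero, ?_⟩
  refine HasLog.mono (L := rect a b c d) ?_ (union_subset inter_subset_right fun z hz => hz.1)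
  simp only [mul_one]
  -- extend by projecting onto the rectangle
  rcases (rect a b c d).eq_empty_or_nonempty with h | ⟨w, ⟨hw1, hw2⟩, hw3, hw4⟩
  · rw [h]; exact ⟨fun _ => 0, continuousOn_empty _, by simp⟩
  have hab : a ≤ b := hw1.trans hw2
  have hcd : c ≤ d := hw3.trans hw4
  set ρ : ℂ → ℂ := fun z => ((max a (min b z.re) : ℝ) : ℂ) + (max c (min d z.im) : ℝ) * I with hρ
  have hρre : ∀ z, (ρ z).re = max a (min b z.re) := fun z => by simp [hρ]
  have hρim : ∀ z, (ρ z).im = max c (min d z.im) := fun z => by simp [hρ]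
  have hρc : Continuous ρ := by fun_prop
  have hρR : ∀ z, ρ z ∈ rect a b c d := fun z => by
    refine ⟨⟨?_, ?_⟩, ?_, ?_⟩ <;> simp [hρre, hρim, hab, hcd]
  refine ((hasLog_univ (F := fun z => f (ρ z)) (hf.comp_continuous hρc hρR)
    fun z => h0 _ (hρR z)).mono (subset_univ _)).congr fun z hz => ?_
  congr 1
  obtain ⟨⟨h1, h2⟩, h3, h4⟩ := hz
  apply Complex.ext
  · rw [hρre, min_eq_right h2, max_eq_right h1]
  · rw [hρim, min_eq_right h4, max_eq_right h3]

theorem RectGood.of_disjoint (hab : a < b) (hcd : c < d) (hK : Disjoint (rect a b c d) K₀) :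
    RectGood K K₀ a b c d := by
  intro f hf h0
  have hX : K₀ ∩ rect a b c d ∪ rectBd a b c d = rectBd a b c d := by
    rw [inter_comm, hK.inter_eq, empty_union]
  rw [hX]
  set q : ℂ := ((a + b) / 2 : ℝ) + ((c + d) / 2 : ℝ) * I with hq
  have hqre : q.re = (a + b) / 2 := by simp [hq]
  have hqim : q.im = (c + d) / 2 := by simp [hq]
  have hw : 0 < (b - a) / 2 := by linarith
  have hh : 0 < (d - c) / 2 := by linarith
  set M : ℂ → ℝ := fun z => max (|z.re| / ((b - a) / 2)) (|z.im| / ((d - c) / 2)) with hM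
  have hS : {z | M (z - q) = 1} = rectBd a b c d := by
    ext z
    simp only [hM, mem_ofPred_eq, rectBd, rect, sub_re, sub_im, hqre, hqim]
    have e1 : |z.re - (a + b) / 2| / ((b - a) / 2) ≤ 1 ↔ a ≤ z.re ∧ z.re ≤ b := by
      rw [div_le_one hw, abs_le]
      constructor <;> rintro ⟨h1, h2⟩ <;> constructor <;> linarith
    have e2 : |z.im - (c + d) / 2| / ((d - c) / 2) ≤ 1 ↔ c ≤ z.im ∧ z.im ≤ d := by
      rw [div_le_one hh, abs_le]
      constructor <;> rintro ⟨h1, h2⟩ <;> constructor <;> linarith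
    have e3 : |z.re - (a + b) / 2| / ((b - a) / 2) = 1 ↔ z.re = a ∨ z.re = b := by
      rw [div_eq_one_iff_eq hw.ne', abs_eq hw.le]
      constructor <;> rintro (h | h) <;> [right; left; right; left] <;> linarith
    have e4 : |z.im - (c + d) / 2| / ((d - c) / 2) = 1 ↔ z.im = c ∨ z.im = d := by
      rw [div_eq_one_iff_eq hh.ne', abs_eq hh.le]
      constructor <;> rintro (h | h) <;> [right; left; right; left] <;> linarith
    rw [← e1, ← e2, ← or_assoc, ← e3, ← e4]
    constructor
    · intro h
      refine ⟨max_le_iff.1 h.le, ?_⟩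
      rcases max_choice (|z.re - (a + b) / 2| / ((b - a) / 2))
        (|z.im - (c + d) / 2| / ((d - c) / 2)) with h' | h'
      · exact Or.inl (h'.symm.trans h)
      · exact Or.inr (h'.symm.trans h)
    · rintro ⟨h, h' | h'⟩
      · rw [h', max_eq_left h.2]
      · rw [h', max_eq_right h.1]
  have hsub : rectBd a b c d ⊆ K ∩ rect a b c d ∪ rectBd a b c d := subset_union_right
  obtain ⟨n, hn⟩ := exists_hasLog_mul_zpow (M := M) (q := q) (f := f) (by fun_prop)
    (fun z hz => by
      by_cases hre : z.re = 0
      · have him : z.im ≠ 0 := fun him => hz (Complex.ext hre him)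
        exact lt_max_of_lt_right (div_pos (abs_pos.2 him) hh)
      · exact lt_max_of_lt_left (div_pos (abs_pos.2 hre) hw))
    (fun t z ht => by
      simp only [hM, re_ofReal_mul, im_ofReal_mul, abs_mul, abs_of_nonneg ht, mul_div_assoc]
      rw [mul_max_of_nonneg _ _ ht])
    (by rw [hS]; exact hf.mono hsub) (fun z hz => h0 z (hsub (by rw [← hS]; exact hz)))
  rw [hS] at hn
  refine ⟨fun z => (z - q) ^ n, fun Z hZ => (hZ q ⟨?_, ?_⟩).zpow n, hn⟩
  · refine disjoint_left.1 hK ⟨⟨?_, ?_⟩, ?_, ?_⟩ <;> linarith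
  · refine ⟨⟨?_, ?_⟩, ?_, ?_⟩ <;> linarith

theorem RectGood.split_re (hK : IsClosed K) (hK₀ : IsClosed K₀) (hKK : K₀ ⊆ K) (ham : a ≤ m)
    (hmb : m ≤ b) (h₁ : RectGood K K₀ a m c d) (h₂ : RectGood K K₀ m b c d) :
    RectGood K K₀ a b c d := by
  have hcov : K₀ ∩ rect a b c d ∪ rectBd a b c d ⊆
      (K₀ ∩ rect a m c d ∪ rectBd a m c d) ∪ (K₀ ∩ rect m b c d ∪ rectBd m b c d) := by
    intro z
    simp only [rect, rectBd, mem_union, mem_inter_iff, mem_ofPred_eq]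
    rcases le_total z.re m with h | h <;> grind
  intro f hf h0
  have hY : IsClosed (K ∩ rect a b c d ∪ rectBd a b c d) :=
    (hK.inter (isClosed_rect ..)).union (isClosed_rectBd ..)
  have hLY : HasLog f ((K ∩ rect a b c d ∪ rectBd a b c d) ∩ rect m m c d) := by
    refine hasLog_of_isometric continuous_im ((isCompact_rect ..).inter_left hY) ?_
      (hf.mono inter_subset_left) fun z hz => h0 z hz.1
    rintro z ⟨-, ⟨h1, h2⟩, -⟩ w ⟨-, ⟨h1', h2'⟩, -⟩
    rw [dist_of_re_eq (by linarith), Real.dist_eq]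
  obtain ⟨f', hf', h0', he⟩ := exists_extend_of_hasLog hY (isClosed_rect m m c d) hf h0 hLY
  have hs₁ : K ∩ rect a m c d ∪ rectBd a m c d ⊆
      (K ∩ rect a b c d ∪ rectBd a b c d) ∪ rect m m c d := by
    intro z; simp only [rect, rectBd, mem_union, mem_inter_iff, mem_ofPred_eq]; grind
  have hs₂ : K ∩ rect m b c d ∪ rectBd m b c d ⊆
      (K ∩ rect a b c d ∪ rectBd a b c d) ∪ rect m m c d := by
    intro z; simp only [rect, rectBd, mem_union, mem_inter_iff, mem_ofPred_eq]; grind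
  have hl₁ := h₁ f' (hf'.mono hs₁) fun z hz => h0' z (hs₁ hz)
  have hl₂ := h₂ f' (hf'.mono hs₂) fun z hz => h0' z (hs₂ hz)
  have hX : (K₀ ∩ rect a m c d ∪ rectBd a m c d) ∩ (K₀ ∩ rect m b c d ∪ rectBd m b c d) =
      rect m m c d := by
    ext z; simp only [rect, rectBd, mem_union, mem_inter_iff, mem_ofPred_eq]; grind
  obtain ⟨p, hp, hfp⟩ : LogModulo f' (K₀ ∩ rect a b c d ∪ rectBd a b c d) (holes K₀ a b c d) := by
    refine hl₁.glue hl₂ ?_ ?_ hcov ((hK₀.inter (isClosed_rect ..)).union (isClosed_rectBd ..))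
      ((hK₀.inter (isClosed_rect ..)).union (isClosed_rectBd ..))
      (hX.symm ▸ isPreconnected_rect m m c d) ?_ ?_
    · intro z; simp only [holes, mem_ofPred_eq]; grind
    · intro z; simp only [holes, mem_ofPred_eq]; grind
    · rintro q ⟨-, ⟨-, hq⟩, -⟩
      refine HasLog.of_slitPlane (by fun_prop) fun z hz => Or.inl ?_
      have : m ≤ z.re := by rcases hz with hz | hz <;> [exact hz.2.1.1; exact hz.1.1.1]
      rw [sub_re]; linarith
    · rintro q ⟨-, ⟨hq, -⟩, -⟩
      refine HasLog.of_mul_mem_slitPlane (c := -1) (by fun_prop) (fun z hz => Or.inl ?_) (by simp)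
      have : z.re ≤ m := by rcases hz with hz | hz <;> [exact hz.2.1.2; exact hz.1.1.2]
      rw [neg_one_mul, neg_re, sub_re]; linarith
  refine ⟨p, hp, hfp.congr fun z hz => ?_⟩
  rw [he (union_subset_union_left _ (inter_subset_inter_left _ hKK) hz)]

theorem RectGood.split_im (hK : IsClosed K) (hK₀ : IsClosed K₀) (hKK : K₀ ⊆ K) (hcm : c ≤ m)
    (hmd : m ≤ d) (h₁ : RectGood K K₀ a b c m) (h₂ : RectGood K K₀ a b m d) :
    RectGood K K₀ a b c d := by
  have hcov : K₀ ∩ rect a b c d ∪ rectBd a b c d ⊆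
      (K₀ ∩ rect a b c m ∪ rectBd a b c m) ∪ (K₀ ∩ rect a b m d ∪ rectBd a b m d) := by
    intro z
    simp only [rect, rectBd, mem_union, mem_inter_iff, mem_ofPred_eq]
    rcases le_total z.im m with h | h <;> grind
  intro f hf h0
  have hY : IsClosed (K ∩ rect a b c d ∪ rectBd a b c d) :=
    (hK.inter (isClosed_rect ..)).union (isClosed_rectBd ..)
  have hLY : HasLog f ((K ∩ rect a b c d ∪ rectBd a b c d) ∩ rect a b m m) := by
    refine hasLog_of_isometric continuous_re ((isCompact_rect ..).inter_left hY) ?_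
      (hf.mono inter_subset_left) fun z hz => h0 z hz.1
    rintro z ⟨-, -, h1, h2⟩ w ⟨-, -, h1', h2'⟩
    rw [dist_of_im_eq (by linarith), Real.dist_eq]
  obtain ⟨f', hf', h0', he⟩ := exists_extend_of_hasLog hY (isClosed_rect a b m m) hf h0 hLY
  have hs₁ : K ∩ rect a b c m ∪ rectBd a b c m ⊆
      (K ∩ rect a b c d ∪ rectBd a b c d) ∪ rect a b m m := by
    intro z; simp only [rect, rectBd, mem_union, mem_inter_iff, mem_ofPred_eq]; grind
  have hs₂ : K ∩ rect a b m d ∪ rectBd a b m d ⊆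
      (K ∩ rect a b c d ∪ rectBd a b c d) ∪ rect a b m m := by
    intro z; simp only [rect, rectBd, mem_union, mem_inter_iff, mem_ofPred_eq]; grind
  have hl₁ := h₁ f' (hf'.mono hs₁) fun z hz => h0' z (hs₁ hz)
  have hl₂ := h₂ f' (hf'.mono hs₂) fun z hz => h0' z (hs₂ hz)
  have hX : (K₀ ∩ rect a b c m ∪ rectBd a b c m) ∩ (K₀ ∩ rect a b m d ∪ rectBd a b m d) =
      rect a b m m := by
    ext z; simp only [rect, rectBd, mem_union, mem_inter_iff, mem_ofPred_eq]; grind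
  obtain ⟨p, hp, hfp⟩ : LogModulo f' (K₀ ∩ rect a b c d ∪ rectBd a b c d) (holes K₀ a b c d) := by
    refine hl₁.glue hl₂ ?_ ?_ hcov ((hK₀.inter (isClosed_rect ..)).union (isClosed_rectBd ..))
      ((hK₀.inter (isClosed_rect ..)).union (isClosed_rectBd ..))
      (hX.symm ▸ isPreconnected_rect a b m m) ?_ ?_
    · intro z; simp only [holes, mem_ofPred_eq]; grind
    · intro z; simp only [holes, mem_ofPred_eq]; grind
    · rintro q ⟨-, -, -, hq⟩
      refine HasLog.of_mul_mem_slitPlane (c := -I) (by fun_prop) (fun z hz => Or.inl ?_) (by simp)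
      have : m ≤ z.im := by rcases hz with hz | hz <;> [exact hz.2.2.1; exact hz.1.2.1]
      simp; linarith
    · rintro q ⟨-, -, hq, -⟩
      refine HasLog.of_mul_mem_slitPlane (c := I) (by fun_prop) (fun z hz => Or.inl ?_) (by simp)
      have : z.im ≤ m := by rcases hz with hz | hz <;> [exact hz.2.2.2; exact hz.1.2.2]
      simp; linarith
  refine ⟨p, hp, hfp.congr fun z hz => ?_⟩
  rw [he (union_subset_union_left _ (inter_subset_inter_left _ hKK) hz)]

theorem rectGood_of_small {δ : ℝ} (hK : IsClosed K) (hK₀ : IsClosed K₀) (hKK : K₀ ⊆ K)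
    (hsmall : ∀ a b c d, a < b → c < d → b - a ≤ δ → d - c ≤ δ →
      RectGood K K₀ a b c d) (n : ℕ) :
    ∀ a b c d, a < b → c < d → b - a ≤ 2 ^ n * δ → d - c ≤ 2 ^ n * δ → RectGood K K₀ a b c d := by
  induction n with
  | zero => simpa using hsmall
  | succ n ih =>
    intro a b c d hab hcd h1 h2
    rw [pow_succ] at h1 h2
    have key : ∀ a b, a < b → b - a ≤ 2 ^ n * δ → RectGood K K₀ a b c d := fun a b hab h =>
      RectGood.split_im (m := (c + d) / 2) hK hK₀ hKK (by linarith) (by linarith)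
        (ih _ _ _ _ hab (by linarith) h (by linarith))
        (ih _ _ _ _ hab (by linarith) h (by linarith))
    exact RectGood.split_re (m := (a + b) / 2) hK hK₀ hKK (by linarith) (by linarith)
      (key _ _ (by linarith) (by linarith)) (key _ _ (by linarith) (by linarith))

/-- Nonvanishing functions on a compact set with connected complement have logarithms. -/
theorem hasLog_of_isPreconnected_compl {K₀ : Set ℂ} (hK₀ : IsCompact K₀)
    (hc : IsPreconnected K₀ᶜ) {f : ℂ → ℂ} (hf : ContinuousOn f K₀) (h0 : ∀ z ∈ K₀, f z ≠ 0) :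
    HasLog f K₀ := by
  classical
  obtain ⟨r, hr0, hr⟩ := hK₀.isBounded.subset_ball_lt 0 0
  have hKin : ∀ z ∈ K₀, |z.re| < r ∧ |z.im| < r := fun z hz => by
    have : ‖z‖ < r := by simpa using hr hz
    exact ⟨(abs_re_le_norm z).trans_lt this, (abs_im_le_norm z).trans_lt this⟩
  set f₀ : ℂ → ℂ := K₀.piecewise f fun _ => 1
  have e1 : EqOn f₀ f K₀ := fun z hz => piecewise_eq_of_mem _ _ _ hz
  have e2 : EqOn f₀ (fun _ => 1) (rectBd (-r) r (-r) r) := fun z hz => by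
    refine piecewise_eq_of_notMem _ _ _ fun hzK => ?_
    have h1 := abs_lt.1 (hKin z hzK).1
    have h2 := abs_lt.1 (hKin z hzK).2
    rcases hz.2 with h | h | h | h <;> linarith
  have hcl := isClosed_rectBd (-r) r (-r) r
  obtain ⟨F, hFc, hF⟩ := exists_continuous_extension (hK₀.isClosed.union hcl)
    ((hf.congr e1).union_of_isClosed (continuousOn_const.congr e2) hK₀.isClosed hcl)
  have hF1 : EqOn F f K₀ := fun z hz => (hF (Or.inl hz)).trans (e1 hz)
  obtain ⟨δ, hδ, hδN⟩ := hK₀.exists_cthickening_subset_open (isOpen_ne_fun hFc continuous_const)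
    (show K₀ ⊆ {z | F z ≠ 0} from fun z hz => by
      rw [mem_ofPred_eq, hF1 hz]; exact h0 z hz)
  have hKK : K₀ ⊆ cthickening δ K₀ := self_subset_cthickening _
  have hsmall : ∀ a b c d, a < b → c < d → b - a ≤ δ / 3 → d - c ≤ δ / 3 →
      RectGood (cthickening δ K₀) K₀ a b c d := by
    intro a b c d hab hcd h1 h2
    by_cases hd : Disjoint (rect a b c d) K₀
    · exact RectGood.of_disjoint hab hcd hd
    · obtain ⟨w, hw, hwK⟩ := not_disjoint_iff.1 hd
      refine RectGood.of_subset fun z hz => mem_cthickening_of_dist_le _ w _ _ hwK ?_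
      exact (rect_subset_ball (δ := δ / 2) (by linarith) (by linarith) hz hw).le.trans (by linarith)
  obtain ⟨n, hn⟩ := pow_unbounded_of_one_lt (2 * r / (δ / 3)) one_lt_two
  have hn' : r - -r ≤ 2 ^ n * (δ / 3) := by
    rw [div_lt_iff₀ (by positivity)] at hn; linarith
  obtain ⟨p, hp, hfp⟩ := rectGood_of_small isClosed_cthickening hK₀.isClosed hKK
    hsmall n (-r) r (-r) r (by linarith) (by linarith) hn' hn'
    F hFc.continuousOn (by
      rintro z (hz | hz)
      · exact hδN hz.1
      · rw [hF (Or.inr hz), e2 hz]; exact one_ne_zero)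
  have hub : ¬ Bornology.IsBounded K₀ᶜ := hK₀.isBounded.not_isBounded_compl
  have hpl : HasLog p K₀ := hp K₀ fun q hq =>
    hasLog_sub_of_unbounded hK₀ hc disjoint_compl_left hub hq.1
  have hsub : K₀ ⊆ K₀ ∩ rect (-r) r (-r) r ∪ rectBd (-r) r (-r) r := fun z hz => by
    have h1 := abs_lt.1 (hKin z hz).1
    have h2 := abs_lt.1 (hKin z hz).2
    exact Or.inl ⟨hz, ⟨h1.1.le, h1.2.le⟩, h2.1.le, h2.2.le⟩
  refine ((hfp.mono hsub).div hpl).congr fun z hz => ?_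
  obtain ⟨φ, -, hφ⟩ := hpl
  have : p z ≠ 0 := by rw [← hφ z hz]; exact exp_ne_zero _
  simp only [hF1 hz]
  field_simp

end

/-! ### The Jordan curve theorem -/

/-- The maps `g` and `h` are inverse homeomorphisms between the unit circle and `J`. -/
structure IsJordan (g h : ℂ → ℂ) (J : Set ℂ) : Prop where
  continuousOn : ContinuousOn g (sphere 0 1)
  continuousOn_inv : ContinuousOn h J
  mapsTo : MapsTo g (sphere 0 1) J
  mapsTo_inv : MapsTo h J (sphere 0 1)
  leftInv : LeftInvOn h g (sphere 0 1)
  rightInv : RightInvOn h g J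

namespace IsJordan

variable {g h : ℂ → ℂ} {J : Set ℂ}

theorem image_eq (H : IsJordan g h J) : g '' sphere 0 1 = J :=
  H.mapsTo.image_subset.antisymm fun z hz => ⟨h z, H.mapsTo_inv hz, H.rightInv hz⟩

theorem isCompact (H : IsJordan g h J) : IsCompact J :=
  H.image_eq ▸ (isCompact_sphere 0 1).image_of_continuousOn H.continuousOn

theorem of_injOn (hg : ContinuousOn g (sphere 0 1)) (hi : InjOn g (sphere 0 1)) :
    IsJordan g (Function.invFunOn g (sphere 0 1)) (g '' sphere 0 1) where
  continuousOn := hg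
  continuousOn_inv := by
    rw [continuousOn_iff_isClosed]
    intro t ht
    refine ⟨g '' (sphere 0 1 ∩ t), (((isCompact_sphere 0 1).inter_right ht).image_of_continuousOn
      (hg.mono inter_subset_left)).isClosed, ?_⟩
    ext z
    constructor
    · rintro ⟨h1, w, hw, rfl⟩
      rw [mem_preimage, hi.leftInvOn_invFunOn hw] at h1
      exact ⟨mem_image_of_mem _ ⟨hw, h1⟩, mem_image_of_mem _ hw⟩
    · rintro ⟨⟨w, ⟨hw, hwt⟩, rfl⟩, h2⟩
      exact ⟨by rwa [mem_preimage, hi.leftInvOn_invFunOn hw], h2⟩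
  mapsTo := mapsTo_image _ _
  mapsTo_inv := by
    rintro _ ⟨w, hw, rfl⟩
    rwa [hi.leftInvOn_invFunOn hw]
  leftInv := hi.leftInvOn_invFunOn
  rightInv := by
    rintro _ ⟨w, hw, rfl⟩
    rw [hi.leftInvOn_invFunOn hw]

theorem exists_hasLog (H : IsJordan g h J) {f : ℂ → ℂ} (hf : ContinuousOn f J)
    (h0 : ∀ z ∈ J, f z ≠ 0) : ∃ n : ℤ, HasLog (fun z => f z * h z ^ n) J := by
  have hS : {z : ℂ | ‖z - 0‖ = 1} = sphere 0 1 := by ext z; simp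
  obtain ⟨n, hn⟩ := exists_hasLog_mul_zpow (M := fun z => ‖z‖) (q := 0) (f := fun z => f (g z))
    continuous_norm (fun z hz => norm_pos_iff.2 hz)
    (fun t z ht => by simp [abs_of_nonneg ht])
    (by rw [hS]; exact hf.comp H.continuousOn H.mapsTo)
    (fun z hz => h0 _ (H.mapsTo (by simpa using hz)))
  rw [hS] at hn
  refine ⟨n, (hn.comp H.continuousOn_inv H.mapsTo_inv).congr fun z hz => ?_⟩
  rw [H.rightInv hz, sub_zero]

theorem exists_not_joined (H : IsJordan g h J) : ∃ a ∉ J, ∃ b ∉ J, ¬ Joined J a b := by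
  by_contra! hcon
  have hc : IsPreconnected Jᶜ := by
    refine isPreconnected_of_forall_pair fun x hx y hy => ?_
    obtain ⟨C, hC, hd, hxC, hyC⟩ := hcon x hx y hy
    exact ⟨C, subset_compl_iff_disjoint_right.2 hd, hxC, hyC, hC⟩
  have hl := hasLog_of_isPreconnected_compl H.isCompact hc H.continuousOn_inv
    fun z hz => ne_zero_of_mem_unit_sphere ⟨h z, H.mapsTo_inv hz⟩
  refine not_hasLog_sphere (a := 0) one_pos one_ne_zero
    ((hl.comp H.continuousOn H.mapsTo).congr fun z hz => ?_)
  rw [H.leftInv hz, sub_zero, zpow_one]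

end IsJordan

theorem Joined.symm {K : Set ℂ} {a b : ℂ} (h : Joined K a b) : Joined K b a :=
  let ⟨C, hC, hd, ha, hb⟩ := h
  ⟨C, hC, hd, hb, ha⟩

theorem Joined.trans {K : Set ℂ} {a b c : ℂ} (h : Joined K a b) (h' : Joined K b c) :
    Joined K a c :=
  let ⟨C, hC, hd, ha, hb⟩ := h
  let ⟨C', hC', hd', hb', hc⟩ := h'
  ⟨C ∪ C', hC.union b hb hb' hC', hd.union_left hd', Or.inl ha, Or.inr hc⟩

theorem Joined.connectedComponentIn_eq {K : Set ℂ} {a b : ℂ} (h : Joined K a b) :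
    connectedComponentIn Kᶜ a = connectedComponentIn Kᶜ b :=
  let ⟨_, hC, hd, ha, hb⟩ := h
  _root_.connectedComponentIn_eq
    (hC.subset_connectedComponentIn ha (subset_compl_iff_disjoint_right.2 hd) hb)

theorem joined_of_mem {K : Set ℂ} {a b : ℂ} (hb : b ∈ connectedComponentIn Kᶜ a) (ha : a ∉ K) :
    Joined K a b :=
  ⟨_, isPreconnected_connectedComponentIn,
    disjoint_compl_left.mono_left (connectedComponentIn_subset _ _), mem_connectedComponentIn ha, hb⟩

namespace IsJordan

variable {g h : ℂ → ℂ} {J : Set ℂ}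

theorem hasLog_of_notMem (H : IsJordan g h J) {F : Set ℂ} (hF : F ⊆ J) {p : ℂ} (hp : p ∈ J)
    (hpF : p ∉ F) {f : ℂ → ℂ} (hf : ContinuousOn f J) (h0 : ∀ z ∈ J, f z ≠ 0) : HasLog f F := by
  obtain ⟨n, hn⟩ := H.exists_hasLog hf h0
  have hne : ∀ z ∈ J, h z ≠ 0 := fun z hz => ne_zero_of_mem_unit_sphere ⟨h z, H.mapsTo_inv hz⟩
  have hl : HasLog h F := by
    refine HasLog.of_mul_mem_slitPlane (c := -(h p)⁻¹) (H.continuousOn_inv.mono hF) (fun z hz => ?_)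
      (neg_ne_zero.2 (inv_ne_zero (hne p hp)))
    have hz1 : ‖h z‖ = 1 := by simpa using H.mapsTo_inv (hF hz)
    have hp1 : ‖h p‖ = 1 := by simpa using H.mapsTo_inv hp
    have hu : ‖(h p)⁻¹ * h z‖ = 1 := by rw [norm_mul, norm_inv, hz1, hp1]; simp
    rw [neg_mul, mem_slitPlane_iff]
    by_contra! hcon
    rw [neg_re, neg_im, neg_eq_zero] at hcon
    have h1 : (h p)⁻¹ * h z = 1 := by
      rw [← abs_re_eq_norm.2 hcon.2, abs_of_nonneg (by linarith)] at hu
      exact Complex.ext hu hcon.2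
    have h2 : h z = h p := by
      rw [inv_mul_eq_one₀ (hne p hp)] at h1
      exact h1.symm
    have h3 : z = p := by rw [← H.rightInv (hF hz), h2, H.rightInv hp]
    exact hpF (h3 ▸ hz)
  refine ((hn.mono hF).div (hl.zpow n)).congr fun z hz => ?_
  have := zpow_ne_zero n (hne z (hF hz))
  field_simp

theorem frontier_component (H : IsJordan g h J) {a : ℂ} (ha : a ∉ J) :
    frontier (connectedComponentIn Jᶜ a) = J := by
  have hop : IsOpen Jᶜ := H.isCompact.isClosed.isOpen_compl
  have hsub : frontier (connectedComponentIn Jᶜ a) ⊆ J := by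
    simpa using frontier_connectedComponentIn_subset hop a
  refine hsub.antisymm fun p hp => ?_
  by_contra hpF
  obtain ⟨b, hb, hab⟩ : ∃ b ∉ J, ¬ Joined J a b := by
    obtain ⟨x, hx, y, hy, hxy⟩ := H.exists_not_joined
    by_contra! hcon
    exact hxy ((hcon x hx).symm.trans (hcon y hy))
  have hl : HasLog (fun z => (z - a) / (z - b)) (frontier (connectedComponentIn Jᶜ a)) := by
    refine H.hasLog_of_notMem hsub hp hpF (ContinuousOn.div (by fun_prop) (by fun_prop) ?_) ?_
    · exact fun z hz h0 => hb (sub_eq_zero.1 h0 ▸ hz)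
    · exact fun z hz => div_ne_zero (fun h0 => ha (sub_eq_zero.1 h0 ▸ hz))
        (fun h0 => hb (sub_eq_zero.1 h0 ▸ hz))
  have hFc : IsCompact (frontier (connectedComponentIn Jᶜ a)) :=
    H.isCompact.of_isClosed_subset isClosed_frontier hsub
  obtain ⟨C, hC, hd, haC, hbC⟩ := joined_of_hasLog_div hFc (fun h => ha (hsub h))
    (fun h => hb (hsub h)) hl
  have hb' : b ∉ connectedComponentIn Jᶜ a := fun h => hab (joined_of_mem h ha)
  exact hb' (hC.mem_of_disjoint_frontier hop.connectedComponentIn hd haC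
    (mem_connectedComponentIn ha) hbC)

theorem joined_of_isBounded (H : IsJordan g h J) {a b : ℂ} (ha : a ∉ J) (hb : b ∉ J)
    (hA : Bornology.IsBounded (connectedComponentIn Jᶜ a))
    (hB : Bornology.IsBounded (connectedComponentIn Jᶜ b)) : Joined J a b := by
  by_contra hcon
  have hop : IsOpen Jᶜ := H.isCompact.isClosed.isOpen_compl
  have hne : ∀ a ∉ J, ∀ z ∈ J, z - a ≠ 0 := fun a ha z hz h0 => ha (sub_eq_zero.1 h0 ▸ hz)
  have key : ∀ a ∉ J, Bornology.IsBounded (connectedComponentIn Jᶜ a) →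
      ∃ n : ℤ, n ≠ 0 ∧ HasLog (fun z => (z - a) * h z ^ n) J := by
    intro a ha hA
    obtain ⟨n, hn⟩ := H.exists_hasLog (f := fun z => z - a) (by fun_prop) (hne a ha)
    refine ⟨n, ?_, hn⟩
    rintro rfl
    refine not_hasLog_frontier hop.connectedComponentIn hA (mem_connectedComponentIn ha)
      (h := fun _ => 1) continuousOn_const (fun _ _ => one_ne_zero) one_ne_zero ?_
    rw [H.frontier_component ha]
    exact hn.congr fun z _ => by simp
  obtain ⟨n, hn0, hn⟩ := key a ha hA
  obtain ⟨m, hm0, hm⟩ := key b hb hB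
  have hb' : b ∉ closure (connectedComponentIn Jᶜ a) := by
    rw [closure_eq_self_union_frontier, H.frontier_component ha]
    rintro (h1 | h1)
    · exact hcon (joined_of_mem h1 ha)
    · exact hb h1
  have hb'' : ∀ z ∈ closure (connectedComponentIn Jᶜ a), z - b ≠ 0 :=
    fun z hz h0 => hb' (sub_eq_zero.1 h0 ▸ hz)
  refine not_hasLog_frontier hop.connectedComponentIn hA (mem_connectedComponentIn ha)
    (h := fun z => (z - b) ^ n) (ContinuousOn.zpow₀ (by fun_prop) n fun z hz => Or.inl (hb'' z hz))
    (fun z hz => zpow_ne_zero _ (hb'' z hz)) hm0 ?_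
  rw [H.frontier_component ha]
  refine ((hn.zpow m).div (hm.zpow n)).congr fun z hz => ?_
  have h1 := zpow_ne_zero n (hne b hb z hz)
  have h2 : h z ≠ 0 := ne_zero_of_mem_unit_sphere ⟨h z, H.mapsTo_inv hz⟩
  rw [mul_zpow, mul_zpow, ← zpow_mul, ← zpow_mul, mul_comm m n]
  have h3 := zpow_ne_zero (n * m) h2
  field_simp

/-- The Jordan curve theorem. -/
theorem exists_interior_exterior (H : IsJordan g h J) : ∃ U V : Set ℂ, IsOpen U ∧ IsOpen V ∧
    IsConnected U ∧ IsConnected V ∧ Bornology.IsBounded U ∧ ¬ Bornology.IsBounded V ∧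
    Disjoint U V ∧ U ∪ V = Jᶜ ∧ frontier U = J ∧ frontier V = J := by
  have hop : IsOpen Jᶜ := H.isCompact.isClosed.isOpen_compl
  obtain ⟨R, hR⟩ := H.isCompact.isBounded.subset_ball 0
  have hsub : (ball (0 : ℂ) R)ᶜ ⊆ Jᶜ := compl_subset_compl.2 hR
  have hub : ¬ Bornology.IsBounded (ball (0 : ℂ) R)ᶜ := isBounded_ball.not_isBounded_compl
  obtain ⟨b, hbR⟩ : ((ball (0 : ℂ) R)ᶜ).Nonempty := by
    by_contra hcon
    exact hub (by rw [not_nonempty_iff_eq_empty.1 hcon]; exact Bornology.isBounded_empty)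
  have hb : b ∉ J := hsub hbR
  have hVub : ¬ Bornology.IsBounded (connectedComponentIn Jᶜ b) := fun hbd =>
    hub (hbd.subset ((isPreconnected_compl_ball R).subset_connectedComponentIn hbR hsub))
  obtain ⟨a, ha, hAb⟩ : ∃ a ∉ J, Bornology.IsBounded (connectedComponentIn Jᶜ a) := by
    obtain ⟨x, hx, y, hy, hxy⟩ := H.exists_not_joined
    rcases isBounded_of_not_joined H.isCompact hx hy hxy with h1 | h1
    exacts [⟨x, hx, h1⟩, ⟨y, hy, h1⟩]
  refine ⟨connectedComponentIn Jᶜ a, connectedComponentIn Jᶜ b, hop.connectedComponentIn,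
    hop.connectedComponentIn, isConnected_connectedComponentIn_iff.2 ha,
    isConnected_connectedComponentIn_iff.2 hb, hAb, hVub, ?_, ?_, H.frontier_component ha,
    H.frontier_component hb⟩
  · refine disjoint_left.2 fun z hz hz' => hVub ?_
    rw [connectedComponentIn_eq hz', ← connectedComponentIn_eq hz]
    exact hAb
  · refine (union_subset (connectedComponentIn_subset _ _)
      (connectedComponentIn_subset _ _)).antisymm fun c hc => ?_
    by_cases hcb : Bornology.IsBounded (connectedComponentIn Jᶜ c)
    · left
      rw [(H.joined_of_isBounded ha hc hAb hcb).connectedComponentIn_eq]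
      exact mem_connectedComponentIn hc
    · right
      have hj : Joined J b c := by
        by_contra hcon
        rcases isBounded_of_not_joined H.isCompact hb hc hcon with h1 | h1
        exacts [hVub h1, hcb h1]
      rw [hj.connectedComponentIn_eq]
      exact mem_connectedComponentIn hc

end IsJordan

/-! ### Logarithms on domains without holes -/

/-- Nonvanishing functions on a domain with connected unbounded complement have logarithms. -/
theorem hasLog_of_domain {U : Set ℂ} (hU : IsOpen U) (hUc : IsConnected U)
    (hc : IsPreconnected Uᶜ) (hb : Bornology.IsBounded U) {f : ℂ → ℂ} (hf : ContinuousOn f U)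
    (h0 : ∀ z ∈ U, f z ≠ 0) : HasLog f U := by
  have hub : ¬ Bornology.IsBounded Uᶜ := hb.not_isBounded_compl
  obtain ⟨v, hv⟩ : (Uᶜ).Nonempty := by
    by_contra hcon
    exact hub (by rw [not_nonempty_iff_eq_empty.1 hcon]; exact Bornology.isBounded_empty)
  have hcpt : ∀ K ⊆ U, IsCompact K → HasLog f K := by
    intro K hKU hK
    have hop : IsOpen Kᶜ := hK.isClosed.isOpen_compl
    have hUK : Uᶜ ⊆ connectedComponentIn Kᶜ v :=
      hc.subset_connectedComponentIn hv (compl_subset_compl.2 hKU)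
    have hsub : (connectedComponentIn Kᶜ v)ᶜ ⊆ U := compl_subset_comm.1 hUK
    refine (hasLog_of_isPreconnected_compl (K₀ := (connectedComponentIn Kᶜ v)ᶜ) ?_ ?_
      (hf.mono hsub) fun z hz => h0 z (hsub hz)).mono ?_
    · exact isCompact_of_isClosed_isBounded hop.connectedComponentIn.isClosed_compl (hb.subset hsub)
    · rw [compl_compl]; exact isPreconnected_connectedComponentIn
    · exact subset_compl_comm.1 (connectedComponentIn_subset _ _)
  obtain ⟨z₀, hz₀⟩ := hUc.nonempty
  have hex : ∀ z ∈ U, ∃ L : Set ℂ, ∃ ψ : ℂ → ℂ, L ⊆ U ∧ IsCompact L ∧ IsPreconnected L ∧ z₀ ∈ L ∧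
      L ∈ 𝓝 z ∧ ContinuousOn ψ L ∧ (∀ w ∈ L, exp (ψ w) = f w) ∧ ψ z₀ = log (f z₀) := by
    intro z hz
    obtain ⟨γ, hγ⟩ := ((hU.isConnected_iff_isPathConnected).1 hUc).joinedIn z₀ hz₀ z hz
    obtain ⟨r, hr, hrU⟩ := nhds_basis_closedBall.mem_iff.1 (hU.mem_nhds hz)
    have hLU : range γ ∪ closedBall z r ⊆ U := union_subset (range_subset_iff.2 hγ) hrU
    have hLc : IsCompact (range γ ∪ closedBall z r) :=
      (isCompact_range γ.continuous).union (isCompact_closedBall z r)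
    have hz₀L : z₀ ∈ range γ ∪ closedBall z r := Or.inl ⟨0, γ.source⟩
    obtain ⟨ψ, hψ, he⟩ := hcpt _ hLU hLc
    refine ⟨_, fun w => ψ w + (log (f z₀) - ψ z₀), hLU, hLc, ?_, hz₀L, ?_,
      hψ.add continuousOn_const, fun w hw => ?_, by ring⟩
    · exact (isPreconnected_range γ.continuous).union z ⟨1, γ.target⟩ (mem_closedBall_self hr.le)
        (convex_closedBall z r).isPreconnected
    · exact mem_of_superset (closedBall_mem_nhds z hr) subset_union_right
    · rw [exp_add, he w hw, exp_sub, exp_log (h0 _ hz₀), he z₀ hz₀L, div_self (h0 _ hz₀), mul_one]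
  choose! L ψ hLU hLc hLp hz₀L hLn hψ he hψ0 using hex
  have hagree : ∀ z ∈ U, ∀ w ∈ U, ∀ x, x ∈ L z → x ∈ L w → ψ z x = ψ w x := by
    intro z hz w hw x hxz hxw
    obtain ⟨χ, hχ, hχe⟩ := hcpt _ (union_subset (hLU z hz) (hLU w hw)) ((hLc z hz).union (hLc w hw))
    have h1 := sub_eq_of_exp_eq (hLp z hz) (hψ z hz) (hχ.mono subset_union_left)
      (fun y hy => (he z hz y hy).trans (hχe y (Or.inl hy)).symm) hxz (hz₀L z hz)
    have h2 := sub_eq_of_exp_eq (hLp w hw) (hψ w hw) (hχ.mono subset_union_right)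
      (fun y hy => (he w hw y hy).trans (hχe y (Or.inr hy)).symm) hxw (hz₀L w hw)
    rw [hψ0 z hz] at h1
    rw [hψ0 w hw] at h2
    linear_combination h1 - h2
  refine ⟨fun z => ψ z z, fun z hz => ContinuousAt.continuousWithinAt ?_,
    fun z hz => he z hz z (mem_of_mem_nhds (hLn z hz))⟩
  refine ((hψ z hz).continuousAt (hLn z hz)).congr ?_
  filter_upwards [hLn z hz] with w hw
  have hwU := hLU z hz hw
  exact hagree z hz w hwU w hw (mem_of_mem_nhds (hLn w hwU))

/-! ### The Riemann mapping theorem -/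

/-- Hurwitz's theorem for limits of nonvanishing holomorphic functions. -/
theorem hurwitz {ι : Type*} {p : Filter ι} [p.NeBot] {F : ι → ℂ → ℂ} {f : ℂ → ℂ} {U : Set ℂ}
    (hU : IsOpen U) (hUc : IsPreconnected U) (hF : ∀ n, DifferentiableOn ℂ (F n) U)
    (h0 : ∀ n, ∀ z ∈ U, F n z ≠ 0) (h : TendstoLocallyUniformlyOn F f p U) :
    (∀ z ∈ U, f z = 0) ∨ ∀ z ∈ U, f z ≠ 0 := by
  have hfd : DifferentiableOn ℂ f U := h.differentiableOn (.of_forall hF) hU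
  have hfa : AnalyticOnNhd ℂ f U := hfd.analyticOnNhd hU
  by_contra! hcon
  obtain ⟨⟨b, hb, hfb⟩, a, ha, hfa0⟩ := hcon
  rcases (hfa a ha).eventually_eq_zero_or_eventually_ne_zero with h1 | h1
  · exact hfb (hfa.eqOn_zero_of_preconnected_of_eventuallyEq_zero hUc ha h1 hb)
  obtain ⟨r, hr, hrU⟩ : ∃ r > 0, closedBall a r ⊆ U ∩ {z | z ≠ a → f z ≠ 0} :=
    nhds_basis_closedBall.mem_iff.1
      (inter_mem (hU.mem_nhds ha) (eventually_nhdsWithin_iff.1 h1))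
  have hcU : closedBall a r ⊆ U := fun z hz => (hrU hz).1
  have hne : ∀ z ∈ sphere a r, f z ≠ 0 := fun z hz =>
    (hrU (sphere_subset_closedBall hz)).2 (ne_of_mem_sphere hz hr.ne')
  obtain ⟨w, hw, hmin⟩ := (isCompact_sphere a r).exists_isMinOn
    (NormedSpace.sphere_nonempty.2 hr.le)
    ((hfd.continuousOn.mono (sphere_subset_closedBall.trans hcU)).norm)
  have hδ : 0 < ‖f w‖ := norm_pos_iff.2 (hne w hw)
  have hunif := (tendstoLocallyUniformlyOn_iff_forall_isCompact hU).1 h _ hcU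
    (isCompact_closedBall a r)
  obtain ⟨n, hn⟩ := ((Metric.tendstoUniformlyOn_iff.1 hunif) (‖f w‖ / 2) (half_pos hδ)).exists
  have hsph : ∀ z ∈ frontier (ball a r), ‖(F n z)⁻¹‖ ≤ (‖f w‖ / 2)⁻¹ := by
    intro z hz
    rw [frontier_ball a hr.ne'] at hz
    have h2 := hn z (sphere_subset_closedBall hz)
    have h3 : ‖f w‖ ≤ ‖f z‖ := hmin hz
    rw [dist_eq_norm] at h2
    have h4 := norm_sub_norm_le (f z) (F n z)
    rw [norm_inv]
    exact inv_anti₀ (half_pos hδ) (by linarith)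
  have hd : DiffContOnCl ℂ (fun z => (F n z)⁻¹) (ball a r) := by
    apply DifferentiableOn.diffContOnCl
    rw [closure_ball a hr.ne']
    exact ((hF n).mono hcU).inv fun z hz => h0 n z (hcU hz)
  have h5 := Complex.norm_le_of_forall_mem_frontier_norm_le isBounded_ball hd hsph
    (subset_closure (mem_ball_self hr))
  have h6 := hn a (mem_closedBall_self hr.le)
  rw [hfa0, dist_zero_left] at h6
  rw [norm_inv, inv_le_inv₀ (norm_pos_iff.2 (h0 n a ha)) (half_pos hδ)] at h5
  linarith

/-- Holomorphic injections of `U` into the unit disc that send `z₀` to `0`. -/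
structure Univalent (U : Set ℂ) (z₀ : ℂ) (f : ℂ → ℂ) : Prop where
  diff : DifferentiableOn ℂ f U
  inj : InjOn f U
  ne : ∀ z ∈ U, deriv f z ≠ 0
  mapsTo : MapsTo f U (ball 0 1)
  zero : f z₀ = 0

theorem tendstoLocallyUniformlyOn_of_bounded {ι : Type*} {p : Filter ι} [p.NeBot]
    {F : ι → ℂ → ℂ} {f : ℂ → ℂ} {U : Set ℂ} (hU : IsOpen U)
    (hF : ∀ n, DifferentiableOn ℂ (F n) U) (hb : ∀ n, MapsTo (F n) U (ball 0 1))
    (h : ∀ z ∈ U, Tendsto (fun n => F n z) p (𝓝 (f z))) :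
    TendstoLocallyUniformlyOn F f p U := by
  rw [Metric.tendstoLocallyUniformlyOn_iff]
  intro ε hε z hz
  obtain ⟨r, hr, hrU⟩ := Metric.isOpen_iff.1 hU z hz
  have hlip : ∀ n, ∀ w ∈ ball z r, dist (F n w) (F n z) ≤ 2 / r * dist w z := by
    intro n w hw
    refine Complex.dist_le_div_mul_dist_of_mapsTo_ball ((hF n).mono hrU) ?_ hw
    intro v hv
    have h1 := mem_ball_zero_iff.1 (hb n (hrU hv))
    have h2 := mem_ball_zero_iff.1 (hb n hz)
    rw [mem_closedBall, dist_eq_norm]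
    linarith [norm_sub_le (F n v) (F n z)]
  have hlim : ∀ w ∈ ball z r, dist (f w) (f z) ≤ 2 / r * dist w z := fun w hw =>
    le_of_tendsto ((h w (hrU hw)).dist (h z hz)) (.of_forall fun n => hlip n w hw)
  refine ⟨ball z (min r (r * ε / 8)), mem_nhdsWithin_of_mem_nhds (ball_mem_nhds z (by positivity)),
    ?_⟩
  filter_upwards [(Metric.tendsto_nhds.1 (h z hz)) (ε / 4) (by positivity)] with n hn w hw
  rw [mem_ball, lt_min_iff] at hw
  have h1 := hlip n w hw.1
  have h2 := hlim w hw.1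
  have h3 : 2 / r * dist w z < ε / 4 := by
    calc 2 / r * dist w z < 2 / r * (r * ε / 8) := by gcongr; exact hw.2
      _ = ε / 4 := by field_simp; ring
  rw [dist_comm] at h1 hn
  linarith [dist_triangle4 (f w) (f z) (F n z) (F n w)]

/-- A limit of univalent maps whose derivative at the base point is nonzero is univalent. -/
theorem Univalent.of_tendsto {ι : Type*} {p : Filter ι} [p.NeBot]
    {F : ι → ℂ → ℂ} {f : ℂ → ℂ} {U : Set ℂ} {z₀ : ℂ} (hU : IsOpen U) (hUc : IsPreconnected U)
    (hz₀ : z₀ ∈ U) (hF : ∀ n, Univalent U z₀ (F n))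
    (h : TendstoLocallyUniformlyOn F f p U) (hne : deriv f z₀ ≠ 0) : Univalent U z₀ f := by
  have hfd : DifferentiableOn ℂ f U := h.differentiableOn (.of_forall fun n => (hF n).diff) hU
  have hfa : AnalyticOnNhd ℂ f U := hfd.analyticOnNhd hU
  have hlim : ∀ z ∈ U, Tendsto (fun n => F n z) p (𝓝 (f z)) := fun z hz => h.tendsto_at hz
  have hconst : ∀ a ∈ U, ∀ c, ¬ f =ᶠ[𝓝 a] fun _ => c := by
    intro a ha c hc
    have h1 := hfa.eqOn_of_preconnected_of_eventuallyEq (g := fun _ => c)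
      analyticOnNhd_const hUc ha hc
    apply hne
    rw [(h1.eventuallyEq_of_mem (hU.mem_nhds hz₀)).deriv_eq, deriv_const]
  refine ⟨hfd, ?_, ?_, ?_, ?_⟩
  · intro a ha b hb hab
    by_contra hne'
    obtain ⟨r, hr, hrU⟩ := Metric.isOpen_iff.1 (hU.inter isOpen_compl_singleton) a ⟨ha, hne'⟩
    have hsub : ball a r ⊆ U := hrU.trans inter_subset_left
    have hcv : TendstoLocallyUniformlyOn (fun n z => F n z - F n b) (fun z => f z - f b) p
        (ball a r) := by
      refine (h.mono hsub).sub ?_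
      rw [Metric.tendstoLocallyUniformlyOn_iff]
      intro ε hε x _
      refine ⟨univ, univ_mem, ?_⟩
      filter_upwards [(Metric.tendsto_nhds.1 (hlim b hb)) ε hε] with n hn y _
      rwa [dist_comm]
    rcases hurwitz isOpen_ball (convex_ball a r).isPreconnected
      (fun n => ((hF n).diff.mono hsub).sub_const _)
      (fun n z hz h0 => (hrU hz).2 ((hF n).inj (hsub hz) hb (sub_eq_zero.1 h0))) hcv with h1 | h1
    · exact hconst a ha (f b) (Filter.eventually_of_mem (ball_mem_nhds a hr)
        fun z hz => sub_eq_zero.1 (h1 z hz))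
    · exact h1 a (mem_ball_self hr) (sub_eq_zero.2 hab)
  · rcases hurwitz hU hUc (fun n => (hF n).diff.deriv hU) (fun n => (hF n).ne)
      (h.deriv (.of_forall fun n => (hF n).diff) hU) with h1 | h1
    · exact absurd (h1 z₀ hz₀) hne
    · exact h1
  · have hle : ∀ z ∈ U, ‖f z‖ ≤ 1 := fun z hz => le_of_tendsto (hlim z hz).norm
      (.of_forall fun n => (mem_ball_zero_iff.1 ((hF n).mapsTo hz)).le)
    intro a ha
    rw [mem_ball_zero_iff]
    refine lt_of_le_of_ne (hle a ha) fun h1 => ?_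
    have := Complex.eqOn_of_isPreconnected_of_isMaxOn_norm hUc hU hfd ha
      (fun z hz => by simpa [h1] using hle z hz)
    exact hconst a ha (f a) (this.eventuallyEq_of_mem (hU.mem_nhds ha))
  · exact tendsto_nhds_unique (hlim z₀ hz₀) (by simp [(hF _).zero])

/-- The disc automorphism sending `a` to `0`. -/
noncomputable def mob (a z : ℂ) : ℂ := (z - a) / (1 - (starRingEnd ℂ) a * z)

theorem mob_den_ne {a z : ℂ} (ha : ‖a‖ < 1) (hz : ‖z‖ < 1) : 1 - (starRingEnd ℂ) a * z ≠ 0 := by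
  intro h
  have h1 : ‖(starRingEnd ℂ) a * z‖ = 1 := by rw [← sub_eq_zero.1 h, norm_one]
  rw [norm_mul, RCLike.norm_conj] at h1
  nlinarith [norm_nonneg a, norm_nonneg z]

theorem norm_mob_lt {a z : ℂ} (ha : ‖a‖ < 1) (hz : ‖z‖ < 1) : ‖mob a z‖ < 1 := by
  have h0 := mob_den_ne ha hz
  rw [mob, norm_div, div_lt_one (norm_pos_iff.2 h0), ← sq_lt_sq₀ (norm_nonneg _) (norm_nonneg _)]
  have ha2 : ‖a‖ ^ 2 < 1 := by nlinarith [norm_nonneg a]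
  have hz2 : ‖z‖ ^ 2 < 1 := by nlinarith [norm_nonneg z]
  rw [Complex.sq_norm, Complex.normSq_apply] at *
  rw [Complex.sq_norm, Complex.normSq_apply] at *
  simp only [sub_re, sub_im, mul_re, mul_im, conj_re, conj_im, one_re, one_im]
  nlinarith [mul_pos (sub_pos.2 ha2) (sub_pos.2 hz2)]

theorem hasDerivAt_mob {a z : ℂ} (ha : ‖a‖ < 1) (hz : ‖z‖ < 1) :
    HasDerivAt (mob a) ((1 - (starRingEnd ℂ) a * a) / (1 - (starRingEnd ℂ) a * z) ^ 2) z := by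
  have h0 := mob_den_ne ha hz
  have h1 : HasDerivAt (fun z : ℂ => z - a) 1 z := (hasDerivAt_id z).sub_const a
  have h2 : HasDerivAt (fun z : ℂ => 1 - (starRingEnd ℂ) a * z) (-(starRingEnd ℂ) a) z := by
    simpa using ((hasDerivAt_id z).const_mul ((starRingEnd ℂ) a)).const_sub 1
  convert! h1.div h2 h0 using 1
  ring

theorem mob_injOn {a : ℂ} (ha : ‖a‖ < 1) : InjOn (mob a) (ball 0 1) := by
  intro z hz w hw h
  have hz0 := mob_den_ne ha (mem_ball_zero_iff.1 hz)
  have hw0 := mob_den_ne ha (mem_ball_zero_iff.1 hw)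
  rw [mob, mob, div_eq_div_iff hz0 hw0] at h
  have h1 : (1 - (starRingEnd ℂ) a * a) * (z - w) = 0 := by linear_combination h
  exact sub_eq_zero.1 ((mul_eq_zero.1 h1).resolve_left (mob_den_ne ha ha))

theorem HasLog.exists_differentiable {U : Set ℂ} (hU : IsOpen U) {h : ℂ → ℂ}
    (hd : DifferentiableOn ℂ h U) (hl : HasLog h U) :
    ∃ φ : ℂ → ℂ, DifferentiableOn ℂ φ U ∧ ∀ z ∈ U, exp (φ z) = h z := by
  obtain ⟨φ, hφ, he⟩ := hl
  refine ⟨φ, fun z hz => ?_, he⟩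
  have hU' := hU.mem_nhds hz
  have hz0 : h z ≠ 0 := he z hz ▸ exp_ne_zero _
  have hdz : DifferentiableAt ℂ h z := hd.differentiableAt hU'
  have hcont : ContinuousAt (fun w => φ w - φ z) z :=
    (hφ.continuousAt hU').sub continuousAt_const
  have hev : ∀ᶠ w in 𝓝 z, ‖φ w - φ z‖ < 1 := by
    have := hcont.norm.eventually_lt_const (u := 1) (by simp)
    exact this
  have heq : φ =ᶠ[𝓝 z] fun w => φ z + log (h w / h z) := by
    filter_upwards [hev, hU'] with w hw hwU
    have him := abs_im_le_norm (φ w - φ z)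
    have hpi := Real.pi_gt_three
    rw [← he w hwU, ← he z hz, ← exp_sub, log_exp]
    · ring
    · linarith [neg_abs_le (φ w - φ z).im]
    · linarith [le_abs_self (φ w - φ z).im]
  have hlog : DifferentiableAt ℂ (fun w => φ z + log (h w / h z)) z := by
    refine (DifferentiableAt.clog (hdz.div_const _) ?_).const_add _
    rw [div_self hz0]
    exact one_mem_slitPlane
  exact (hlog.congr_of_eventuallyEq heq).differentiableWithinAt

/-- If a univalent map omits a value of the disc, its derivative at the base point can be
increased. -/
theorem Univalent.exists_deriv_lt {U : Set ℂ} {z₀ : ℂ} {f : ℂ → ℂ} (hf : Univalent U z₀ f)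
    (hU : IsOpen U) (hz₀ : z₀ ∈ U)
    (hlog : ∀ h : ℂ → ℂ, ContinuousOn h U → (∀ z ∈ U, h z ≠ 0) → HasLog h U) {w : ℂ}
    (hw : w ∈ ball (0 : ℂ) 1) (hwf : w ∉ f '' U) :
    ∃ g, Univalent U z₀ g ∧ ‖deriv f z₀‖ < ‖deriv g z₀‖ := by
  have hw1 := mem_ball_zero_iff.1 hw
  have hf1 : ∀ z ∈ U, ‖f z‖ < 1 := fun z hz => mem_ball_zero_iff.1 (hf.mapsTo hz)
  have hfd : ∀ z ∈ U, HasDerivAt f (deriv f z) z := fun z hz =>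
    (hf.diff.differentiableAt (hU.mem_nhds hz)).hasDerivAt
  have hw0 : w ≠ 0 := fun h => hwf ⟨z₀, hz₀, by rw [hf.zero, h]⟩
  have hnd : ∀ a : ℂ, ‖a‖ < 1 → 1 - (starRingEnd ℂ) a * a ≠ 0 := fun a ha => mob_den_ne ha ha
  have hh : ∀ z ∈ U, HasDerivAt (fun z => mob w (f z))
      ((1 - (starRingEnd ℂ) w * w) / (1 - (starRingEnd ℂ) w * f z) ^ 2 * deriv f z) z :=
    fun z hz => (hasDerivAt_mob hw1 (hf1 z hz)).comp z (hfd z hz)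
  have hdh : DifferentiableOn ℂ (fun z => mob w (f z)) U := fun z hz =>
    (hh z hz).differentiableAt.differentiableWithinAt
  have hh0 : ∀ z ∈ U, mob w (f z) ≠ 0 := fun z hz h0 => by
    rw [mob, div_eq_zero_iff, or_iff_left (mob_den_ne hw1 (hf1 z hz))] at h0
    exact hwf ⟨z, hz, sub_eq_zero.1 h0⟩
  obtain ⟨φ, hφ, he⟩ := (hlog _ hdh.continuousOn hh0).exists_differentiable hU hdh
  set s : ℂ → ℂ := fun z => exp (φ z / 2) with hs
  have hs2 : ∀ z ∈ U, s z ^ 2 = mob w (f z) := fun z hz => by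
    rw [hs, ← he z hz, ← exp_nat_mul]
    congr 1
    push_cast
    ring
  have hs0 : ∀ z, s z ≠ 0 := fun z => exp_ne_zero _
  have hsd : DifferentiableOn ℂ s U := (hφ.div_const 2).cexp
  have hsd' : ∀ z ∈ U, HasDerivAt s (deriv s z) z := fun z hz =>
    (hsd.differentiableAt (hU.mem_nhds hz)).hasDerivAt
  have hs1 : ∀ z ∈ U, ‖s z‖ < 1 := fun z hz => by
    have h1 := norm_mob_lt hw1 (hf1 z hz)
    rw [← hs2 z hz, norm_pow] at h1
    exact lt_of_pow_lt_pow_left₀ 2 zero_le_one (by simpa using h1)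
  have hderiv : ∀ z ∈ U, 2 * s z * deriv s z =
      (1 - (starRingEnd ℂ) w * w) / (1 - (starRingEnd ℂ) w * f z) ^ 2 * deriv f z := by
    intro z hz
    have h1 : HasDerivAt (fun z => s z ^ 2) (2 * s z * deriv s z) z := by
      simpa using (hsd' z hz).fun_pow 2
    refine h1.unique ((hh z hz).congr_of_eventuallyEq ?_)
    filter_upwards [hU.mem_nhds hz] with v hv using hs2 v hv
  have hs'0 : ∀ z ∈ U, deriv s z ≠ 0 := by
    intro z hz h0
    have h1 := hderiv z hz
    rw [h0, mul_zero] at h1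
    exact mul_ne_zero (div_ne_zero (hnd w hw1) (pow_ne_zero 2 (mob_den_ne hw1 (hf1 z hz))))
      (hf.ne z hz) h1.symm
  set a := s z₀ with ha
  have ha1 : ‖a‖ < 1 := hs1 z₀ hz₀
  have hψ : ∀ z ∈ U, HasDerivAt (fun z => mob a (s z))
      ((1 - (starRingEnd ℂ) a * a) / (1 - (starRingEnd ℂ) a * s z) ^ 2 * deriv s z) z :=
    fun z hz => (hasDerivAt_mob ha1 (hs1 z hz)).comp z (hsd' z hz)
  refine ⟨fun z => mob a (s z), ⟨fun z hz => (hψ z hz).differentiableAt.differentiableWithinAt,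
    ?_, ?_, fun z hz => mem_ball_zero_iff.2 (norm_mob_lt ha1 (hs1 z hz)), by simp [mob, ← ha]⟩, ?_⟩
  · intro x hx y hy hxy
    have h1 : s x = s y := mob_injOn ha1 (mem_ball_zero_iff.2 (hs1 x hx))
      (mem_ball_zero_iff.2 (hs1 y hy)) hxy
    have h2 : mob w (f x) = mob w (f y) := by rw [← hs2 x hx, ← hs2 y hy, h1]
    exact hf.inj hx hy (mob_injOn hw1 (hf.mapsTo hx) (hf.mapsTo hy) h2)
  · intro z hz
    rw [(hψ z hz).deriv]
    exact mul_ne_zero (div_ne_zero (hnd a ha1) (pow_ne_zero 2 (mob_den_ne ha1 (hs1 z hz))))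
      (hs'0 z hz)
  · rw [(hψ z₀ hz₀).deriv, ← ha]
    have h1 := hderiv z₀ hz₀
    rw [hf.zero, ← ha] at h1
    have h2 := hs2 z₀ hz₀
    rw [hf.zero, ← ha] at h2
    have h3 : w = -a ^ 2 := by rw [h2]; simp [mob]
    set t := ‖a‖ with ht
    have ht0 : 0 < t := norm_pos_iff.2 (hs0 z₀)
    have hca : (starRingEnd ℂ) a * a = ((t ^ 2 : ℝ) : ℂ) := by
      rw [conj_mul', ofReal_pow]
    have hcw : (starRingEnd ℂ) w * w = ((t ^ 4 : ℝ) : ℂ) := by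
      rw [conj_mul', h3, norm_neg, norm_pow]
      push_cast
      ring
    have hn1 : ‖(1 : ℂ) - ((t ^ 2 : ℝ) : ℂ)‖ = 1 - t ^ 2 := by
      rw [← ofReal_one, ← ofReal_sub, norm_real, Real.norm_of_nonneg]
      nlinarith
    have hn2 : ‖(1 : ℂ) - ((t ^ 4 : ℝ) : ℂ)‖ = 1 - t ^ 4 := by
      rw [← ofReal_one, ← ofReal_sub, norm_real, Real.norm_of_nonneg]
      nlinarith [pow_le_one₀ (n := 4) ht0.le ha1.le]
    have h4 := congrArg norm h1
    simp only [mul_zero, sub_zero, one_pow, div_one, norm_mul, hcw, hn2, ← ht, Complex.norm_two]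
      at h4
    rw [norm_mul, norm_div, norm_pow, hca, hn1]
    have hu : 0 < 1 - t ^ 2 := by nlinarith
    have hf' : 0 < ‖deriv f z₀‖ := norm_pos_iff.2 (hf.ne z₀ hz₀)
    have h5 : ‖deriv s z₀‖ = (1 - t ^ 4) * ‖deriv f z₀‖ / (2 * t) := by
      rw [eq_div_iff (by positivity)]
      linarith
    have h6 : (1 - t ^ 2) / (1 - t ^ 2) ^ 2 * ‖deriv s z₀‖ =
        ‖deriv f z₀‖ * ((1 + t ^ 2) / (2 * t)) := by
      rw [h5]
      field_simp
      ring
    rw [h6]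
    refine lt_mul_of_one_lt_right hf' ?_
    rw [one_lt_div (by positivity)]
    nlinarith [sq_pos_of_pos (sub_pos.2 ha1)]

/-- The Riemann mapping theorem for bounded domains on which continuous nonvanishing functions
have logarithms. -/
theorem exists_univalent_surjective {U : Set ℂ} (hU : IsOpen U) (hUc : IsPreconnected U)
    (hb : Bornology.IsBounded U) {z₀ : ℂ} (hz₀ : z₀ ∈ U)
    (hlog : ∀ h : ℂ → ℂ, ContinuousOn h U → (∀ z ∈ U, h z ≠ 0) → HasLog h U) :
    ∃ f, Univalent U z₀ f ∧ f '' U = ball 0 1 := by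
  set S : Set ℝ := {x | ∃ f, Univalent U z₀ f ∧ ‖deriv f z₀‖ = x} with hS
  obtain ⟨r, hr, hrU⟩ := Metric.isOpen_iff.1 hU z₀ hz₀
  have hbd : BddAbove S := by
    refine ⟨1 / r, ?_⟩
    rintro _ ⟨f, hf, rfl⟩
    refine Complex.norm_deriv_le_div_of_mapsTo_ball (hf.diff.mono hrU) (fun z hz => ?_) hr
    rw [hf.zero]
    exact ball_subset_closedBall (hf.mapsTo (hrU hz))
  have hne : S.Nonempty := by
    obtain ⟨R, hR⟩ := hb.subset_ball z₀
    have hR0 : 0 < R := pos_of_mem_ball (hR hz₀)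
    have hR0' : (R : ℂ) ≠ 0 := ofReal_ne_zero.2 hR0.ne'
    have hd : ∀ z : ℂ, HasDerivAt (fun z : ℂ => (z - z₀) / R) (1 / R) z := fun z =>
      ((hasDerivAt_id z).sub_const z₀).div_const _
    refine ⟨_, fun z => (z - z₀) / R, ⟨fun z _ => (hd z).differentiableAt.differentiableWithinAt,
      fun x _ y _ h => ?_, fun z _ => ?_, fun z hz => ?_, by simp⟩, rfl⟩
    · simpa [div_left_inj' hR0'] using h
    · rw [(hd z).deriv]
      exact one_div_ne_zero hR0'
    · rw [mem_ball_zero_iff, norm_div, norm_real, Real.norm_of_nonneg hR0.le, div_lt_one hR0,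
        ← dist_eq_norm]
      exact hR hz
  obtain ⟨u, -, hu, huS⟩ := exists_seq_tendsto_sSup hne hbd
  choose F hF hFu using huS
  have hpt : ∀ z ∈ U, ∃ y, Tendsto (fun n => F n z) (hyperfilter ℕ) (𝓝 y) := by
    intro z hz
    obtain ⟨y, -, hy⟩ := (isCompact_closedBall (0 : ℂ) 1).ultrafilter_le_nhds
      (Ultrafilter.map (fun n => F n z) (hyperfilter ℕ))
      (le_principal_iff.2 (Ultrafilter.mem_map.2 (Filter.univ_mem' fun n =>
        ball_subset_closedBall ((hF n).mapsTo hz))))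
    exact ⟨y, hy⟩
  choose! f hf using hpt
  have hcv := tendstoLocallyUniformlyOn_of_bounded hU (fun n => (hF n).diff)
    (fun n => (hF n).mapsTo) hf
  have hmax : ‖deriv f z₀‖ = sSup S := by
    have h1 := ((hcv.deriv (.of_forall fun n => (hF n).diff) hU).tendsto_at hz₀).norm
    refine tendsto_nhds_unique h1 ?_
    simp only [Function.comp_apply, hFu]
    exact hu.mono_left Nat.hyperfilter_le_atTop
  have hpos : 0 < ‖deriv f z₀‖ := by
    rw [hmax]
    obtain ⟨_, g, hg, rfl⟩ := hne
    exact (norm_pos_iff.2 (hg.ne z₀ hz₀)).trans_le (le_csSup hbd ⟨g, hg, rfl⟩)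
  have hfu : Univalent U z₀ f := Univalent.of_tendsto hU hUc hz₀ hF hcv (norm_pos_iff.1 hpos)
  refine ⟨f, hfu, hfu.mapsTo.image_subset.antisymm fun w hw => ?_⟩
  by_contra hwf
  obtain ⟨g, hg, hlt⟩ := hfu.exists_deriv_lt hU hz₀ hlog hw hwf
  exact (le_csSup hbd ⟨g, hg, rfl⟩).not_gt (hmax ▸ hlt)

/-- A bijective holomorphic map with nonvanishing derivative has a holomorphic inverse. -/
theorem exists_conformal_inverse {U : Set ℂ} (hU : IsOpen U) {z₀ : ℂ} (hz₀ : z₀ ∈ U) {f : ℂ → ℂ}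
    (hf : Univalent U z₀ f) (hs : f '' U = ball 0 1) :
    ∃ g : ℂ → ℂ, DifferentiableOn ℂ g (ball 0 1) ∧ MapsTo g (ball 0 1) U ∧
      LeftInvOn f g (ball 0 1) ∧ LeftInvOn g f U ∧ g 0 = z₀ := by
  set g := Function.invFunOn f U
  have hgU : MapsTo g (ball 0 1) U := fun w hw => Function.invFunOn_mem (hs ▸ hw : w ∈ f '' U)
  have hfg : LeftInvOn f g (ball 0 1) := fun w hw =>
    Function.invFunOn_eq (hs ▸ hw : w ∈ f '' U)
  have hgf : LeftInvOn g f U := hf.inj.leftInvOn_invFunOn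
  refine ⟨g, fun w hw => ?_, hgU, hfg, hgf, by rw [← hf.zero, hgf hz₀]⟩
  have hz := hgU hw
  have hsd : HasStrictDerivAt f (deriv f (g w)) (g w) :=
    ((hf.diff.analyticOnNhd hU) _ hz).hasStrictDerivAt
  have hc : ContinuousAt g w := by
    intro N hN
    have h1 : f '' (N ∩ U) ∈ 𝓝 w := by
      rw [← hfg hw, ← hsd.map_nhds_eq (hf.ne _ hz)]
      exact image_mem_map (inter_mem hN (hU.mem_nhds hz))
    refine mem_map.2 (mem_of_superset h1 ?_)
    rintro _ ⟨x, ⟨hxN, hxU⟩, rfl⟩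
    change g (f x) ∈ N
    rwa [hgf hxU]
  exact (HasDerivAt.of_local_left_inverse hc hsd.hasDerivAt (hf.ne _ hz)
    (eventually_of_mem (isOpen_ball.mem_nhds hw) hfg)).differentiableAt.differentiableWithinAt

/-! ### The length–area estimate -/

open MeasureTheory in
theorem lintegral_norm_deriv_sq {G : ℂ → ℂ} {s : Set ℂ} (hs : IsOpen s)
    (hd : DifferentiableOn ℂ G s) (hi : InjOn G s) :
    ∫⁻ w in s, ENNReal.ofReal (‖deriv G w‖ ^ 2) = volume (G '' s) := by
  rw [← lintegral_abs_det_fderiv_eq_addHaar_image volume hs.measurableSet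
    (f' := fun w => (ContinuousLinearMap.toSpanSingleton ℂ (deriv G w)).restrictScalars ℝ)
    (fun w hw => ((hd.differentiableAt
      (hs.mem_nhds hw)).hasDerivAt.hasFDerivAt.restrictScalars ℝ).hasFDerivWithinAt) hi]
  refine setLIntegral_congr_fun hs.measurableSet fun w _ => ?_
  congr 1
  have : ((ContinuousLinearMap.toSpanSingleton ℂ (deriv G w)).restrictScalars ℝ).det =
      Algebra.norm ℝ (LinearMap.det
        (ContinuousLinearMap.toSpanSingleton ℂ (deriv G w)).toLinearMap) :=
    LinearMap.det_restrictScalars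
  rw [this, Algebra.norm_complex_apply, ← Complex.sq_norm, abs_of_nonneg (sq_nonneg _)]
  congr 2
  simp

theorem circle_mem_ball_one {r : ℝ} (hr : 0 < r) (θ : ℝ) :
    (r : ℂ) * exp (θ * I) ∈ ball (1 : ℂ) 1 ↔ r < 2 * Real.cos θ := by
  have h1 : ‖(r : ℂ) * exp (θ * I) - 1‖ ^ 2 = 1 - r * (2 * Real.cos θ - r) := by
    rw [Complex.sq_norm, Complex.normSq_apply, exp_mul_I, ← ofReal_cos, ← ofReal_sin]
    simp only [sub_re, sub_im, mul_re, mul_im, add_re, add_im, ofReal_re, ofReal_im, I_re, I_im,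
      one_re, one_im]
    linear_combination r ^ 2 * Real.sin_sq_add_cos_sq θ
  rw [mem_ball, dist_eq_norm, ← sq_lt_sq₀ (norm_nonneg _) zero_le_one, h1, one_pow,
    sub_lt_self_iff, mul_pos_iff_of_pos_left hr, sub_pos]

theorem min_cos_le {a b θ : ℝ} (ha : -Real.pi ≤ a) (hb : b ≤ Real.pi) (hθ : θ ∈ Icc a b) :
    min (Real.cos a) (Real.cos b) ≤ Real.cos θ := by
  rcases le_total 0 θ with h | h
  · exact (min_le_right _ _).trans (Real.cos_le_cos_of_nonneg_of_le_pi h hb hθ.2)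
  · refine (min_le_left _ _).trans ?_
    rw [← Real.cos_neg a, ← Real.cos_neg θ]
    exact Real.cos_le_cos_of_nonneg_of_le_pi (by linarith) (by linarith) (by linarith [hθ.1])

open MeasureTheory in
/-- The length of the image of a circular arc is controlled by the integral of the square of the
derivative over that arc. -/
theorem exists_lintegral_arc_ge {G : ℂ → ℂ} (hd : DifferentiableOn ℂ G (ball 1 1)) {ε r : ℝ}
    (hε : 0 < ε) (hr : 0 < r) {a b : ℝ} (hab : a ≤ b) (ha : -Real.pi ≤ a) (hb : b ≤ Real.pi)
    (hwa : (r : ℂ) * exp (a * I) ∈ ball (1 : ℂ) 1) (hwb : (r : ℂ) * exp (b * I) ∈ ball (1 : ℂ) 1)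
    (h : ε ≤ dist (G (r * exp (a * I))) (G (r * exp (b * I)))) :
    ENNReal.ofReal (ε ^ 2 / (4 * Real.pi) * r⁻¹) ≤ ENNReal.ofReal r *
      ∫⁻ θ in Ioo (-Real.pi) Real.pi, (ball (1 : ℂ) 1).indicator
        (fun w => ENNReal.ofReal (‖deriv G w‖ ^ 2)) (r * exp (θ * I)) := by
  have hpi := Real.pi_pos
  set γ : ℝ → ℂ := fun θ => r * exp (θ * I) with hγ
  have hγd : ∀ θ, HasDerivAt γ (γ θ * I) θ := by
    intro θ
    have h1 : HasDerivAt (fun z : ℂ => (r : ℂ) * exp (z * I)) (r * (exp (θ * I) * I)) θ := by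
      simpa using (((hasDerivAt_id (θ : ℂ)).mul_const I).cexp).const_mul (r : ℂ)
    simpa [hγ, mul_assoc] using h1.comp_ofReal
  have hγc : Continuous γ := continuous_iff_continuousAt.2 fun θ => (hγd θ).continuousAt
  have hγn : ∀ θ, ‖γ θ‖ = r := by
    intro θ
    rw [hγ]
    simp only [norm_mul, norm_exp_ofReal_mul_I, mul_one, norm_real, Real.norm_of_nonneg hr.le]
  have hmem : ∀ θ ∈ Icc a b, γ θ ∈ ball (1 : ℂ) 1 := by
    intro θ hθ
    rw [hγ]
    dsimp only
    rw [circle_mem_ball_one hr] at hwa hwb ⊢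
    rcases min_le_iff.1 (min_cos_le ha hb hθ) with h1 | h1 <;> linarith
  have hbpi : b < Real.pi := by
    refine lt_of_le_of_ne hb fun h1 => ?_
    rw [circle_mem_ball_one hr, h1, Real.cos_pi] at hwb
    linarith
  have hdc : ContinuousOn (fun θ => deriv G (γ θ)) (Icc a b) :=
    (hd.deriv isOpen_ball).continuousOn.comp hγc.continuousOn hmem
  have hdc' : ContinuousOn (fun θ => deriv G (γ θ)) (uIcc a b) := by rwa [uIcc_of_le hab]
  have hftc : ∫ θ in a..b, deriv G (γ θ) * (γ θ * I) = G (γ b) - G (γ a) := by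
    refine intervalIntegral.integral_eq_sub_of_hasDerivAt (f := fun θ => G (γ θ)) ?_ ?_
    · intro θ hθ
      rw [uIcc_of_le hab] at hθ
      exact (hd.differentiableAt (isOpen_ball.mem_nhds (hmem θ hθ))).hasDerivAt.comp θ (hγd θ)
    · exact (hdc'.mul (hγc.continuousOn.mul continuousOn_const)).intervalIntegrable
  set A : ℝ := ∫ θ in a..b, ‖deriv G (γ θ)‖ ^ 2 with hA
  have hAi : IntervalIntegrable (fun θ => ‖deriv G (γ θ)‖ ^ 2) volume a b :=
    (hdc'.norm.pow 2).intervalIntegrable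
  have hle : ε ≤ r ^ 2 * Real.pi / ε * A + ε / (4 * Real.pi) * (b - a) := by
    calc ε ≤ ‖∫ θ in a..b, deriv G (γ θ) * (γ θ * I)‖ := by
          rw [hftc, ← dist_eq_norm, dist_comm]
          exact h
      _ ≤ ∫ θ in a..b, ‖deriv G (γ θ) * (γ θ * I)‖ :=
          intervalIntegral.norm_integral_le_integral_norm hab
      _ ≤ ∫ θ in a..b, (r ^ 2 * Real.pi / ε * ‖deriv G (γ θ)‖ ^ 2 + ε / (4 * Real.pi)) := by
          refine intervalIntegral.integral_mono_on hab
            (hdc'.mul (hγc.continuousOn.mul continuousOn_const)).norm.intervalIntegrable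
            ((hAi.const_mul _).add intervalIntegrable_const) fun θ _ => ?_
          rw [norm_mul, norm_mul, hγn, norm_I, mul_one]
          set x := ‖deriv G (γ θ)‖
          rw [← sub_nonneg]
          have : r ^ 2 * Real.pi / ε * x ^ 2 + ε / (4 * Real.pi) - x * r =
              (2 * Real.pi * r * x - ε) ^ 2 / (4 * Real.pi * ε) := by
            field_simp
            ring
          rw [this]
          positivity
      _ = _ := by
          rw [intervalIntegral.integral_add (hAi.const_mul _) intervalIntegrable_const,
            intervalIntegral.integral_const_mul, intervalIntegral.integral_const, smul_eq_mul,
            mul_comm (b - a)]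
  have hAge : ε ^ 2 / (4 * Real.pi) * r⁻¹ ≤ r * A := by
    have h1 : ε / (4 * Real.pi) * (b - a) ≤ ε / 2 := by
      calc ε / (4 * Real.pi) * (b - a) ≤ ε / (4 * Real.pi) * (2 * Real.pi) := by
            gcongr
            linarith
        _ = ε / 2 := by field_simp; ring
    have h2 : ε / 2 ≤ r ^ 2 * Real.pi / ε * A := by linarith
    have h3 : ε / 2 * (ε / (Real.pi * r)) ≤ r ^ 2 * Real.pi / ε * A * (ε / (Real.pi * r)) := by
      gcongr
    have h4 : r ^ 2 * Real.pi / ε * A * (ε / (Real.pi * r)) = r * A := by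
      field_simp
    have h5 : ε ^ 2 / (4 * Real.pi) * r⁻¹ ≤ ε / 2 * (ε / (Real.pi * r)) := by
      rw [← sub_nonneg]
      have : ε / 2 * (ε / (Real.pi * r)) - ε ^ 2 / (4 * Real.pi) * r⁻¹ =
          ε ^ 2 / (4 * Real.pi * r) := by
        field_simp
        ring
      rw [this]
      positivity
    linarith
  refine (ENNReal.ofReal_le_ofReal hAge).trans ?_
  rw [ENNReal.ofReal_mul hr.le]
  gcongr
  rw [hA, intervalIntegral.integral_of_le hab, ofReal_integral_eq_lintegral_ofReal
    ((intervalIntegrable_iff_integrableOn_Ioc_of_le hab).1 hAi)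
    (Eventually.of_forall fun θ => sq_nonneg _)]
  calc ∫⁻ θ in Ioc a b, ENNReal.ofReal (‖deriv G (γ θ)‖ ^ 2)
      = ∫⁻ θ in Ioc a b, (ball (1 : ℂ) 1).indicator
          (fun w => ENNReal.ofReal (‖deriv G w‖ ^ 2)) (γ θ) := by
        refine setLIntegral_congr_fun measurableSet_Ioc fun θ hθ => ?_
        rw [indicator_of_mem (hmem θ (Ioc_subset_Icc_self hθ))]
    _ ≤ _ := by
        refine lintegral_mono_set fun θ hθ => ⟨ha.trans_lt hθ.1, hθ.2.trans_lt hbpi⟩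

open MeasureTheory in
/-- The length-area principle. -/
theorem exists_circle_dist_le {G : ℂ → ℂ} (hd : DifferentiableOn ℂ G (ball 1 1))
    (hi : InjOn G (ball 1 1)) (hb : Bornology.IsBounded (G '' ball 1 1)) {ε δ : ℝ} (hε : 0 < ε)
    (hδ : 0 < δ) : ∃ r ∈ Ioo 0 δ, ∀ w₁ ∈ sphere (0 : ℂ) r ∩ ball 1 1,
      ∀ w₂ ∈ sphere (0 : ℂ) r ∩ ball 1 1, dist (G w₁) (G w₂) ≤ ε := by
  by_contra! hcon
  set F : ℂ → ENNReal := (ball (1 : ℂ) 1).indicator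
    (fun w => ENNReal.ofReal (‖deriv G w‖ ^ 2)) with hF
  have hFm : Measurable F :=
    (((measurable_deriv G).norm.pow_const 2).ennreal_ofReal).indicator measurableSet_ball
  have hFi : ∫⁻ w, F w ≠ ⊤ := by
    rw [hF, lintegral_indicator measurableSet_ball, lintegral_norm_deriv_sq isOpen_ball hd hi]
    exact hb.measure_lt_top.ne
  have hge : ∀ r ∈ Ioo 0 δ, ENNReal.ofReal (ε ^ 2 / (4 * Real.pi) * r⁻¹) ≤ ENNReal.ofReal r *
      ∫⁻ θ in Ioo (-Real.pi) Real.pi, F (r * exp (θ * I)) := by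
    intro r hr
    obtain ⟨w₁, ⟨h1s, h1b⟩, w₂, ⟨h2s, h2b⟩, hlt⟩ := hcon r hr
    have he : ∀ w ∈ sphere (0 : ℂ) r, (r : ℂ) * exp (arg w * I) = w := by
      intro w hw
      rw [← mem_sphere_zero_iff_norm.1 hw, norm_mul_exp_arg_mul_I]
    rw [← he w₁ h1s] at h1b hlt
    rw [← he w₂ h2s] at h2b hlt
    rcases le_total (arg w₁) (arg w₂) with h | h
    · exact exists_lintegral_arc_ge hd hε hr.1 h (neg_pi_lt_arg _).le (arg_le_pi _) h1b h2b hlt.le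
    · rw [dist_comm] at hlt
      exact exists_lintegral_arc_ge hd hε hr.1 h (neg_pi_lt_arg _).le (arg_le_pi _) h2b h1b hlt.le
  have hpolar : ∫⁻ r in Ioi (0 : ℝ), ENNReal.ofReal r *
      ∫⁻ θ in Ioo (-Real.pi) Real.pi, F (r * exp (θ * I)) = ∫⁻ w, F w := by
    rw [← Complex.lintegral_comp_polarCoord_symm, polarCoord_target,
      Measure.volume_eq_prod, ← Measure.prod_restrict, lintegral_prod]
    · refine lintegral_congr fun r => ?_
      rw [← lintegral_const_mul' _ _ ENNReal.ofReal_ne_top]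
      refine lintegral_congr fun θ => ?_
      simp only [Complex.polarCoord_symm_apply, smul_eq_mul, exp_mul_I, ofReal_cos, ofReal_sin]
    · simp only [Complex.polarCoord_symm_apply, smul_eq_mul]
      refine Measurable.aemeasurable ?_
      refine (measurable_fst.ennreal_ofReal).mul (hFm.comp ?_)
      fun_prop
  have hfin : ∫⁻ r in Ioo 0 δ, ENNReal.ofReal (ε ^ 2 / (4 * Real.pi) * r⁻¹) ≠ ⊤ := by
    refine ne_top_of_le_ne_top (hpolar ▸ hFi) ?_
    calc _ ≤ ∫⁻ r in Ioo 0 δ, ENNReal.ofReal r *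
          ∫⁻ θ in Ioo (-Real.pi) Real.pi, F (r * exp (θ * I)) :=
          setLIntegral_mono' measurableSet_Ioo hge
      _ ≤ _ := lintegral_mono_set Ioo_subset_Ioi_self
  have hpi := Real.pi_pos
  have hInt : IntegrableOn (fun r : ℝ => ε ^ 2 / (4 * Real.pi) * r⁻¹) (Ioo 0 δ) := by
    refine ⟨by fun_prop, ?_⟩
    rw [hasFiniteIntegral_iff_ofReal]
    · exact hfin.lt_top
    · filter_upwards [ae_restrict_mem measurableSet_Ioo] with r hr
      have := hr.1
      positivity
  have hInt' : IntervalIntegrable (fun r : ℝ => r⁻¹) volume 0 δ := by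
    rw [intervalIntegrable_iff_integrableOn_Ioo_of_le hδ.le]
    have := hInt.const_mul (ε ^ 2 / (4 * Real.pi))⁻¹
    refine this.congr (Eventually.of_forall fun r => ?_)
    dsimp only
    rw [← mul_assoc, inv_mul_cancel₀ (by positivity), one_mul]
  rw [intervalIntegrable_inv_iff] at hInt'
  rcases hInt' with h | h
  · exact hδ.ne h
  · exact h left_mem_uIcc

/-! ### The Carathéodory extension theorem -/

theorem dist_le_of_mem_closure {s : Set ℂ} {δ : ℝ} (h : ∀ x ∈ s, ∀ y ∈ s, dist x y ≤ δ) :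
    ∀ x ∈ closure s, ∀ y ∈ closure s, dist x y ≤ δ := by
  intro x hx y hy
  have h1 : ∀ y ∈ s, dist x y ≤ δ := fun y hy =>
    closure_minimal (fun x hx => h x hx y hy) (isClosed_closedBall (x := y) (ε := δ)) hx
  have h2 := closure_minimal (fun y hy => by rw [mem_closedBall, dist_comm]; exact h1 y hy)
    (isClosed_closedBall (x := x) (ε := δ)) hy
  rwa [mem_closedBall, dist_comm] at h2

theorem IsJordan.exists_small_arc {p q : ℂ → ℂ} {J : Set ℂ} (hJ : IsJordan p q J) {ε : ℝ}
    (hε : 0 < ε) : ∃ δ > 0, ∀ T ⊆ J, (∀ x ∈ T, ∀ y ∈ T, dist x y ≤ δ) →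
      ∃ A, T ⊆ A ∧ A ⊆ J ∧ IsCompact A ∧ IsPreconnected A ∧ ∀ x ∈ A, ∃ t ∈ T, dist x t ≤ ε := by
  obtain ⟨η₁, hη₁, hp⟩ := Metric.uniformContinuousOn_iff.1
    ((isCompact_sphere (0 : ℂ) 1).uniformContinuousOn_of_continuous hJ.continuousOn) ε hε
  have harg : ContinuousAt arg 1 := continuousAt_arg one_mem_slitPlane
  obtain ⟨η₂, hη₂, ha⟩ := Metric.continuousAt_iff.1 harg (η₁ / 2) (half_pos hη₁)
  obtain ⟨δ, hδ, hq⟩ := Metric.uniformContinuousOn_iff.1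
    (hJ.isCompact.uniformContinuousOn_of_continuous hJ.continuousOn_inv) η₂ hη₂
  refine ⟨δ / 2, half_pos hδ, fun T hTJ hT => ?_⟩
  rcases T.eq_empty_or_nonempty with rfl | ⟨y, hy⟩
  · exact ⟨∅, Subset.rfl, empty_subset _, isCompact_empty, isPreconnected_empty, by simp⟩
  set c := q y with hc
  have hcS : c ∈ sphere (0 : ℂ) 1 := hJ.mapsTo_inv (hTJ hy)
  have hc1 : ‖c‖ = 1 := mem_sphere_zero_iff_norm.1 hcS
  have hc0 : c ≠ 0 := norm_ne_zero_iff.1 (by rw [hc1]; exact one_ne_zero)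
  set e : ℝ → ℂ := fun θ => c * exp (θ * I) with he
  have heS : ∀ θ, e θ ∈ sphere (0 : ℂ) 1 := fun θ => by
    rw [mem_sphere_zero_iff_norm, he]
    simp [hc1]
  have hec : Continuous e := by fun_prop
  have hpe : Continuous fun θ => p (e θ) :=
    hJ.continuousOn.comp_continuous hec heS
  refine ⟨(fun θ => p (e θ)) '' Icc (-(η₁ / 2)) (η₁ / 2), ?_, ?_, isCompact_Icc.image hpe,
    isPreconnected_Icc.image _ hpe.continuousOn, ?_⟩
  · intro x hx
    have hxS := hJ.mapsTo_inv (hTJ hx)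
    have hx1 : ‖q x‖ = 1 := mem_sphere_zero_iff_norm.1 hxS
    have h1 : dist (q x) c < η₂ := hq x (hTJ hx) y (hTJ hy) ((hT x hx y hy).trans_lt (by linarith))
    have h2 : dist (q x / c) 1 < η₂ := by
      rw [dist_eq_norm, div_sub_one hc0, norm_div, hc1, div_one, ← dist_eq_norm]
      exact h1
    have h3 := ha h2
    rw [arg_one, dist_zero_right, Real.norm_eq_abs] at h3
    refine ⟨arg (q x / c), abs_le.1 h3.le, ?_⟩
    have h4 : e (arg (q x / c)) = q x := by
      have h5 := norm_mul_exp_arg_mul_I (q x / c)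
      rw [norm_div, hc1, hx1, div_one, ofReal_one, one_mul] at h5
      rw [he]
      simp only [h5]
      field_simp
    simp only [h4]
    exact hJ.rightInv (hTJ hx)
  · rintro _ ⟨θ, -, rfl⟩
    exact hJ.mapsTo (heS θ)
  · rintro _ ⟨θ, hθ, rfl⟩
    refine ⟨y, hy, ?_⟩
    have h1 : dist (e θ) c < η₁ := by
      rw [dist_eq_norm, he]
      have h2 : c * exp (θ * I) - c = c * (exp (I * θ) - 1) := by ring_nf
      simp only [h2, norm_mul, hc1, one_mul]
      have h3 := Real.norm_exp_I_mul_ofReal_sub_one_le (x := θ)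
      rw [Real.norm_eq_abs] at h3
      linarith [abs_le.2 hθ]
    have h2 := hp _ (heS θ) _ hcS h1
    rw [hc, hJ.rightInv (hTJ hy)] at h2
    exact h2.le

/-- A homeomorphism `g` of the open unit disc onto the bounded domain `U`, with inverse `f`,
holomorphic in the disc. -/
structure DiscMap (U : Set ℂ) (f g : ℂ → ℂ) : Prop where
  isOpen : IsOpen U
  isPreconnected : IsPreconnected U
  isBounded : Bornology.IsBounded U
  continuousOn : ContinuousOn f U
  diff : DifferentiableOn ℂ g (ball 0 1)
  mapsTo : MapsTo f U (ball 0 1)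
  mapsTo_inv : MapsTo g (ball 0 1) U
  leftInv : LeftInvOn f g (ball 0 1)
  rightInv : LeftInvOn g f U

namespace DiscMap

variable {U J : Set ℂ} {f g p q : ℂ → ℂ}

theorem exists_circle (h : DiscMap U f g) {ζ : ℂ} (hζ : ζ ∈ sphere (0 : ℂ) 1) {ε δ : ℝ}
    (hε : 0 < ε) (hδ : 0 < δ) : ∃ r ∈ Ioo 0 δ, ∀ w₁ ∈ sphere ζ r ∩ ball 0 1,
      ∀ w₂ ∈ sphere ζ r ∩ ball 0 1, dist (g w₁) (g w₂) ≤ ε := by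
  have hζ1 : ‖ζ‖ = 1 := mem_sphere_zero_iff_norm.1 hζ
  have hζ0 : ζ ≠ 0 := norm_ne_zero_iff.1 (by rw [hζ1]; exact one_ne_zero)
  have hm : MapsTo (fun w : ℂ => ζ * (1 - w)) (ball 1 1) (ball 0 1) := by
    intro w hw
    rw [mem_ball_zero_iff, norm_mul, hζ1, one_mul, ← dist_eq_norm, dist_comm]
    exact hw
  obtain ⟨r, hr, hw⟩ := exists_circle_dist_le (G := fun w => g (ζ * (1 - w)))
    (h.diff.comp (by fun_prop) hm)
    (fun x hx y hy hxy => by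
      have := h.leftInv.injOn (hm hx) (hm hy) hxy
      simpa [hζ0] using this)
    (h.isBounded.subset (by
      rintro _ ⟨w, hw, rfl⟩
      exact h.mapsTo_inv (hm hw))) hε hδ
  refine ⟨r, hr, ?_⟩
  have key : ∀ w ∈ sphere ζ r ∩ ball 0 1, 1 - w / ζ ∈ sphere (0 : ℂ) r ∩ ball 1 1 ∧
      ζ * (1 - (1 - w / ζ)) = w := by
    rintro w ⟨h1, h2⟩
    refine ⟨⟨?_, ?_⟩, by field_simp; ring⟩
    · rw [mem_sphere_zero_iff_norm, one_sub_div hζ0, norm_div, hζ1, div_one, ← dist_eq_norm,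
        dist_comm]
      exact h1
    · rw [mem_ball, dist_eq_norm, sub_sub_cancel_left, norm_neg, norm_div, hζ1, div_one]
      exact mem_ball_zero_iff.1 h2
  intro w₁ h₁ w₂ h₂
  have := hw _ (key w₁ h₁).1 _ (key w₂ h₂).1
  simpa only [(key w₁ h₁).2, (key w₂ h₂).2] using this

theorem exists_dist_le (h : DiscMap U f g) (hJ : IsJordan p q J) (hUJ : frontier U = J) {ζ : ℂ}
    (hζ : ζ ∈ sphere (0 : ℂ) 1) {ε : ℝ} (hε : 0 < ε) : ∃ r > 0, ∀ w₁ ∈ ball ζ r ∩ ball 0 1,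
      ∀ w₂ ∈ ball ζ r ∩ ball 0 1, dist (g w₁) (g w₂) ≤ ε := by
  have h0 : (0 : ℂ) ∈ ball (0 : ℂ) 1 := mem_ball_self one_pos
  have hζ1 : ‖ζ‖ = 1 := mem_sphere_zero_iff_norm.1 hζ
  set c := g 0 with hc
  have hcU : c ∈ U := h.mapsTo_inv h0
  obtain ⟨s, hs, hsU⟩ := nhds_basis_closedBall.mem_iff.1 (h.isOpen.mem_nhds hcU)
  obtain ⟨y, hy, hymax⟩ := (isCompact_closedBall c s).exists_isMaxOn
    ⟨c, mem_closedBall_self hs.le⟩ ((h.continuousOn.mono hsU).norm)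
  have hρ : ‖f y‖ < 1 := mem_ball_zero_iff.1 (h.mapsTo (hsU hy))
  set ε' := min ε s / 8 with hε'
  have hε'0 : 0 < ε' := by positivity
  have hε'ε : 4 * ε' ≤ ε := by rw [hε']; linarith [min_le_left ε s, lt_min hε hs]
  have hε's : 2 * ε' < s := by rw [hε']; linarith [min_le_right ε s, lt_min hε hs]
  obtain ⟨δ, hδ, harc⟩ := hJ.exists_small_arc hε'0
  obtain ⟨r, ⟨hr0, hr1⟩, hC⟩ := h.exists_circle hζ (lt_min hδ hε'0) (sub_pos.2 hρ)
  set Q := closure (g '' (sphere ζ r ∩ ball 0 1)) with hQ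
  have hQd : ∀ x ∈ Q, ∀ y ∈ Q, dist x y ≤ min δ ε' := by
    refine dist_le_of_mem_closure ?_
    rintro _ ⟨x, hx, rfl⟩ _ ⟨y, hy, rfl⟩
    exact hC x hx y hy
  have hQc : IsCompact Q := by
    refine (h.isBounded.subset ?_).isCompact_closure
    rintro _ ⟨x, hx, rfl⟩
    exact h.mapsTo_inv hx.2
  obtain ⟨A, hTA, hAJ, hAc, hAp, hAT⟩ := harc (Q ∩ J) inter_subset_right
    fun x hx y hy => (hQd x hx.1 y hy.1).trans (min_le_left _ _)
  have hr1' : r < 1 := hr1.trans_le (by linarith [norm_nonneg (f y)])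
  have hw0 : ((1 - r : ℝ) : ℂ) * ζ ∈ sphere ζ r ∩ ball 0 1 := by
    constructor
    · rw [mem_sphere, dist_eq_norm]
      have : ((1 - r : ℝ) : ℂ) * ζ - ζ = -(r : ℂ) * ζ := by push_cast; ring
      rw [this, norm_mul, norm_neg, norm_real, hζ1, mul_one, Real.norm_of_nonneg hr0.le]
    · rw [mem_ball_zero_iff, norm_mul, norm_real, hζ1, mul_one, Real.norm_of_nonneg] <;> linarith
  set y₀ := g (((1 - r : ℝ) : ℂ) * ζ) with hy₀
  have hy₀Q : y₀ ∈ Q := subset_closure ⟨_, hw0, rfl⟩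
  have hK : ∀ x ∈ Q ∪ A, dist x y₀ ≤ 2 * ε' := by
    rintro x (hx | hx)
    · linarith [hQd x hx y₀ hy₀Q, min_le_right δ ε']
    · obtain ⟨t, ht, hxt⟩ := hAT x hx
      linarith [hQd t ht.1 y₀ hy₀Q, min_le_right δ ε', dist_triangle x t y₀]
  have hcy : 2 * ε' < dist c y₀ := by
    refine hε's.trans (not_le.1 fun hle => ?_)
    have h1 : y₀ ∈ closedBall c s := by rwa [mem_closedBall, dist_comm]
    have h2 : ‖f y₀‖ ≤ ‖f y‖ := hymax h1
    rw [hy₀, h.leftInv hw0.2, norm_mul, norm_real, hζ1, mul_one, Real.norm_of_nonneg] at h2 <;>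
      linarith
  have main : ∀ w ∈ ball ζ r ∩ ball 0 1, dist (g w) y₀ ≤ 2 * ε' := by
    rintro w ⟨hwζ, hw⟩
    by_contra! hlt
    have hwU := h.mapsTo_inv hw
    have hj1 : Joined (Q ∪ A) (g w) c := by
      refine ⟨(fun x => x + y₀) '' (ball 0 (min (dist (g w) y₀) (dist c y₀)))ᶜ,
        (isPreconnected_compl_ball _).image _ (by fun_prop), ?_, ?_, ?_⟩
      · rw [Set.disjoint_right]
        rintro x hx ⟨v, hv, rfl⟩
        have h1 := hK _ hx
        rw [dist_eq_norm, add_sub_cancel_right] at h1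
        rw [mem_compl_iff, mem_ball_zero_iff, not_lt, min_le_iff] at hv
        rcases hv with hv | hv <;> linarith
      · refine ⟨g w - y₀, ?_, by ring⟩
        rw [mem_compl_iff, mem_ball_zero_iff, not_lt, ← dist_eq_norm]
        exact min_le_left _ _
      · refine ⟨c - y₀, ?_, by ring⟩
        rw [mem_compl_iff, mem_ball_zero_iff, not_lt, ← dist_eq_norm]
        exact min_le_right _ _
    have hj2 : Joined J (g w) c := ⟨U, h.isPreconnected,
      hUJ ▸ Set.disjoint_iff_inter_eq_empty.2 h.isOpen.inter_frontier_eq, hwU, hcU⟩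
    have hInt : (Q ∪ A) ∩ J = A := by
      rw [union_inter_distrib_right, inter_eq_left.2 hAJ]
      exact union_eq_self_of_subset_left hTA
    obtain ⟨C, hCp, hCd, hwC, hcC⟩ := Joined.union (hQc.union hAc) hJ.isCompact
      (hInt.symm ▸ hAp) hj1 hj2
    have hCU : C ⊆ U := fun x hx => IsPreconnected.mem_of_disjoint_frontier hCp h.isOpen
      (hUJ ▸ hCd.mono_right subset_union_right) hwC hwU hx
    have h3 : f c ∈ ball ζ r := by
      refine IsPreconnected.mem_of_disjoint_frontier (hCp.image f (h.continuousOn.mono hCU))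
        isOpen_ball ?_ (mem_image_of_mem f hwC) (by rwa [h.leftInv hw]) (mem_image_of_mem f hcC)
      rw [frontier_ball ζ hr0.ne', Set.disjoint_left]
      rintro _ ⟨x, hx, rfl⟩ hxs
      refine Set.disjoint_left.1 hCd hx (Or.inl (Or.inl (subset_closure ⟨f x, ⟨hxs,
        h.mapsTo (hCU hx)⟩, h.rightInv (hCU hx)⟩)))
    rw [hc, h.leftInv h0, mem_ball, dist_zero_left, hζ1] at h3
    linarith
  refine ⟨r, hr0, fun w₁ h₁ w₂ h₂ => ?_⟩
  linarith [dist_triangle_right (g w₁) (g w₂) y₀, main w₁ h₁, main w₂ h₂]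

/-- The continuous extension of a Riemann map to the closed disc. -/
theorem exists_extension (h : DiscMap U f g) (hJ : IsJordan p q J) (hUJ : frontier U = J) :
    ∃ G : ℂ → ℂ, ContinuousOn G (closedBall 0 1) ∧ EqOn G g (ball 0 1) ∧
      MapsTo G (sphere 0 1) J := by
  have hcl : closure (ball (0 : ℂ) 1) = closedBall 0 1 := closure_ball 0 one_ne_zero
  have hlim : ∀ ζ ∈ closedBall (0 : ℂ) 1, ∃ y, Tendsto g (𝓝[ball 0 1] ζ) (𝓝 y) := by
    intro ζ hζ
    rcases (mem_closedBall_zero_iff.1 hζ).lt_or_eq with h1 | h1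
    · exact ⟨g ζ, h.diff.continuousOn ζ (mem_ball_zero_iff.2 h1)⟩
    have : (𝓝[ball 0 1] ζ).NeBot := mem_closure_iff_nhdsWithin_neBot.1 (hcl ▸ hζ)
    have hcau : Cauchy (map g (𝓝[ball 0 1] ζ)) := by
      rw [Metric.cauchy_iff]
      refine ⟨inferInstance, fun ε hε => ?_⟩
      obtain ⟨r, hr, hd⟩ := h.exists_dist_le hJ hUJ (mem_sphere_zero_iff_norm.2 h1) (half_pos hε)
      refine ⟨g '' (ball ζ r ∩ ball 0 1), image_mem_map (inter_mem
        (mem_nhdsWithin_of_mem_nhds (ball_mem_nhds ζ hr)) self_mem_nhdsWithin), ?_⟩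
      rintro _ ⟨x, hx, rfl⟩ _ ⟨y, hy, rfl⟩
      linarith [hd x hx y hy]
    exact CompleteSpace.complete hcau
  have hc : ContinuousOn (extendFrom (ball 0 1) g) (closedBall 0 1) :=
    continuousOn_extendFrom hcl.ge hlim
  have heq : EqOn (extendFrom (ball 0 1) g) g (ball 0 1) := fun x hx =>
    extendFrom_eq (subset_closure hx) (h.diff.continuousOn x hx)
  refine ⟨_, hc, heq, fun ζ hζ => ?_⟩
  have hζc := sphere_subset_closedBall hζ
  have ht : Tendsto g (𝓝[ball 0 1] ζ) (𝓝 (extendFrom (ball 0 1) g ζ)) :=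
    tendsto_extendFrom (hlim ζ hζc)
  have : (𝓝[ball 0 1] ζ).NeBot := mem_closure_iff_nhdsWithin_neBot.1 (hcl ▸ hζc)
  have hev : ∀ᶠ x in 𝓝[ball 0 1] ζ, x ∈ ball (0 : ℂ) 1 := self_mem_nhdsWithin
  rw [← hUJ, h.isOpen.frontier_eq]
  refine ⟨mem_closure_of_tendsto ht (hev.mono fun x hx => h.mapsTo_inv hx), fun hU => ?_⟩
  have h1 : Tendsto (fun x => f (g x)) (𝓝[ball 0 1] ζ) (𝓝 (f (extendFrom (ball 0 1) g ζ))) :=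
    (h.continuousOn.continuousAt (h.isOpen.mem_nhds hU)).tendsto.comp ht
  have h2 : Tendsto (fun x => f (g x)) (𝓝[ball 0 1] ζ) (𝓝 ζ) :=
    (tendsto_nhdsWithin_of_tendsto_nhds tendsto_id).congr'
      (hev.mono fun x hx => (h.leftInv hx).symm)
  have h3 := h.mapsTo hU
  rw [tendsto_nhds_unique h1 h2, mem_ball_zero_iff, mem_sphere_zero_iff_norm.1 hζ] at h3
  exact lt_irrefl _ h3

end DiscMap

/-- A function holomorphic in the disc that takes a constant value on a boundary arc also takes
it at the centre. -/
theorem eq_of_eqOn_arc {G : ℂ → ℂ} (hd : DifferentiableOn ℂ G (ball 0 1))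
    (hc : ContinuousOn G (closedBall 0 1)) {W : Set ℂ} (hW : IsOpen W) {c p : ℂ}
    (hcS : c ∈ sphere (0 : ℂ) 1) (hcW : c ∈ W) (h : ∀ ξ ∈ sphere (0 : ℂ) 1, ξ ∈ W → G ξ = p) :
    G 0 = p := by
  have hne : ∀ ξ ∈ sphere (0 : ℂ) 1, ξ ≠ 0 := fun ξ hξ => ne_of_mem_sphere hξ one_ne_zero
  obtain ⟨t, htS, ht⟩ := (isCompact_sphere (0 : ℂ) 1).elim_nhds_subcover
    (fun ξ => {η | c / ξ * η ∈ W}) fun ξ hξ => by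
      have hcont : ContinuousAt (fun η : ℂ => c / ξ * η) ξ := by fun_prop
      refine hcont.preimage_mem_nhds (hW.mem_nhds ?_)
      rwa [div_mul_cancel₀ _ (hne ξ hξ)]
  have hnorm : ∀ ξ ∈ t, ∀ η : ℂ, ‖c / ξ * η‖ = ‖η‖ := fun ξ hξ η => by
    rw [norm_mul, norm_div, mem_sphere_zero_iff_norm.1 hcS, mem_sphere_zero_iff_norm.1 (htS ξ hξ),
      div_one, one_mul]
  set P : ℂ → ℂ := fun η => ∏ ξ ∈ t, (G (c / ξ * η) - p) with hP
  have hPd : DiffContOnCl ℂ P (ball 0 1) := by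
    refine ⟨DifferentiableOn.fun_finsetProd fun ξ hξ => ?_, ?_⟩
    · refine (hd.comp (by fun_prop) fun η hη => ?_).sub_const p
      rw [mem_ball_zero_iff, hnorm ξ hξ]
      exact mem_ball_zero_iff.1 hη
    · rw [closure_ball 0 one_ne_zero]
      refine continuousOn_finsetProd t fun ξ hξ => ?_
      refine (hc.comp (by fun_prop) fun η hη => ?_).sub continuousOn_const
      rw [mem_closedBall_zero_iff, hnorm ξ hξ]
      exact mem_closedBall_zero_iff.1 hη
  have hP0 : ‖P 0‖ ≤ 0 := by
    refine Complex.norm_le_of_forall_mem_frontier_norm_le isBounded_ball hPd (fun η hη => ?_)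
      (subset_closure (mem_ball_self one_pos))
    rw [frontier_ball 0 one_ne_zero] at hη
    obtain ⟨ξ, hξ, hηW⟩ := mem_iUnion₂.1 (ht hη)
    rw [norm_le_zero_iff]
    refine Finset.prod_eq_zero hξ (sub_eq_zero.2 (h _ ?_ hηW))
    rw [mem_sphere_zero_iff_norm, hnorm ξ hξ]
    exact mem_sphere_zero_iff_norm.1 hη
  obtain ⟨ξ, hξ, h0⟩ := Finset.prod_eq_zero_iff.1 (norm_le_zero_iff.1 hP0)
  rw [mul_zero] at h0
  exact sub_eq_zero.1 h0

theorem IsJordan.isPreconnected_diff_singleton {p q : ℂ → ℂ} {J : Set ℂ} (hJ : IsJordan p q J)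
    {y : ℂ} (hy : y ∈ J) : IsPreconnected (J \ {y}) := by
  set c := q y with hc
  have hcS : c ∈ sphere (0 : ℂ) 1 := hJ.mapsTo_inv hy
  have hc1 : ‖c‖ = 1 := mem_sphere_zero_iff_norm.1 hcS
  have hc0 : c ≠ 0 := ne_of_mem_sphere hcS one_ne_zero
  set e : ℝ → ℂ := fun θ => -c * exp (θ * I) with he
  have heS : ∀ θ, e θ ∈ sphere (0 : ℂ) 1 := fun θ => by
    rw [mem_sphere_zero_iff_norm, he]
    simp [hc1]
  have hpe : Continuous fun θ => p (e θ) :=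
    hJ.continuousOn.comp_continuous (by fun_prop) heS
  have himg : J \ {y} = (fun θ => p (e θ)) '' Ioo (-Real.pi) Real.pi := by
    apply Subset.antisymm
    · rintro x ⟨hx, hxy⟩
      have hxS := hJ.mapsTo_inv hx
      have h1 := norm_mul_exp_arg_mul_I (q x / -c)
      rw [norm_div, norm_neg, hc1, mem_sphere_zero_iff_norm.1 hxS, div_one, ofReal_one,
        one_mul] at h1
      have h2 : e (arg (q x / -c)) = q x := by
        rw [he]
        simp only [h1]
        field_simp
      refine ⟨arg (q x / -c), ⟨neg_pi_lt_arg _, lt_of_le_of_ne (arg_le_pi _) fun h3 => ?_⟩, ?_⟩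
      · rw [h3, he] at h2
        simp only [exp_pi_mul_I, mul_neg, mul_one, neg_neg] at h2
        exact hxy (hJ.rightInv.injOn hx hy h2.symm)
      · simp only [h2]
        exact hJ.rightInv hx
    · rintro _ ⟨θ, hθ, rfl⟩
      refine ⟨hJ.mapsTo (heS θ), fun h1 => ?_⟩
      have h2 : e θ = c := by
        rw [hc, ← mem_singleton_iff.1 h1, hJ.leftInv (heS θ)]
      have h3 : exp (θ * I) = -1 := by
        have h4 : c * (exp (θ * I) + 1) = 0 := by
          rw [he] at h2
          linear_combination -h2
        exact eq_neg_of_add_eq_zero_left ((mul_eq_zero.1 h4).resolve_left hc0)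
      have h5 := congrArg arg h3
      rw [arg_exp_mul_I, (toIocMod_eq_self _).2 ⟨hθ.1, by linarith [hθ.2]⟩, arg_neg_one] at h5
      exact hθ.2.ne h5
  rw [himg]
  exact isPreconnected_Ioo.image _ hpe.continuousOn

/-- Two radii separate the disc. -/
theorem not_isPreconnected_of_radii {ζ₁ ζ₂ ξ₁ ξ₂ : ℂ} (h₁ : ζ₁ ∈ sphere (0 : ℂ) 1)
    (h₂ : ζ₂ ∈ sphere (0 : ℂ) 1) (hξ₁ : arg (-ξ₁ / ζ₁) < arg (-ζ₂ / ζ₁))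
    (hξ₂ : arg (-ζ₂ / ζ₁) < arg (-ξ₂ / ζ₁)) {E : Set ℂ} (hE : IsPreconnected E)
    (hED : E ⊆ ball 0 1) (hE₁ : ∀ t ∈ Icc (0 : ℝ) 1, (t : ℂ) * ζ₁ ∉ E)
    (hE₂ : ∀ t ∈ Icc (0 : ℝ) 1, (t : ℂ) * ζ₂ ∉ E) (hm₁ : ξ₁ ∈ E) (hm₂ : ξ₂ ∈ E) : False := by
  have hn₁ := mem_sphere_zero_iff_norm.1 h₁
  have hn₂ := mem_sphere_zero_iff_norm.1 h₂
  have hζ0 : ζ₁ ≠ 0 := ne_of_mem_sphere h₁ one_ne_zero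
  have hslit : ∀ z ∈ E, -z / ζ₁ ∈ slitPlane := by
    intro z hz
    by_contra hs
    rw [mem_slitPlane_iff, not_or, not_lt, not_not] at hs
    have hre : -z / ζ₁ = ((-z / ζ₁).re : ℂ) := by
      apply Complex.ext <;> simp [hs.2]
    have hz' : ((-(-z / ζ₁).re : ℝ) : ℂ) * ζ₁ = z := by
      rw [ofReal_neg, ← hre]
      field_simp
    refine hE₁ _ ⟨neg_nonneg.2 hs.1, ?_⟩ (hz'.symm ▸ hz)
    have := mem_ball_zero_iff.1 (hED hz)
    rw [← hz', norm_mul, hn₁, mul_one, norm_real, Real.norm_of_nonneg (neg_nonneg.2 hs.1)] at this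
    exact this.le
  have hcont : ContinuousOn (fun z => arg (-z / ζ₁)) E := fun z hz =>
    ((continuousAt_arg (hslit z hz)).comp (f := fun z => -z / ζ₁)
      (by fun_prop)).continuousWithinAt
  obtain ⟨z, hz, hzeq⟩ := (hE.image _ hcont).ordConnected.out (mem_image_of_mem _ hm₁)
    (mem_image_of_mem _ hm₂) ⟨hξ₁.le, hξ₂.le⟩
  have h3 := norm_mul_exp_arg_mul_I (-z / ζ₁)
  have h4 := norm_mul_exp_arg_mul_I (-ζ₂ / ζ₁)
  rw [norm_div, norm_neg, hn₁, div_one] at h3 h4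
  rw [hn₂, ofReal_one, one_mul] at h4
  dsimp only at hzeq
  rw [hzeq, h4] at h3
  refine hE₂ ‖z‖ ⟨norm_nonneg _, (mem_ball_zero_iff.1 (hED hz)).le⟩ ?_
  have h5 : (‖z‖ : ℂ) * ζ₂ = z := by
    field_simp at h3
    linear_combination -h3
  rwa [h5]

namespace DiscMap

variable {U J : Set ℂ} {f g p q : ℂ → ℂ} {G : ℂ → ℂ}

theorem exists_joined_radius {L : Set ℂ} (hL : IsClosed L)
    (hG : ContinuousOn G (closedBall 0 1)) {ξ : ℂ} (hξ : ξ ∈ sphere (0 : ℂ) 1) (hξL : G ξ ∉ L) :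
    ∀ᶠ t : ℝ in 𝓝[<] 1, Joined L (G (t * ξ)) (G ξ) := by
  obtain ⟨s, hs, hsL⟩ := Metric.isOpen_iff.1 hL.isOpen_compl (G ξ) hξL
  have hξ1 := mem_sphere_zero_iff_norm.1 hξ
  have h1 : Tendsto (fun t : ℝ => (t : ℂ) * ξ) (𝓝[<] 1) (𝓝[closedBall 0 1] ξ) := by
    refine tendsto_nhdsWithin_iff.2 ⟨?_, ?_⟩
    · have : Continuous fun t : ℝ => (t : ℂ) * ξ := by fun_prop
      have := this.tendsto 1
      rw [ofReal_one, one_mul] at this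
      exact tendsto_nhdsWithin_of_tendsto_nhds this
    · filter_upwards [Ioo_mem_nhdsLT one_pos] with t ht
      rw [mem_closedBall_zero_iff, norm_mul, hξ1, mul_one, norm_real, Real.norm_of_nonneg ht.1.le]
      exact ht.2.le
  have h2 := (hG ξ (sphere_subset_closedBall hξ)).tendsto.comp h1
  filter_upwards [h2 (ball_mem_nhds _ hs)] with t ht
  exact ⟨ball (G ξ) s, (convex_ball _ _).isPreconnected,
    Set.disjoint_left.2 fun x hx => hsL hx, ht, mem_ball_self hs⟩

theorem injOn_sphere (h : DiscMap U f g) (hJ : IsJordan p q J) (hUJ : frontier U = J)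
    (hG : ContinuousOn G (closedBall 0 1)) (hGg : EqOn G g (ball 0 1))
    (hGJ : MapsTo G (sphere 0 1) J) : InjOn G (sphere 0 1) := by
  intro ζ₁ hζ₁ ζ₂ hζ₂ hG12
  by_contra hne
  have hUJd : Disjoint U J := hUJ ▸ Set.disjoint_iff_inter_eq_empty.2 h.isOpen.inter_frontier_eq
  have hGU : ∀ z ∈ ball (0 : ℂ) 1, G z ∈ U := fun z hz => hGg hz ▸ h.mapsTo_inv hz
  have hn₁ := mem_sphere_zero_iff_norm.1 hζ₁
  have hn₂ := mem_sphere_zero_iff_norm.1 hζ₂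
  have hζ0 : ζ₁ ≠ 0 := ne_of_mem_sphere hζ₁ one_ne_zero
  set y := G ζ₁ with hy
  have hyJ : y ∈ J := hGJ hζ₁
  have hd : DifferentiableOn ℂ G (ball 0 1) := h.diff.congr hGg
  have hG0 : G 0 ≠ y := fun h0 => Set.disjoint_left.1 hUJd (hGU 0 (mem_ball_self one_pos)) (h0 ▸ hyJ)
  set β := arg (-ζ₂ / ζ₁) with hβ
  have hβπ : β < Real.pi := by
    refine lt_of_le_of_ne (arg_le_pi _) fun h1 => hne ?_
    have h4 := norm_mul_exp_arg_mul_I (-ζ₂ / ζ₁)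
    rw [← hβ, h1, norm_div, norm_neg, hn₁, hn₂, div_one, ofReal_one, one_mul, exp_pi_mul_I] at h4
    field_simp at h4
    linear_combination -h4
  have hβπ' : -Real.pi < β := neg_pi_lt_arg _
  have hopen : ∀ V : Set ℝ, IsOpen V → IsOpen {ξ : ℂ | -ξ / ζ₁ ∈ slitPlane ∧ arg (-ξ / ζ₁) ∈ V} := by
    intro V hV
    rw [isOpen_iff_mem_nhds]
    rintro ξ ⟨h1, h2⟩
    have hc : ContinuousAt (fun ξ : ℂ => -ξ / ζ₁) ξ := by fun_prop
    exact inter_mem (hc.preimage_mem_nhds (isOpen_slitPlane.mem_nhds h1))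
      (((continuousAt_arg h1).comp (f := fun ξ => -ξ / ζ₁) hc).preimage_mem_nhds (hV.mem_nhds h2))
  have harc : ∀ V : Set ℝ, IsOpen V → ∀ θ ∈ Ioo (-Real.pi) Real.pi, θ ∈ V →
      ∃ ξ ∈ sphere (0 : ℂ) 1, arg (-ξ / ζ₁) ∈ V ∧ G ξ ≠ y := by
    intro V hV θ hθ hθV
    by_contra! hcon
    have h1 : -(-ζ₁ * exp (θ * I)) / ζ₁ = exp (θ * I) := by field_simp
    have h2 : arg (exp (θ * I)) = θ := by
      rw [arg_exp_mul_I, toIocMod_eq_self]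
      exact ⟨hθ.1, by linarith [hθ.2]⟩
    refine hG0 (eq_of_eqOn_arc hd hG (hopen V hV) (c := -ζ₁ * exp (θ * I)) ?_ ?_
      fun ξ hξ hξV => hcon ξ hξ hξV.2)
    · rw [mem_sphere_zero_iff_norm, norm_mul, norm_neg, hn₁, norm_exp_ofReal_mul_I, one_mul]
    · refine ⟨?_, ?_⟩
      · rw [h1, mem_slitPlane_iff_arg, h2]
        exact ⟨hθ.2.ne, exp_ne_zero _⟩
      · rw [h1, h2]
        exact hθV
  obtain ⟨θ₁, hθ₁, hθ₁'⟩ := exists_between hβπ'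
  obtain ⟨θ₂, hθ₂, hθ₂'⟩ := exists_between hβπ
  obtain ⟨ξ₁, hξ₁, ha₁, hGξ₁⟩ := harc (Iio β) isOpen_Iio θ₁ ⟨hθ₁, hθ₁'.trans hβπ⟩ hθ₁'
  obtain ⟨ξ₂, hξ₂, ha₂, hGξ₂⟩ := harc (Ioi β) isOpen_Ioi θ₂ ⟨hβπ'.trans hθ₂, hθ₂'⟩ hθ₂
  set R : Set ℂ := (fun t : ℝ => (t : ℂ) * ζ₁) '' Icc 0 1 ∪ (fun t : ℝ => (t : ℂ) * ζ₂) '' Icc 0 1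
    with hR
  have hRc : IsCompact R :=
    (isCompact_Icc.image (by fun_prop)).union (isCompact_Icc.image (by fun_prop))
  have hRcases : ∀ z ∈ R, z ∈ ball (0 : ℂ) 1 ∨ z ∈ sphere (0 : ℂ) 1 ∧ G z = y := by
    have aux : ∀ ζ ∈ sphere (0 : ℂ) 1, G ζ = y → ∀ t ∈ Icc (0 : ℝ) 1,
        (t : ℂ) * ζ ∈ ball (0 : ℂ) 1 ∨ (t : ℂ) * ζ ∈ sphere (0 : ℂ) 1 ∧ G (t * ζ) = y := by
      intro ζ hζ hGζ t ht
      rcases ht.2.lt_or_eq with h1 | rfl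
      · left
        rwa [mem_ball_zero_iff, norm_mul, mem_sphere_zero_iff_norm.1 hζ, mul_one, norm_real,
          Real.norm_of_nonneg ht.1]
      · right
        rw [ofReal_one, one_mul]
        exact ⟨hζ, hGζ⟩
    rintro _ (⟨t, ht, rfl⟩ | ⟨t, ht, rfl⟩)
    · exact aux ζ₁ hζ₁ rfl t ht
    · exact aux ζ₂ hζ₂ hG12.symm t ht
  have hRD : R ⊆ closedBall 0 1 := fun z hz => (hRcases z hz).elim (fun h => ball_subset_closedBall h)
    fun h => sphere_subset_closedBall h.1
  set L := G '' R with hL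
  have hLc : IsCompact L := hRc.image_of_continuousOn (hG.mono hRD)
  have hLJ : ∀ x ∈ L, x ∈ J → x = y := by
    rintro _ ⟨z, hz, rfl⟩ hzJ
    rcases hRcases z hz with h1 | h1
    · exact absurd hzJ (Set.disjoint_left.1 hUJd (hGU z h1))
    · exact h1.2
  have hnotL : ∀ ξ ∈ sphere (0 : ℂ) 1, G ξ ≠ y → G ξ ∉ L := fun ξ hξ hGξ hmem =>
    hGξ (hLJ _ hmem (hGJ hξ))
  obtain ⟨t, ⟨hj₁, hj₂⟩, ht⟩ := (((exists_joined_radius hLc.isClosed hG hξ₁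
    (hnotL ξ₁ hξ₁ hGξ₁)).and (exists_joined_radius hLc.isClosed hG hξ₂
    (hnotL ξ₂ hξ₂ hGξ₂))).and (Ioo_mem_nhdsLT one_pos)).exists
  have hjL : Joined L (G (t * ξ₁)) (G (t * ξ₂)) := by
    refine hj₁.trans (Joined.trans ⟨J \ {y}, hJ.isPreconnected_diff_singleton hyJ, ?_,
      ⟨hGJ hξ₁, hGξ₁⟩, ⟨hGJ hξ₂, hGξ₂⟩⟩ hj₂.symm)
    exact Set.disjoint_left.2 fun x hx hxL => hx.2 (hLJ x hxL hx.1)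
  have htb : ∀ ξ ∈ sphere (0 : ℂ) 1, (t : ℂ) * ξ ∈ ball (0 : ℂ) 1 := fun ξ hξ => by
    rw [mem_ball_zero_iff, norm_mul, mem_sphere_zero_iff_norm.1 hξ, mul_one, norm_real,
      Real.norm_of_nonneg ht.1.le]
    exact ht.2
  have hjJ : Joined J (G (t * ξ₁)) (G (t * ξ₂)) :=
    ⟨U, h.isPreconnected, hUJd, hGU _ (htb ξ₁ hξ₁), hGU _ (htb ξ₂ hξ₂)⟩
  have hsub : (L ∩ J).Subsingleton := fun a ha b hb => by
    rw [hLJ a ha.1 ha.2, hLJ b hb.1 hb.2]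
  obtain ⟨C, hCp, hCd, hC₁, hC₂⟩ := Joined.union hLc hJ.isCompact hsub.isPreconnected hjL hjJ
  have hCU : C ⊆ U := fun x hx => IsPreconnected.mem_of_disjoint_frontier hCp h.isOpen
    (hUJ ▸ hCd.mono_right subset_union_right) hC₁ (hGU _ (htb ξ₁ hξ₁)) hx
  have hfG : ∀ z ∈ ball (0 : ℂ) 1, f (G z) = z := fun z hz => by rw [hGg hz, h.leftInv hz]
  have hRE : ∀ z ∈ R, z ∉ f '' C := by
    rintro _ hz ⟨x, hx, rfl⟩
    refine Set.disjoint_left.1 hCd hx (Or.inl ⟨f x, hz, ?_⟩)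
    rw [hGg (h.mapsTo (hCU hx)), h.rightInv (hCU hx)]
  have harg : ∀ ξ : ℂ, arg (-((t : ℂ) * ξ) / ζ₁) = arg (-ξ / ζ₁) := fun ξ => by
    rw [← mul_neg, mul_div_assoc, arg_real_mul _ ht.1]
  refine not_isPreconnected_of_radii (ξ₁ := t * ξ₁) (ξ₂ := t * ξ₂) hζ₁ hζ₂ ?_ ?_
    (hCp.image f (h.continuousOn.mono hCU)) ?_ (fun s hs => hRE _ (Or.inl ⟨s, hs, rfl⟩))
    (fun s hs => hRE _ (Or.inr ⟨s, hs, rfl⟩)) ⟨_, hC₁, hfG _ (htb ξ₁ hξ₁)⟩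
    ⟨_, hC₂, hfG _ (htb ξ₂ hξ₂)⟩
  · rw [harg]
    exact ha₁
  · rw [harg]
    exact ha₂
  · rintro _ ⟨x, hx, rfl⟩
    exact h.mapsTo (hCU hx)

end DiscMap

/-- Carathéodory's theorem: the Riemann map of a Jordan domain extends to a homeomorphism of the
closed disc onto the closure of the domain. -/
theorem IsJordan.exists_caratheodory {p q : ℂ → ℂ} {J U : Set ℂ} (hJ : IsJordan p q J)
    (hU : IsOpen U) (hUc : IsConnected U) (hUb : Bornology.IsBounded U)
    (hUcompl : IsPreconnected Uᶜ) (hUJ : frontier U = J) {z₀ : ℂ} (hz₀ : z₀ ∈ U) :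
    ∃ G : ℂ → ℂ, ContinuousOn G (closedBall 0 1) ∧ InjOn G (closedBall 0 1) ∧
      G '' closedBall 0 1 = U ∪ J ∧ G '' sphere 0 1 = J ∧ G 0 = z₀ := by
  obtain ⟨f, hf, hfs⟩ := exists_univalent_surjective hU hUc.isPreconnected hUb hz₀
    fun h hc h0 => hasLog_of_domain hU hUc hUcompl hUb hc h0
  obtain ⟨g, hg, hgU, hfg, hgf, hg0⟩ := exists_conformal_inverse hU hz₀ hf hfs
  have h : DiscMap U f g :=
    ⟨hU, hUc.isPreconnected, hUb, hf.diff.continuousOn, hg, hf.mapsTo, hgU, hfg, hgf⟩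
  obtain ⟨G, hG, hGg, hGJ⟩ := h.exists_extension hJ hUJ
  have hUJd : Disjoint U J := hUJ ▸ Set.disjoint_iff_inter_eq_empty.2 hU.inter_frontier_eq
  have hGU : ∀ z ∈ ball (0 : ℂ) 1, G z ∈ U := fun z hz => hGg hz ▸ hgU hz
  have hcases : ∀ z ∈ closedBall (0 : ℂ) 1, z ∈ ball (0 : ℂ) 1 ∨ z ∈ sphere (0 : ℂ) 1 :=
    fun z hz => by rwa [← mem_union, ball_union_sphere]
  have himg : G '' closedBall 0 1 = U ∪ J := by
    apply Subset.antisymm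
    · rintro _ ⟨z, hz, rfl⟩
      rcases hcases z hz with h1 | h1
      · exact Or.inl (hGU z h1)
      · exact Or.inr (hGJ h1)
    · have h1 : U ⊆ G '' closedBall 0 1 := fun x hx => ⟨f x,
        ball_subset_closedBall (hf.mapsTo hx), by rw [hGg (hf.mapsTo hx), hgf hx]⟩
      rw [← hUJ, ← closure_eq_self_union_frontier]
      exact closure_minimal h1 ((isCompact_closedBall 0 1).image_of_continuousOn hG).isClosed
  refine ⟨G, hG, ?_, himg, ?_, by rw [hGg (mem_ball_self one_pos), hg0]⟩
  · intro x hx y hy hxy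
    rcases hcases x hx with h1 | h1 <;> rcases hcases y hy with h2 | h2
    · rw [hGg h1, hGg h2] at hxy
      exact hfg.injOn h1 h2 hxy
    · exact absurd (hGJ h2) (Set.disjoint_left.1 hUJd (hxy ▸ hGU x h1))
    · exact absurd (hGJ h1) (Set.disjoint_left.1 hUJd (hxy ▸ hGU y h2))
    · exact h.injOn_sphere hJ hUJ hG hGg hGJ h1 h2 hxy
  · refine hGJ.image_subset.antisymm fun x hx => ?_
    obtain ⟨z, hz, rfl⟩ : x ∈ G '' closedBall 0 1 := himg ▸ Or.inr hx
    rcases hcases z hz with h1 | h1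
    · exact absurd hx (Set.disjoint_left.1 hUJd (hGU z h1))
    · exact ⟨z, h1, rfl⟩

/-! ### Gluing the interior and the exterior -/

/-- Two discs, one of them seen through the inversion `z ↦ z⁻¹`, glued along their common boundary
form a plane. -/
theorem exists_homeomorph_of_glue {G₁ G₂ : ℂ → ℂ}
    (hc₁ : ContinuousOn G₁ (closedBall 0 1)) (hc₂ : ContinuousOn G₂ (closedBall 0 1))
    (hi₁ : InjOn G₁ (closedBall 0 1)) (hi₂ : InjOn G₂ (closedBall 0 1))
    (h0 : ∀ u ∈ sphere (0 : ℂ) 1, G₁ u ≠ 0) (hG₁ : G₁ 0 = 0) (hG₂ : G₂ 0 = 0)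
    (hsph : G₂ '' sphere 0 1 = (fun u => (G₁ u)⁻¹) '' sphere 0 1)
    (hsep : ∀ x ∈ closedBall (0 : ℂ) 1, ∀ y ∈ ball (0 : ℂ) 1, G₁ x ≠ (G₂ y)⁻¹ ∨ y = 0)
    (hcov : ∀ z, z ∈ G₁ '' closedBall 0 1 ∨ z⁻¹ ∈ G₂ '' ball 0 1) :
    ∃ Φ : ℂ ≃ₜ ℂ, Φ '' sphere 0 1 = G₁ '' sphere 0 1 := by
  have hsub : sphere (0 : ℂ) 1 ⊆ closedBall 0 1 := sphere_subset_closedBall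
  have hJ := IsJordan.of_injOn (hc₂.mono hsub) (hi₂.mono hsub)
  set h := Function.invFunOn G₂ (sphere 0 1) with hh
  set k : ℂ → ℂ := fun u => h (G₁ u)⁻¹ with hk
  have hmaps : MapsTo (fun u => (G₁ u)⁻¹) (sphere 0 1) (G₂ '' sphere 0 1) :=
    hsph ▸ mapsTo_image _ _
  have hkS : ∀ u ∈ sphere (0 : ℂ) 1, k u ∈ sphere (0 : ℂ) 1 := fun u hu => hJ.mapsTo_inv (hmaps hu)
  have hkG : ∀ u ∈ sphere (0 : ℂ) 1, G₂ (k u) = (G₁ u)⁻¹ := fun u hu => hJ.rightInv (hmaps hu)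
  have hkc : ContinuousOn k (sphere 0 1) :=
    hJ.continuousOn_inv.comp ((hc₁.mono hsub).inv₀ h0) hmaps
  have hki : InjOn k (sphere 0 1) := fun u hu v hv huv => hi₁ (hsub hu) (hsub hv)
    (inv_injective (by rw [← hkG u hu, ← hkG v hv, huv]))
  have hks : ∀ v ∈ sphere (0 : ℂ) 1, ∃ u ∈ sphere (0 : ℂ) 1, k u = v := by
    intro v hv
    obtain ⟨u, hu, huv⟩ : G₂ v ∈ (fun u => (G₁ u)⁻¹) '' sphere 0 1 := hsph ▸ mem_image_of_mem _ hv
    exact ⟨u, hu, hi₂ (hsub (hkS u hu)) (hsub hv) ((hkG u hu).trans huv)⟩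
  have hnorm : ∀ w : ℂ, w ≠ 0 → ‖w‖⁻¹ • w ∈ sphere (0 : ℂ) 1 := fun w hw => by
    rw [mem_sphere_zero_iff_norm, norm_smul, norm_inv, norm_norm,
      inv_mul_cancel₀ (norm_ne_zero_iff.2 hw)]
  set a : ℂ → ℂ := fun w => ‖w‖⁻¹ • k (‖w‖⁻¹ • w) with ha
  have han : ∀ w : ℂ, w ≠ 0 → ‖a w‖ = ‖w‖⁻¹ := fun w hw => by
    rw [ha, norm_smul, mem_sphere_zero_iff_norm.1 (hkS _ (hnorm w hw)), norm_inv, norm_norm,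
      mul_one]
  have ha0 : ∀ w : ℂ, w ≠ 0 → a w ≠ 0 := fun w hw => norm_ne_zero_iff.1 (by
    rw [han w hw]; exact inv_ne_zero (norm_ne_zero_iff.2 hw))
  have hai : ∀ v w : ℂ, v ≠ 0 → w ≠ 0 → a v = a w → v = w := by
    intro v w hv hw hvw
    have h1 : ‖v‖ = ‖w‖ := inv_injective (by rw [← han v hv, ← han w hw, hvw])
    have h2 : ‖w‖⁻¹ ≠ 0 := inv_ne_zero (norm_ne_zero_iff.2 hw)
    simp only [ha, h1] at hvw
    have h3 := hki (h1 ▸ hnorm v hv) (hnorm w hw) (smul_right_injective _ h2 hvw)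
    exact smul_right_injective _ h2 h3
  have has : ∀ y : ℂ, y ≠ 0 → ∃ w : ℂ, w ≠ 0 ∧ a w = y := by
    intro y hy
    have hy' : ‖y‖ ≠ 0 := norm_ne_zero_iff.2 hy
    obtain ⟨u, hu, huy⟩ := hks _ (hnorm y hy)
    rw [mem_sphere_zero_iff_norm] at hu
    have hn : ‖‖y‖⁻¹ • u‖ = ‖y‖⁻¹ := by rw [norm_smul, hu, norm_inv, norm_norm, mul_one]
    refine ⟨‖y‖⁻¹ • u, norm_ne_zero_iff.1 (by rw [hn]; exact inv_ne_zero hy'), ?_⟩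
    simp only [ha, hn, inv_inv]
    rw [smul_smul, mul_inv_cancel₀ hy', one_smul, huy, smul_smul, mul_inv_cancel₀ hy', one_smul]
  have hac : ContinuousOn a {0}ᶜ := by
    have h1 : ContinuousOn (fun w : ℂ => ‖w‖⁻¹) {0}ᶜ :=
      continuous_norm.continuousOn.inv₀ fun w hw => norm_ne_zero_iff.2 hw
    exact h1.smul (hkc.comp (h1.smul continuousOn_id) fun w hw => hnorm w hw)
  have hGa0 : ∀ w : ℂ, 1 ≤ ‖w‖ → w ≠ 0 ∧ a w ∈ closedBall (0 : ℂ) 1 ∧ G₂ (a w) ≠ 0 := by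
    intro w hw
    have hw0 : w ≠ 0 := norm_pos_iff.1 (one_pos.trans_le hw)
    have h1 : a w ∈ closedBall (0 : ℂ) 1 := by
      rw [mem_closedBall_zero_iff, han w hw0]; exact inv_le_one_of_one_le₀ hw
    refine ⟨hw0, h1, fun h2 => ha0 w hw0 ?_⟩
    exact hi₂ h1 (mem_closedBall_self zero_le_one) (h2.trans hG₂.symm)
  set Φ : ℂ → ℂ := fun w => if ‖w‖ ≤ 1 then G₁ w else (G₂ (a w))⁻¹ with hΦ
  have hΦ₁ : ∀ w : ℂ, ‖w‖ ≤ 1 → Φ w = G₁ w := fun w hw => if_pos hw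
  have hΦ₂ : ∀ w : ℂ, 1 ≤ ‖w‖ → Φ w = (G₂ (a w))⁻¹ := by
    intro w hw
    rcases hw.eq_or_lt with h1 | h1
    · rw [hΦ₁ w h1.ge]
      simp only [ha, ← h1, inv_one, one_smul]
      rw [hkG w (mem_sphere_zero_iff_norm.2 h1.symm), inv_inv]
    · exact if_neg h1.not_ge
  have hcont : Continuous Φ := by
    have h1 : ContinuousOn Φ (closedBall 0 1) :=
      hc₁.congr fun w hw => hΦ₁ w (mem_closedBall_zero_iff.1 hw)
    have h2 : ContinuousOn Φ {w : ℂ | 1 ≤ ‖w‖} := by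
      refine ContinuousOn.congr (ContinuousOn.inv₀ (hc₂.comp (hac.mono fun w hw => (hGa0 w hw).1)
        fun w hw => (hGa0 w hw).2.1) fun w hw => (hGa0 w hw).2.2) fun w hw => hΦ₂ w hw
    have h3 := h1.union_of_isClosed h2 isClosed_closedBall
      (isClosed_le continuous_const continuous_norm)
    rw [← continuousOn_univ]
    refine h3.mono fun w _ => ?_
    rcases le_total ‖w‖ 1 with h4 | h4
    · exact Or.inl (mem_closedBall_zero_iff.2 h4)
    · exact Or.inr h4
  have hout : ∀ w : ℂ, 1 < ‖w‖ → a w ∈ ball (0 : ℂ) 1 := fun w hw => by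
    rw [mem_ball_zero_iff, han w (hGa0 w hw.le).1]
    exact inv_lt_one_of_one_lt₀ hw
  have hne : ∀ v w : ℂ, ‖v‖ ≤ 1 → 1 < ‖w‖ → Φ v ≠ Φ w := by
    intro v w hv hw
    rw [hΦ₁ v hv, hΦ₂ w hw.le]
    exact (hsep v (mem_closedBall_zero_iff.2 hv) _ (hout w hw)).resolve_right
      (ha0 w (hGa0 w hw.le).1)
  have hinj : Function.Injective Φ := by
    intro v w hvw
    rcases le_or_gt ‖v‖ 1 with hv | hv <;> rcases le_or_gt ‖w‖ 1 with hw | hw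
    · rw [hΦ₁ v hv, hΦ₁ w hw] at hvw
      exact hi₁ (mem_closedBall_zero_iff.2 hv) (mem_closedBall_zero_iff.2 hw) hvw
    · exact absurd hvw (hne v w hv hw)
    · exact absurd hvw.symm (hne w v hw hv)
    · rw [hΦ₂ v hv.le, hΦ₂ w hw.le] at hvw
      exact hai v w (hGa0 v hv.le).1 (hGa0 w hw.le).1
        (hi₂ (hGa0 v hv.le).2.1 (hGa0 w hw.le).2.1 (inv_injective hvw))
  have hsurj : Function.Surjective Φ := by
    intro z
    rcases hcov z with ⟨w, hw, rfl⟩ | ⟨y, hy, hyz⟩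
    · exact ⟨w, hΦ₁ w (mem_closedBall_zero_iff.1 hw)⟩
    · by_cases hy0 : y = 0
      · exact ⟨0, by rw [hΦ₁ 0 (by simp), hG₁, ← inv_inv z, ← hyz, hy0, hG₂, inv_zero]⟩
      · obtain ⟨w, hw, rfl⟩ := has y hy0
        rw [mem_ball_zero_iff, han w hw, inv_lt_one₀ (norm_pos_iff.2 hw)] at hy
        exact ⟨w, by rw [hΦ₂ w hy.le, hyz, inv_inv]⟩
  have hprop : Tendsto Φ (cocompact ℂ) (cocompact ℂ) := by
    rw [← Metric.cobounded_eq_cocompact]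
    have hlarge : ∀ᶠ w : ℂ in Bornology.cobounded ℂ, 1 ≤ ‖w‖ :=
      tendsto_norm_cobounded_atTop.eventually_ge_atTop 1
    have ha : Tendsto a (Bornology.cobounded ℂ) (𝓝[closedBall 0 1] 0) := by
      refine tendsto_nhdsWithin_iff.2 ⟨tendsto_zero_iff_norm_tendsto_zero.2 ?_,
        hlarge.mono fun w hw => (hGa0 w hw).2.1⟩
      exact (tendsto_inv_atTop_zero.comp tendsto_norm_cobounded_atTop).congr'
        (hlarge.mono fun w hw => (han w (hGa0 w hw).1).symm)
    have h1 : Tendsto (fun w => G₂ (a w)) (Bornology.cobounded ℂ) (𝓝[≠] 0) := by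
      refine tendsto_nhdsWithin_iff.2 ⟨?_, hlarge.mono fun w hw => (hGa0 w hw).2.2⟩
      have h2 := (hc₂ 0 (mem_closedBall_self zero_le_one)).tendsto.comp ha
      rwa [hG₂] at h2
    exact (tendsto_inv₀_nhdsNE_zero.comp h1).congr' (hlarge.mono fun w hw => (hΦ₂ w hw).symm)
  have hclosed : IsClosedMap Φ := (isProperMap_iff_tendsto_cocompact.2 ⟨hcont, hprop⟩).isClosedMap
  refine ⟨(Equiv.ofBijective Φ ⟨hinj, hsurj⟩).toHomeomorphOfContinuousClosed hcont hclosed, ?_⟩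
  exact image_congr fun w hw => hΦ₁ w (mem_sphere_zero_iff_norm.1 hw).le

theorem IsJordan.inv {p q : ℂ → ℂ} {J : Set ℂ} (hJ : IsJordan p q J) (h0 : (0 : ℂ) ∉ J) :
    ∃ p' q', IsJordan p' q' (Inv.inv '' J) := by
  refine ⟨fun u => (p u)⁻¹, Function.invFunOn (fun u => (p u)⁻¹) (sphere 0 1), ?_⟩
  have h1 : (Inv.inv '' J : Set ℂ) = (fun u => (p u)⁻¹) '' sphere 0 1 := by
    rw [← hJ.image_eq, image_image]
  rw [h1]
  refine IsJordan.of_injOn (hJ.continuousOn.inv₀ fun u hu h => h0 (h ▸ hJ.mapsTo hu)) ?_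
  exact fun u hu v hv huv => hJ.leftInv.injOn hu hv (inv_injective huv)

/-- The inversion of an unbounded planar domain, completed by the origin. -/
def invDomain (V : Set ℂ) : Set ℂ := insert 0 (Inv.inv '' V)

theorem mem_invDomain {V : Set ℂ} {z : ℂ} (hz : z ≠ 0) : z ∈ invDomain V ↔ z⁻¹ ∈ V := by
  simp [invDomain, hz]

section invDomain

variable {V : Set ℂ}

theorem invDomain_mem_nhds_zero (hV : Bornology.IsBounded Vᶜ) : invDomain V ∈ 𝓝 (0 : ℂ) := by
  obtain ⟨R, hR, hVR⟩ := hV.subset_closedBall_lt 0 0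
  refine mem_of_superset (ball_mem_nhds 0 (inv_pos.2 hR)) fun z hz => ?_
  rcases eq_or_ne z 0 with rfl | h0
  · exact mem_insert _ _
  rw [mem_invDomain h0]
  by_contra h
  have h1 := mem_closedBall_zero_iff.1 (hVR h)
  rw [norm_inv] at h1
  rw [mem_ball_zero_iff] at hz
  exact ((lt_inv_comm₀ (norm_pos_iff.2 h0) hR).1 hz).not_ge h1

theorem isOpen_invDomain (hVo : IsOpen V) (hV : Bornology.IsBounded Vᶜ) :
    IsOpen (invDomain V) := by
  rw [isOpen_iff_mem_nhds]
  intro z hz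
  rcases eq_or_ne z 0 with rfl | h0
  · exact invDomain_mem_nhds_zero hV
  · rw [mem_invDomain h0] at hz
    filter_upwards [(continuousAt_inv₀ h0).preimage_mem_nhds (hVo.mem_nhds hz),
      isOpen_ne.mem_nhds h0] with w hw hw0
    exact (mem_invDomain hw0).2 hw

theorem isConnected_invDomain (hVc : IsConnected V) (hV : Bornology.IsBounded Vᶜ)
    (h0 : (0 : ℂ) ∉ V) : IsConnected (invDomain V) := by
  have h1 : IsConnected (Inv.inv '' V) :=
    hVc.image _ (continuousOn_inv₀.mono fun z hz hz0 => h0 (hz0 ▸ hz))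
  refine h1.subset_closure (subset_insert _ _) (insert_subset ?_ subset_closure)
  have h2 : ∃ᶠ z in 𝓝[≠] (0 : ℂ), z ∈ Inv.inv '' V := by
    refine Eventually.frequently ?_
    filter_upwards [mem_nhdsWithin_of_mem_nhds (invDomain_mem_nhds_zero hV),
      self_mem_nhdsWithin] with z hz hz0
    exact hz.resolve_left hz0
  exact mem_closure_iff_frequently.2 (h2.filter_mono nhdsWithin_le_nhds)

theorem isBounded_invDomain (hV : Vᶜ ∈ 𝓝 (0 : ℂ)) : Bornology.IsBounded (invDomain V) := by
  obtain ⟨r, hr, hrV⟩ := Metric.mem_nhds_iff.1 hV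
  refine isBounded_closedBall (x := (0 : ℂ)) (r := r⁻¹) |>.subset ?_
  refine insert_subset (mem_closedBall_self (inv_pos.2 hr).le) ?_
  rintro _ ⟨z, hz, rfl⟩
  have h1 : r ≤ ‖z‖ := by
    by_contra! h
    exact hrV (mem_ball_zero_iff.2 h) hz
  rw [mem_closedBall_zero_iff, norm_inv]
  exact inv_anti₀ hr h1

theorem mem_closure_invDomain {z : ℂ} (hz : z ≠ 0) : z ∈ closure (invDomain V) ↔
    z⁻¹ ∈ closure V := by
  simp only [mem_closure_iff_frequently]
  constructor
  · intro h
    refine (continuousAt_inv₀ hz).tendsto.frequently ?_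
    refine (h.and_eventually (isOpen_ne.mem_nhds hz)).mono fun w hw => ?_
    exact (mem_invDomain hw.2).1 hw.1
  · intro h
    have h1 := (continuousAt_inv₀ (inv_ne_zero hz)).tendsto
    rw [inv_inv] at h1
    refine h1.frequently ?_
    refine (h.and_eventually (isOpen_ne.mem_nhds (inv_ne_zero hz))).mono fun w hw => ?_
    exact (mem_invDomain (inv_ne_zero hw.2)).2 (by rw [inv_inv]; exact hw.1)

theorem frontier_invDomain (hVo : IsOpen V) (hV : Bornology.IsBounded Vᶜ)
    (h0 : (0 : ℂ) ∉ frontier V) :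
    frontier (invDomain V) = Inv.inv '' frontier V := by
  have ho := isOpen_invDomain hVo hV
  rw [ho.frontier_eq, hVo.frontier_eq]
  rw [hVo.frontier_eq] at h0
  ext z
  rcases eq_or_ne z 0 with rfl | hz
  · simp only [Set.mem_sdiff, image_inv_eq_inv, Set.mem_inv, inv_zero]
    exact iff_of_false (fun h => h.2 (mem_insert _ _)) h0
  · simp only [Set.mem_sdiff, image_inv_eq_inv, Set.mem_inv, mem_closure_invDomain hz,
      mem_invDomain hz]

end invDomain

theorem isPreconnected_closedBall_diff_zero :
    IsPreconnected (closedBall (0 : ℂ) 1 \ {0}) := by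
  have h1 : IsPreconnected (Ioc (0 : ℝ) 1 ×ˢ sphere (0 : ℂ) 1) :=
    isPreconnected_Ioc.prod (isPreconnected_sphere (by simp) 0 1)
  convert h1.image (fun x : ℝ × ℂ => x.1 • x.2) (by fun_prop) using 1
  ext z
  simp only [Set.mem_sdiff, mem_closedBall_zero_iff, mem_singleton_iff, mem_image, mem_prod,
    mem_sphere_zero_iff_norm, mem_Ioc, Prod.exists]
  constructor
  · rintro ⟨h, h0⟩
    have h0' := norm_pos_iff.2 h0
    refine ⟨‖z‖, ‖z‖⁻¹ • z, ⟨⟨h0', h⟩, ?_⟩, ?_⟩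
    · rw [norm_smul, norm_inv, norm_norm, inv_mul_cancel₀ h0'.ne']
    · rw [smul_smul, mul_inv_cancel₀ h0'.ne', one_smul]
  · rintro ⟨t, u, ⟨⟨ht0, ht⟩, hu⟩, rfl⟩
    refine ⟨by rwa [norm_smul, hu, mul_one, Real.norm_of_nonneg ht0.le], ?_⟩
    exact smul_ne_zero ht0.ne' (norm_pos_iff.1 (hu ▸ one_pos))

/-- The Schoenflies theorem for a Jordan curve with the origin in its bounded complementary
domain. -/
theorem IsJordan.exists_homeomorph_of_zero_mem {p q : ℂ → ℂ} {J U V : Set ℂ}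
    (hJ : IsJordan p q J) (hU : IsOpen U) (hV : IsOpen V) (hUc : IsConnected U)
    (hVc : IsConnected V) (hUb : Bornology.IsBounded U) (hUV : Disjoint U V)
    (hcompl : U ∪ V = Jᶜ) (hUJ : frontier U = J) (hVJ : frontier V = J) (h0 : (0 : ℂ) ∈ U) :
    ∃ Φ : ℂ ≃ₜ ℂ, Φ '' sphere 0 1 = J := by
  have hmem : ∀ z, (z ∈ U ∨ z ∈ V) ↔ z ∉ J := fun z => by
    rw [← mem_compl_iff, ← hcompl, mem_union]
  have hUVn : ∀ z ∈ U, z ∉ V := fun _ hz => Set.disjoint_left.1 hUV hz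
  have h0J : (0 : ℂ) ∉ J := (hmem 0).1 (Or.inl h0)
  have hUcompl : Uᶜ = closure V := by
    rw [closure_eq_self_union_frontier, hVJ]
    ext z
    have := hmem z
    have := hUVn z
    simp only [mem_compl_iff, mem_union]
    tauto
  have hVcompl : Vᶜ = U ∪ J := by
    ext z
    have := hmem z
    have := hUVn z
    simp only [mem_compl_iff, mem_union]
    tauto
  have hVb : Bornology.IsBounded Vᶜ := hVcompl ▸ hUb.union hJ.isCompact.isBounded
  obtain ⟨G₁, hc₁, hi₁, him₁, hs₁, hz₁⟩ := hJ.exists_caratheodory hU hUc hUb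
    (hUcompl ▸ hVc.isPreconnected.closure) hUJ h0
  obtain ⟨p', q', hJ'⟩ := hJ.inv h0J
  have hcompl' : (invDomain V)ᶜ = (fun w => (G₁ w)⁻¹) '' (closedBall 0 1 \ {0}) := by
    have h1 : (invDomain V)ᶜ = Inv.inv '' ((U ∪ J) \ {0}) := by
      ext z
      rcases eq_or_ne z 0 with rfl | hz
      · simp [invDomain]
      · simp only [mem_compl_iff, mem_invDomain hz, image_inv_eq_inv, Set.mem_inv, Set.mem_sdiff,
          ← hVcompl]
        simp [hz]
    rw [h1, ← him₁, ← image_image Inv.inv G₁, hi₁.image_sdiff_subset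
      (singleton_subset_iff.2 (mem_closedBall_self zero_le_one)), image_singleton, hz₁]
  have hne₁ : ∀ w ∈ closedBall (0 : ℂ) 1 \ {0}, G₁ w ≠ 0 := fun w hw h =>
    hw.2 (hi₁ hw.1 (mem_closedBall_self zero_le_one) (h.trans hz₁.symm))
  obtain ⟨G₂, hc₂, hi₂, him₂, hs₂, hz₂⟩ := hJ'.exists_caratheodory (isOpen_invDomain hV hVb)
    (isConnected_invDomain hVc hVb (hUVn 0 h0))
    (isBounded_invDomain (mem_of_superset (hU.mem_nhds h0) hUVn))
    (hcompl' ▸ isPreconnected_closedBall_diff_zero.image _ ((hc₁.mono sdiff_subset).inv₀ hne₁))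
    ((frontier_invDomain hV hVb (hVJ ▸ h0J)).trans (by rw [hVJ])) (mem_insert _ _)
  have hball : G₂ '' ball 0 1 = invDomain V := by
    have h1 : Disjoint (invDomain V) (Inv.inv '' J) := by
      have h2 := (isOpen_invDomain hV hVb).inter_frontier_eq
      rw [frontier_invDomain hV hVb (hVJ ▸ h0J), hVJ] at h2
      exact Set.disjoint_iff_inter_eq_empty.2 h2
    rw [← closedBall_sdiff_sphere, hi₂.image_sdiff_subset sphere_subset_closedBall, him₂, hs₂,
      union_sdiff_right, h1.sdiff_eq_left]
  have hs0 : ∀ u ∈ sphere (0 : ℂ) 1, G₁ u ≠ 0 := fun u hu h =>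
    h0J (hs₁.subset ⟨u, hu, h⟩)
  rw [← hs₁]
  refine exists_homeomorph_of_glue hc₁ hc₂ hi₁ hi₂ hs0 hz₁ hz₂ ?_ ?_ ?_
  · rw [hs₂, ← hs₁, image_image]
  · intro x hx y hy
    rcases eq_or_ne y 0 with hy0 | hy0
    · exact Or.inr hy0
    refine Or.inl fun h => ?_
    have h1 : G₂ y ∈ invDomain V := hball ▸ mem_image_of_mem _ hy
    have h2 : G₂ y ≠ 0 := fun h => hy0 (hi₂ (ball_subset_closedBall hy)
      (mem_closedBall_self zero_le_one) (h.trans hz₂.symm))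
    rw [mem_invDomain h2, ← h] at h1
    have h3 : G₁ x ∈ Vᶜ := hVcompl ▸ him₁ ▸ mem_image_of_mem _ hx
    exact h3 h1
  · intro z
    rw [him₁, hball, ← hVcompl]
    by_cases hz : z ∈ V
    · exact Or.inr (Or.inr (mem_image_of_mem _ hz))
    · exact Or.inl hz

/-- The Schoenflies theorem in the complex plane. -/
theorem exists_homeomorph_image_sphere {p : ℂ → ℂ} (hp : ContinuousOn p (sphere 0 1))
    (hi : InjOn p (sphere 0 1)) : ∃ Φ : ℂ ≃ₜ ℂ, Φ '' sphere 0 1 = p '' sphere 0 1 := by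
  have hJ := IsJordan.of_injOn hp hi
  obtain ⟨U, V, hU, hV, hUc, hVc, hUb, -, hUV, hcompl, hUJ, hVJ⟩ := hJ.exists_interior_exterior
  obtain ⟨z₀, hz₀⟩ := hUc.nonempty
  set e : ℂ ≃ₜ ℂ := Homeomorph.subRight z₀ with he
  have hiso : Isometry e := fun x y => by simp [he]
  have hJe := IsJordan.of_injOn (e.continuous.comp_continuousOn hp) (e.injective.comp_injOn hi)
  rw [image_comp] at hJe
  obtain ⟨Φ, hΦ⟩ := hJe.exists_homeomorph_of_zero_mem (U := e '' U) (V := e '' V)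
    (e.isOpenMap U hU) (e.isOpenMap V hV) (hUc.image e e.continuous.continuousOn)
    (hVc.image e e.continuous.continuousOn) (hiso.lipschitz.isBounded_image hUb)
    ((disjoint_image_iff e.injective).2 hUV)
    (by rw [← image_union, hcompl, image_compl_eq e.bijective])
    (by rw [← e.image_frontier, hUJ]) (by rw [← e.image_frontier, hVJ]) ⟨z₀, hz₀, by simp [he]⟩
  refine ⟨Φ.trans e.symm, ?_⟩
  change (e.symm ∘ Φ) '' sphere 0 1 = _
  rw [image_comp, hΦ, image_image]
  simp

end Schoenflies

theorem stmt_5 (γ : Set Plane)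
    (hγ : ∃ g : Circle2 → Plane, Continuous g ∧ Function.Injective g ∧ range g = γ) :
    ∃ f : Plane ≃ₜ Plane, f '' γ = Metric.sphere (0 : Plane) 1 := by
  classical
  obtain ⟨g, hg, hgi, rfl⟩ := hγ
  let L : ℂ ≃ₗᵢ[ℝ] Plane := Complex.orthonormalBasisOneI.repr
  have hL : ∀ z : ℂ, z ∈ sphere (0 : ℂ) 1 ↔ L z ∈ Circle2 := fun z => by
    rw [mem_sphere_zero_iff_norm, mem_sphere_zero_iff_norm, L.norm_map]
  let p : ℂ → ℂ := fun z => if h : z ∈ sphere (0 : ℂ) 1 then L.symm (g ⟨L z, (hL z).1 h⟩) else 0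
  have hpe : ∀ z (h : z ∈ sphere (0 : ℂ) 1), p z = L.symm (g ⟨L z, (hL z).1 h⟩) :=
    fun z h => dif_pos h
  have hpc : ContinuousOn p (sphere 0 1) := by
    rw [continuousOn_iff_continuous_domRestrict]
    refine Continuous.congr (f := fun z : sphere (0 : ℂ) 1 => L.symm (g ⟨L z, (hL z).1 z.2⟩)) ?_
      fun z => (hpe z z.2).symm
    exact L.symm.continuous.comp (hg.comp ((L.continuous.comp continuous_subtype_val).subtype_mk _))
  have hpi : InjOn p (sphere 0 1) := fun z hz w hw h => by
    rw [hpe z hz, hpe w hw] at h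
    exact L.injective (congrArg Subtype.val (hgi (L.symm.injective h)))
  have hpr : L '' (p '' sphere 0 1) = range g := by
    rw [image_image]
    ext y
    constructor
    · rintro ⟨z, hz, rfl⟩
      exact ⟨⟨L z, (hL z).1 hz⟩, by simp only [hpe z hz, L.apply_symm_apply]⟩
    · rintro ⟨x, rfl⟩
      have hx : L.symm x.1 ∈ sphere (0 : ℂ) 1 := (hL _).2 (by rw [L.apply_symm_apply]; exact x.2)
      exact ⟨L.symm x.1, hx, by simp only [hpe _ hx, L.apply_symm_apply]⟩
  obtain ⟨Φ, hΦ⟩ := Schoenflies.exists_homeomorph_image_sphere hpc hpi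
  refine ⟨L.symm.toHomeomorph.trans (Φ.symm.trans L.toHomeomorph), ?_⟩
  rw [← hpr, ← hΦ, image_image, image_image]
  ext y
  simp only [Homeomorph.trans_apply, LinearIsometryEquiv.coe_toHomeomorph,
    L.symm_apply_apply, Φ.symm_apply_apply]
  exact ⟨fun ⟨z, hz, h⟩ => h ▸ (hL z).1 hz, fun h => ⟨L.symm y, (hL _).2
    (by rw [L.apply_symm_apply]; exact h), L.apply_symm_apply y⟩⟩
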